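/- Let k be a finite field with q elements and let n be a positive integer. Then h(GL_n(k)) lies in the subring ℤ[q⁻¹] of ℚ; that is, there exists a non-negative integer m such that q^m · h(GL_n(k)) is an integer. -/

import Mathlib

/-- The set of pairs (χ, d) where χ is the character of an irreducible (simple) complex
representation of `G` and `d` is its degree. Distinct irreducible characters correspond to
distinct isomorphism classes, so this set is in bijection with `Irr(G)`. -/
noncomputable def irrCharDegSet (G : Type) [Group G] : Set ((G → ℂ) × ℕ) :=
  {p | ∃ V : FDRep ℂ G, CategoryTheory.Simple V ∧ p.1 = V.character ∧ p.2 = Module.finrank ℂ V}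

/-- `h(G)`: the product of the sizes of all conjugacy classes of `G` divided by the
product of the degrees of all irreducible complex characters of `G`. -/
noncomputable def groupH (G : Type) [Group G] : ℚ :=
  (∏ᶠ c : ConjClasses G, (c.carrier.ncard : ℚ)) / (∏ᶠ p ∈ irrCharDegSet G, (p.2 : ℚ))

open CategoryTheory

section CharacterTheory

variable {G : Type} [Group G]

/-- The character of some finite-dimensional complex representation. -/
def IsCharacter (f : G → ℂ) : Prop := ∃ V : FDRep ℂ G, V.character = f

/-- The character of some simple finite-dimensional complex representation. -/
def IsIrrCharacter (f : G → ℂ) : Prop := ∃ V : FDRep ℂ G, Simple V ∧ V.character = f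

lemma IsIrrCharacter.isCharacter {f : G → ℂ} (h : IsIrrCharacter f) : IsCharacter f :=
  let ⟨V, _, hV⟩ := h
  ⟨V, hV⟩

/-- A representation on any finite-dimensional space gives a character. -/
lemma isCharacter_of_representation {V : Type} [AddCommGroup V] [Module ℂ V]
    [FiniteDimensional ℂ V] (ρ : Representation ℂ G V) : IsCharacter ρ.character :=
  ⟨FDRep.of ρ, rfl⟩

lemma IsCharacter.conj_mul {f : G → ℂ} (hf : IsCharacter f) (g h : G) : f (h * g * h⁻¹) = f g := by
  obtain ⟨V, rfl⟩ := hf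
  exact V.char_conj g h

lemma IsCharacter.mul {f g : G → ℂ} (hf : IsCharacter f) (hg : IsCharacter g) :
    IsCharacter (f * g) := by
  obtain ⟨V, rfl⟩ := hf
  obtain ⟨W, rfl⟩ := hg
  exact ⟨MonoidalCategory.tensorObj V W, FDRep.char_tensor V W⟩

lemma IsCharacter.comp {H : Type} [Group H] {f : G → ℂ} (hf : IsCharacter f) (φ : H →* G) :
    IsCharacter (f ∘ φ) := by
  obtain ⟨V, rfl⟩ := hf
  exact isCharacter_of_representation (MonoidHom.comp V.ρ φ)

/-- The averaged restriction of a character along a family of elements which is a group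
homomorphism `ι : U → G` normalised by `φ : H → G`. -/
lemma IsCharacter.average {H U : Type} [Group H] [Group U] [Fintype U] {f : G → ℂ}
    (hf : IsCharacter f) (φ : H →* G) (ι : U →* G)
    (hn : ∀ h : H, ∃ e : U ≃ U, ∀ u, φ h * ι u = ι (e u) * φ h) :
    IsCharacter fun h => (Nat.card U : ℂ)⁻¹ * ∑ u, f (ι u * φ h) := by
  obtain ⟨V, rfl⟩ := hf
  let σ : Representation ℂ U V := MonoidHom.comp V.ρ ι
  let E := σ.averageMap
  have hE : LinearMap.IsProj σ.invariants E := Representation.isProj_averageMap σ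
  have hmap : ∀ h : H, ∀ v ∈ σ.invariants, V.ρ (φ h) v ∈ σ.invariants := by
    intro h v hv u
    obtain ⟨e, he⟩ := hn h
    obtain ⟨u', rfl⟩ := e.surjective u
    have h1 : V.ρ (ι (e u')) (V.ρ (φ h) v) = V.ρ (φ h) (V.ρ (ι u') v) := by
      rw [← Module.End.mul_apply, ← Module.End.mul_apply, ← map_mul, ← map_mul, he]
    exact h1.trans (congrArg _ (hv u'))
  let τ : Representation ℂ H σ.invariants :=
    { toFun := fun h => (V.ρ (φ h)).restrict (hmap h)
      map_one' := LinearMap.ext fun v => Subtype.ext (by simp)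
      map_mul' := fun a b => LinearMap.ext fun v => Subtype.ext (by simp) }
  refine ⟨FDRep.of τ, funext fun h => ?_⟩
  have h1 : LinearMap.trace ℂ σ.invariants ((V.ρ (φ h)).restrict (hmap h)) =
      LinearMap.trace ℂ V (E ∘ₗ V.ρ (φ h)) := by
    rw [← LinearMap.trace_restrict_eq_of_forall_mem σ.invariants (E ∘ₗ V.ρ (φ h))
      fun v => hE.map_mem _]
    congr 1
    ext v
    exact (hE.map_id _ (hmap h v v.2)).symm
  have h2 : E ∘ₗ V.ρ (φ h) = (Nat.card U : ℂ)⁻¹ • ∑ u, V.ρ (ι u * φ h) := by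
    have h3 : E = (Nat.card U : ℂ)⁻¹ • ∑ u, V.ρ (ι u) := by
      simp [E, Representation.averageMap, GroupAlgebra.average, σ]
    rw [h3]
    ext v
    simp
  change LinearMap.trace ℂ σ.invariants ((V.ρ (φ h)).restrict (hmap h)) = _
  rw [h1, h2]
  simp [FDRep.character]

variable [Fintype G]

open scoped ComplexConjugate Matrix ComplexOrder in
lemma FDRep.character_inv (V : FDRep ℂ G) (g : G) : V.character g⁻¹ = conj (V.character g) := by
  classical
  let b := Module.finBasis ℂ V
  let M : G → Matrix _ _ ℂ := fun g => LinearMap.toMatrix b b (V.ρ g)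
  have hM : ∀ g h, M (g * h) = M g * M h := fun g h => by
    simp [M, LinearMap.toMatrix_mul]
  have hM1 : M 1 = 1 := by simp [M]
  have htr : ∀ g, V.character g = (M g).trace := fun g =>
    LinearMap.trace_eq_matrix_trace ℂ b _
  let P : Matrix _ _ ℂ := ∑ h, (M h)ᴴ * M h
  have hP : P.PosDef := by
    have h1 : P = (M 1)ᴴ * M 1 + ∑ h ∈ Finset.univ.erase 1, (M h)ᴴ * M h := by
      exact (Finset.add_sum_erase _ (fun h => (M h)ᴴ * M h) (Finset.mem_univ _)).symm
    rw [h1, hM1]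
    refine Matrix.PosDef.add_posSemidef (by simpa using Matrix.PosDef.one) ?_
    exact Matrix.posSemidef_sum _ fun h _ => Matrix.posSemidef_conjTranspose_mul_self _
  have hinv : (M g)ᴴ * P * M g = P := by
    simp only [P, Finset.mul_sum, Finset.sum_mul]
    refine (Fintype.sum_equiv (Equiv.mulRight g) _ _ fun h => ?_)
    simp [hM, Matrix.mul_assoc]
  have hu : IsUnit P.det := (Matrix.isUnit_iff_isUnit_det _).1 hP.isUnit
  have hgg : M g * M g⁻¹ = 1 := by rw [← hM]; simp [hM1]
  have h2 : M g⁻¹ = P⁻¹ * (M g)ᴴ * P := by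
    have : (M g)ᴴ * P = P * M g⁻¹ := by
      conv_rhs => rw [← hinv]
      rw [Matrix.mul_assoc, hgg, Matrix.mul_one]
    rw [Matrix.mul_assoc, this, ← Matrix.mul_assoc, Matrix.nonsing_inv_mul _ hu, Matrix.one_mul]
  rw [htr, htr, h2, Matrix.trace_mul_cycle, Matrix.mul_nonsing_inv _ hu, Matrix.one_mul,
    Matrix.trace_conjTranspose]
  rfl

/-- The bilinear pairing `|G|⁻¹ ∑ f(x) g(x)`. -/
noncomputable def pairing (f g : G → ℂ) : ℂ := (Nat.card G : ℂ)⁻¹ * ∑ x, f x * g x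

lemma IsCharacter.star_apply {f : G → ℂ} (hf : IsCharacter f) (x : G) :
    (star f) x = f x⁻¹ := by
  obtain ⟨V, rfl⟩ := hf
  exact (FDRep.character_inv V x).symm

noncomputable instance : Invertible (Nat.card G : ℂ) :=
  invertibleOfNonzero (by exact_mod_cast Nat.card_pos.ne')

lemma IsCharacter.pairing_nat {f g : G → ℂ} (hf : IsCharacter f) (hg : IsCharacter g) :
    ∃ n : ℕ, pairing f (star g) = n := by
  simp only [pairing, hg.star_apply]
  obtain ⟨V, rfl⟩ := hf
  obtain ⟨W, rfl⟩ := hg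
  exact ⟨_, FDRep.scalar_product_char_eq_finrank_equivariant W V⟩

open scoped Classical in
lemma IsIrrCharacter.pairing {f g : G → ℂ} (hf : IsIrrCharacter f) (hg : IsIrrCharacter g) :
    pairing f (star g) = if f = g then 1 else 0 := by
  simp only [_root_.pairing, hg.isCharacter.star_apply]
  obtain ⟨V, hV, rfl⟩ := hf
  obtain ⟨W, hW, rfl⟩ := hg
  have h := FDRep.char_orthonormal V W
  have h' := FDRep.char_orthonormal V V
  rw [h]
  rw [if_pos ⟨Iso.refl _⟩] at h'
  by_cases hVW : Nonempty (V ≅ W)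
  · rw [if_pos hVW, if_pos (FDRep.char_iso hVW.some)]
  · rw [if_neg hVW] at h ⊢
    rw [if_neg]
    intro h1
    rw [← h1, h'] at h
    exact one_ne_zero h

omit [Group G] in
lemma pairing_sum_left {ι : Type*} (s : Finset ι) (c : ι → ℂ) (F : ι → G → ℂ) (g : G → ℂ) :
    pairing (fun x => ∑ i ∈ s, c i * F i x) g = ∑ i ∈ s, c i * pairing (F i) g := by
  simp only [pairing, Finset.sum_mul, Finset.mul_sum]
  rw [Finset.sum_comm]
  refine Finset.sum_congr rfl fun i _ => Finset.sum_congr rfl fun x _ => by ring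

/-- Schur's lemma: a linear map commuting with an irreducible representation is a scalar. -/
lemma Representation.IsIrreducible.exists_eq_smul_id {G V : Type} [Group G] [AddCommGroup V]
    [Module ℂ V] [FiniteDimensional ℂ V] (ρ : Representation ℂ G V) [ρ.IsIrreducible]
    (T : V →ₗ[ℂ] V) (hT : ∀ g v, T (ρ g v) = ρ g (T v)) : ∃ c : ℂ, T = c • LinearMap.id := by
  let f := T.intertwiningMap_of_isIntertwiningMap (ρ := ρ) (σ := ρ) hT
  obtain ⟨c, hc⟩ :=
    (Representation.IsIrreducible.algebraMap_intertwiningMap_bijective_of_isAlgClosed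
      (k := ℂ) (ρ := ρ)).2 f
  refine ⟨c, LinearMap.ext fun v => ?_⟩
  have := congrArg (fun φ : Representation.IntertwiningMap ρ ρ => φ v) hc
  exact this.symm

lemma Representation.IsIrreducible.isIrrCharacter {V : Type} [AddCommGroup V]
    [Module ℂ V] [FiniteDimensional ℂ V] (ρ : Representation ℂ G V) [ρ.IsIrreducible] :
    IsIrrCharacter ρ.character := by
  refine ⟨FDRep.of ρ, (FDRep.simple_iff_char_is_norm_one _).2 ?_, rfl⟩
  have h := Representation.char_orthonormal ρ ρ
  rw [if_pos ⟨Representation.Equiv.refl ρ⟩] at h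
  have h0 : (Nat.card G : ℂ) ≠ 0 := by exact_mod_cast Nat.card_pos.ne'
  rw [inv_mul_eq_iff_eq_mul₀ h0, mul_one] at h
  exact h

open scoped MonoidAlgebra in
/-- The representation of `G` on a module over the group algebra. -/
noncomputable def groupAlgebraRep (M : Type) [AddCommGroup M] [Module ℂ M] [Module ℂ[G] M]
    [IsScalarTower ℂ ℂ[G] M] : Representation ℂ G M where
  toFun g :=
    { toFun := fun m => MonoidAlgebra.single g (1 : ℂ) • m
      map_add' := smul_add _
      map_smul' := fun c m => by
        rw [RingHom.id_apply, ← smul_assoc c, ← one_smul ℂ[G] m, ← smul_assoc c, ← mul_smul,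
          ← mul_smul, mul_one, mul_smul_comm, mul_one] }
  map_one' := LinearMap.ext fun m => one_smul ℂ[G] m
  map_mul' g h := LinearMap.ext fun m => by
    simp [← mul_smul, MonoidAlgebra.single_mul_single]

open scoped MonoidAlgebra in
omit [Fintype G] in
lemma groupAlgebraRep_isIrreducible (M : Type) [AddCommGroup M] [Module ℂ M] [Module ℂ[G] M]
    [IsScalarTower ℂ ℂ[G] M] [IsSimpleModule ℂ[G] M] :
    (groupAlgebraRep (G := G) M).IsIrreducible := by
  have hnt : Nontrivial M := IsSimpleModule.nontrivial ℂ[G] M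
  refine { exists_pair_ne := ⟨⊥, ⊤, fun h => ?_⟩, eq_bot_or_eq_top := fun S => ?_ }
  · obtain ⟨m, hm⟩ := exists_ne (0 : M)
    have : m ∈ (⊥ : Subrepresentation (groupAlgebraRep (G := G) M)) := by rw [h]; trivial
    exact hm this
  · let N : Submodule ℂ[G] M :=
      { S.toSubmodule with
        smul_mem' := fun c x hx => by
          induction c using MonoidAlgebra.induction_linear with
          | zero => rw [zero_smul]; exact S.toSubmodule.zero_mem
          | add a b ha hb => rw [add_smul]; exact S.toSubmodule.add_mem ha hb
          | single y c =>
            have : MonoidAlgebra.single y c • x = c • MonoidAlgebra.single y (1 : ℂ) • x := by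
              rw [← smul_assoc, MonoidAlgebra.smul_single, smul_eq_mul, mul_one]
            rw [this]
            exact S.toSubmodule.smul_mem c (S.apply_mem_toSubmodule y hx) }
    rcases eq_bot_or_eq_top N with h | h
    · left
      ext x
      exact SetLike.ext_iff.1 h x
    · right
      ext x
      exact SetLike.ext_iff.1 h x

open scoped MonoidAlgebra in
/-- A class function orthogonal to the characters of irreducible representations vanishes. -/
lemma eq_zero_of_forall_irreducible {f : G → ℂ} (hf : ∀ x y, f (y * x * y⁻¹) = f x)
    (h : ∀ (V : Type) [AddCommGroup V] [Module ℂ V] [FiniteDimensional ℂ V]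
      (ρ : Representation ℂ G V) [ρ.IsIrreducible], pairing f (star ρ.character) = 0) : f = 0 := by
  classical
  let z : ℂ[G] := ∑ x, MonoidAlgebra.single x⁻¹ (f x)
  have hz : ∀ w : ℂ[G], z * w = w * z := by
    intro w
    induction w using MonoidAlgebra.induction_linear with
    | zero => simp
    | add a b ha hb => rw [mul_add, add_mul, ha, hb]
    | single y c =>
      simp only [z, Finset.sum_mul, Finset.mul_sum, MonoidAlgebra.single_mul_single]
      refine Fintype.sum_equiv (MulAut.conj y⁻¹).toEquiv _ _ fun x => ?_
      have : f (y⁻¹ * (x * y)) = f x := by simpa [mul_assoc] using hf x y⁻¹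
      simp [this, mul_comm, mul_assoc]
  have hzM : ∀ M : Submodule ℂ[G] ℂ[G], IsSimpleModule ℂ[G] M → ∀ m ∈ M, z * m = 0 := by
    intro M hM m hm
    have : FiniteDimensional ℂ M :=
      inferInstanceAs (FiniteDimensional ℂ (M.restrictScalars ℂ))
    let ρ : Representation ℂ G M := groupAlgebraRep M
    have hρ : ρ.IsIrreducible := groupAlgebraRep_isIrreducible M
    have hT := h _ ρ
    let T : M →ₗ[ℂ] M := ∑ x, f x • ρ x⁻¹
    have hTz : ∀ w, T w = z • w := by
      intro w
      simp only [T, z, Finset.sum_smul, LinearMap.sum_apply, LinearMap.smul_apply]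
      refine Finset.sum_congr rfl fun x _ => ?_
      change f x • (MonoidAlgebra.single x⁻¹ (1 : ℂ) • w) = _
      rw [← smul_assoc, MonoidAlgebra.smul_single, smul_eq_mul, mul_one]
    obtain ⟨c, hc⟩ := Representation.IsIrreducible.exists_eq_smul_id ρ T fun g v => by
      rw [hTz, hTz]
      change z • (MonoidAlgebra.single g (1 : ℂ) • v) = MonoidAlgebra.single g (1 : ℂ) • (z • v)
      rw [← mul_smul, ← mul_smul, hz]
    have htr : LinearMap.trace ℂ _ T = 0 := by
      have h0 : (Nat.card G : ℂ) ≠ 0 := by exact_mod_cast Nat.card_pos.ne'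
      have h1 := (mul_eq_zero.1 hT).resolve_left (inv_ne_zero h0)
      simp only [(isCharacter_of_representation ρ).star_apply] at h1
      simpa [T, Representation.character] using h1
    have hc0 : c = 0 := by
      rw [hc, map_smul, LinearMap.trace_id, smul_eq_mul, mul_eq_zero] at htr
      refine htr.resolve_right ?_
      have : Nontrivial M := IsSimpleModule.nontrivial ℂ[G] M
      exact_mod_cast (Module.finrank_pos (R := ℂ) (M := M)).ne'
    have h2 := hTz ⟨m, hm⟩
    rw [hc, hc0, zero_smul, LinearMap.zero_apply] at h2
    simpa using congrArg Subtype.val h2.symm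
  have hz0 : z = 0 := by
    have htop := IsSemisimpleModule.sSup_simples_eq_top ℂ[G] ℂ[G]
    let φ : ℂ[G] →ₗ[ℂ[G]] ℂ[G] :=
      { toFun := fun w => z * w
        map_add' := mul_add z
        map_smul' := fun r x => by simp [← mul_assoc, hz r] }
    have hle : sSup {N : Submodule ℂ[G] ℂ[G] | IsSimpleModule ℂ[G] N} ≤ LinearMap.ker φ :=
      sSup_le fun N hN x hx => hzM N hN x hx
    have h1 : (1 : ℂ[G]) ∈ LinearMap.ker φ := hle (by rw [htop]; trivial)
    simpa [φ] using h1
  funext x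
  have := congrArg (fun w : ℂ[G] => w.coeff x⁻¹) hz0
  simpa [z, Finsupp.single_apply] using this

lemma eq_zero_of_pairing_eq_zero {f : G → ℂ} (hf : ∀ x y, f (y * x * y⁻¹) = f x)
    (h : ∀ χ : G → ℂ, IsIrrCharacter χ → pairing f (star χ) = 0) : f = 0 :=
  eq_zero_of_forall_irreducible hf fun _ _ _ _ ρ _ =>
    h _ (Representation.IsIrreducible.isIrrCharacter ρ)

lemma IsIrrCharacter.exists_representation {f : G → ℂ} (hf : IsIrrCharacter f) :
    ∃ (V : Type) (_ : AddCommGroup V) (_ : Module ℂ V) (_ : FiniteDimensional ℂ V)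
      (ρ : Representation ℂ G V), ρ.IsIrreducible ∧ ρ.character = f := by
  by_contra! hne
  have h0 : f = 0 := eq_zero_of_forall_irreducible
    (fun x y => hf.isCharacter.conj_mul x y) fun V _ _ h4 ρ hρ => by
      rw [hf.pairing (Representation.IsIrreducible.isIrrCharacter ρ), if_neg]
      exact fun h => hne V _ _ h4 ρ hρ h.symm
  have h1 := hf.pairing hf
  rw [if_pos rfl, h0] at h1
  simp [_root_.pairing] at h1

lemma linearIndependent_isIrrCharacter :
    LinearIndependent ℂ (Subtype.val : {f : G → ℂ // IsIrrCharacter f} → G → ℂ) := by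
  classical
  refine linearIndependent_iff'.2 fun s c hc i hi => ?_
  have h : pairing (fun x => ∑ j ∈ s, c j * j.1 x) (star i.1) = 0 := by
    have : (fun x => ∑ j ∈ s, c j * j.1 x) = 0 := by
      rw [← hc]
      ext x
      simp
    rw [this]
    simp [pairing]
  rw [pairing_sum_left] at h
  simp only [fun j : {f : G → ℂ // IsIrrCharacter f} => j.2.pairing i.2] at h
  simpa [Subtype.val_inj, hi] using h

lemma finite_setOf_isIrrCharacter : {f : G → ℂ | IsIrrCharacter f}.Finite :=
  Set.finite_coe_iff.1 linearIndependent_isIrrCharacter.finite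

variable (G) in
/-- The finite set of irreducible characters. -/
noncomputable def irrChars : Finset (G → ℂ) :=
  (finite_setOf_isIrrCharacter (G := G)).toFinset

lemma mem_irrChars {f : G → ℂ} : f ∈ irrChars G ↔ IsIrrCharacter f := by
  simp [irrChars]

/-- Class functions expand in irreducible characters. -/
lemma classFunction_expand {f : G → ℂ} (hf : ∀ x y, f (y * x * y⁻¹) = f x) (x : G) :
    f x = ∑ χ ∈ irrChars G, pairing f (star χ) * χ x := by
  classical
  have h : (fun x => f x - ∑ χ ∈ irrChars G, pairing f (star χ) * χ x) = 0 := by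
    refine eq_zero_of_pairing_eq_zero (fun x y => ?_) fun χ hχ => ?_
    · rw [hf]
      congr 1
      exact Finset.sum_congr rfl fun χ hχ => by
        rw [(mem_irrChars.1 hχ).isCharacter.conj_mul]
    · have h1 : pairing (fun x => f x - ∑ χ ∈ irrChars G, pairing f (star χ) * χ x) (star χ) =
          pairing f (star χ) -
            pairing (fun x => ∑ χ ∈ irrChars G, pairing f (star χ) * χ x) (star χ) := by
        simp only [pairing, sub_mul, Finset.sum_sub_distrib, mul_sub]
      rw [h1, pairing_sum_left (irrChars G) (fun χ => pairing f (star χ)) (fun χ => χ),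
        Finset.sum_eq_single χ, hχ.pairing hχ, if_pos rfl, mul_one, sub_self]
      · intro χ' h' hne
        rw [(mem_irrChars.1 h').pairing hχ, if_neg hne, mul_zero]
      · exact fun h => absurd (mem_irrChars.2 hχ) h
  exact sub_eq_zero.1 (congrFun h x)

end CharacterTheory

section DeterminantCriterion

open Polynomial

variable {G : Type} [Group G]

lemma IsCharacter.apply_out {χ : G → ℂ} (hχ : IsCharacter χ) (x : G) :
    χ (Quotient.out (ConjClasses.mk x)) = χ x := by
  have : IsConj (Quotient.out (ConjClasses.mk x)) x :=
    ConjClasses.mk_eq_mk_iff_isConj.1 (Quotient.out_eq _)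
  obtain ⟨y, hy⟩ := isConj_iff.1 this
  exact (hχ.conj_mul _ y).symm.trans (congrArg χ hy)

variable [Fintype G]

lemma IsIrrCharacter.exists_degree {χ : G → ℂ} (hχ : IsIrrCharacter χ) :
    ∃ d : ℕ, 0 < d ∧ χ 1 = d := by
  obtain ⟨V, _, _, _, ρ, hρ, rfl⟩ := hχ.exists_representation
  have : Nontrivial V := by
    by_contra hV
    have := not_nontrivial_iff_subsingleton.1 hV
    obtain ⟨a, b, hab⟩ := hρ.exists_pair_ne
    exact hab (SetLike.ext fun v => by
      rw [Subsingleton.elim v 0]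
      exact iff_of_true a.toSubmodule.zero_mem b.toSubmodule.zero_mem)
  exact ⟨Module.finrank ℂ V, Module.finrank_pos, by simp [Representation.character]⟩

lemma IsIrrCharacter.apply_one_ne_zero {χ : G → ℂ} (hχ : IsIrrCharacter χ) : χ 1 ≠ 0 := by
  obtain ⟨d, hd, h⟩ := hχ.exists_degree
  rw [h]
  exact_mod_cast hd.ne'

open Classical in
/-- Class sums act on irreducible representations by scalars. -/
lemma IsIrrCharacter.sum_class_mul {χ : G → ℂ} (hχ : IsIrrCharacter χ) (c : ConjClasses G)
    (g : G) : ∑ h with ConjClasses.mk h = c, χ (h * g) =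
      (∑ h with ConjClasses.mk h = c, χ h) / χ 1 * χ g := by
  have h1 := hχ.apply_one_ne_zero
  obtain ⟨V, _, _, _, ρ, hρ, rfl⟩ := hχ.exists_representation
  let T : V →ₗ[ℂ] V := ∑ h with ConjClasses.mk h = c, ρ h
  obtain ⟨z, hz⟩ := Representation.IsIrreducible.exists_eq_smul_id ρ T fun x v => by
    simp only [T, LinearMap.sum_apply, map_sum]
    refine Finset.sum_bij' (fun h _ => x⁻¹ * h * x) (fun h _ => x * h * x⁻¹) ?_ ?_ ?_ ?_ ?_
    · intro h hh
      simp only [Finset.mem_filter_univ] at hh ⊢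
      rw [← hh, ConjClasses.mk_eq_mk_iff_isConj]
      exact (isConj_iff.2 ⟨x, by group⟩)
    · intro h hh
      simp only [Finset.mem_filter_univ] at hh ⊢
      rw [← hh, ConjClasses.mk_eq_mk_iff_isConj]
      exact (isConj_iff.2 ⟨x⁻¹, by group⟩)
    · intro h _
      group
    · intro h _
      group
    · intro h _
      rw [← Module.End.mul_apply, ← Module.End.mul_apply, ← map_mul, ← map_mul]
      congr 2
      group
  have key : ∀ g, ∑ h with ConjClasses.mk h = c, ρ.character (h * g) = z * ρ.character g := by
    intro g
    have : ∑ h with ConjClasses.mk h = c, ρ.character (h * g) =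
        LinearMap.trace ℂ V (T * ρ g) := by
      simp [T, Finset.sum_mul, Representation.character]
    rw [this, hz]
    change LinearMap.trace ℂ V (z • ρ g) = _
    simp [Representation.character]
  have k1 := key 1
  simp only [mul_one] at k1
  rw [key, k1, mul_div_cancel_right₀ _ h1]

open Classical in
/-- The character table and its inverse. -/
lemma exists_characterTable_inverse : ∃ Y : Matrix (ConjClasses G) (irrChars G) ℂ,
    (Matrix.of fun (χ : irrChars G) (c : ConjClasses G) => χ.1 (Quotient.out c)) * Y = 1 ∧
    Y * (Matrix.of fun (χ : irrChars G) (c : ConjClasses G) => χ.1 (Quotient.out c)) = 1 := by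
  let δ : ConjClasses G → G → ℂ := fun c x => if ConjClasses.mk x = c then 1 else 0
  refine ⟨Matrix.of fun c χ => pairing (δ c) (star χ.1), ?_, ?_⟩
  · ext χ χ'
    have h1 := pairing_sum_left Finset.univ (fun c : ConjClasses G => χ.1 (Quotient.out c)) δ
      (star χ'.1)
    have h2 : (fun x => ∑ c : ConjClasses G, χ.1 (Quotient.out c) * δ c x) = χ.1 := by
      ext x
      simp [δ, (mem_irrChars.1 χ.2).isCharacter.apply_out]
    rw [h2, (mem_irrChars.1 χ.2).pairing (mem_irrChars.1 χ'.2)] at h1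
    simp only [Matrix.mul_apply, Matrix.of_apply, Matrix.one_apply, ← h1, Subtype.ext_iff]
  · ext c d
    have h1 : δ c (Quotient.out d) = _ := classFunction_expand (f := δ c) (fun x y => by
      have : ConjClasses.mk (y * x * y⁻¹) = ConjClasses.mk x :=
        ConjClasses.mk_eq_mk_iff_isConj.2 (isConj_iff.2 ⟨y⁻¹, by group⟩)
      simp only [δ, this]) (Quotient.out d)
    have h2 : ConjClasses.mk (Quotient.out d) = d := Quotient.out_eq d
    rw [← Finset.sum_coe_sort] at h1
    rw [Matrix.mul_apply, Matrix.one_apply]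
    refine h1.symm.trans ?_
    simp only [δ, h2, eq_comm]

open Classical in
lemma groupH_eq : (groupH G : ℂ) =
    (∏ c : ConjClasses G, (c.carrier.ncard : ℂ)) / ∏ χ : irrChars G, χ.1 1 := by
  have h1 : ((∏ᶠ p ∈ irrCharDegSet G, (p.2 : ℚ) : ℚ) : ℂ) = ∏ χ : irrChars G, χ.1 1 := by
    have h2 : ∏ᶠ p ∈ irrCharDegSet G, (p.2 : ℚ) =
        ∏ᶠ χ ∈ (irrChars G : Set (G → ℂ)), (⌊Complex.re (χ 1)⌋ : ℚ) := by
      refine finprod_mem_eq_of_bijOn Prod.fst ⟨?_, ?_, ?_⟩ ?_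
      · rintro p ⟨V, hV, h, -⟩
        exact mem_irrChars.2 ⟨V, hV, h.symm⟩
      · rintro p ⟨V, hV, h, h'⟩ p' ⟨V', hV', k, k'⟩ hp
        refine Prod.ext hp ?_
        have h3 := congrFun (h.symm.trans (hp.trans k)) 1
        rw [FDRep.char_one, FDRep.char_one] at h3
        rw [h', k']
        exact_mod_cast h3
      · intro χ hχ
        obtain ⟨V, hV, h⟩ := mem_irrChars.1 hχ
        exact ⟨(χ, Module.finrank ℂ V), ⟨V, hV, h.symm, rfl⟩, rfl⟩
      · rintro p ⟨V, hV, h, h'⟩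
        rw [h, h', FDRep.char_one]
        simp
    rw [h2, finprod_mem_coe_finset, ← Finset.prod_coe_sort]
    push_cast
    refine Finset.prod_congr rfl fun χ _ => ?_
    obtain ⟨d, -, hd⟩ := (mem_irrChars.1 χ.2).exists_degree
    simp [hd]
  rw [groupH, Rat.cast_div, h1, finprod_eq_prod_of_fintype]
  push_cast
  rfl

open Classical in
/-- The determinant of multiplication on the class functions, over a polynomial ring. -/
lemma exists_det_eq (S : Subring ℂ) (a : G → S[X]) :
    ∃ D : S[X], D.map S.subtype = C (groupH G : ℂ) *
      ∏ χ : irrChars G, ∑ g, (a g).map S.subtype * C (χ.1 g) := by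
  obtain ⟨Y, hXY, hYX⟩ := exists_characterTable_inverse (G := G)
  set X₀ : Matrix (irrChars G) (ConjClasses G) ℂ := Matrix.of fun χ c => χ.1 (Quotient.out c)
  let A : Matrix (ConjClasses G) (ConjClasses G) S[X] := Matrix.of fun c d =>
    ∑ h with ConjClasses.mk h = d, ∑ g, if ConjClasses.mk (h * g) = c then a g else 0
  let P : irrChars G → ℂ[X] := fun χ => ∑ g, (a g).map S.subtype * C (χ.1 g)
  have hA : X₀.map C * A.map (mapRingHom S.subtype) =
      Matrix.diagonal (fun χ => P χ * C (χ.1 1)⁻¹) * X₀.map C *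
        Matrix.diagonal (fun c : ConjClasses G => C (c.carrier.ncard : ℂ)) := by
    ext1 χ d
    rw [Matrix.mul_diagonal, Matrix.diagonal_mul]
    have hχ := mem_irrChars.1 χ.2
    have h1 : ∀ g, ∑ h with ConjClasses.mk h = d, χ.1 (h * g) =
        (d.carrier.ncard * χ.1 (Quotient.out d)) / χ.1 1 * χ.1 g := by
      intro g
      rw [hχ.sum_class_mul]
      congr 2
      rw [Finset.sum_congr rfl (g := fun _ => χ.1 (Quotient.out d)) fun h hh => by
        rw [← (Finset.mem_filter.1 hh).2, hχ.isCharacter.apply_out], Finset.sum_const,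
        nsmul_eq_mul]
      congr 2
      rw [← Set.ncard_coe_finset]
      congr 1
      ext x
      simp [ConjClasses.mem_carrier_iff_mk_eq]
    have h2 : (X₀.map C * A.map (mapRingHom S.subtype)) χ d =
        ∑ g, (a g).map S.subtype * C (∑ h with ConjClasses.mk h = d, χ.1 (h * g)) := by
      simp only [Matrix.mul_apply, Matrix.map_apply, X₀, A, Matrix.of_apply, map_sum,
        Finset.mul_sum]
      rw [Finset.sum_comm]
      rw [Finset.sum_comm (s := Finset.univ (α := G))]
      refine Finset.sum_congr rfl fun h _ => ?_
      rw [Finset.sum_comm]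
      refine Finset.sum_congr rfl fun g _ => ?_
      rw [Finset.sum_eq_single (ConjClasses.mk (h * g))]
      · rw [if_pos rfl, hχ.isCharacter.apply_out, coe_mapRingHom, mul_comm]
      · intro c _ hc
        rw [if_neg (Ne.symm hc), map_zero, mul_zero]
      · simp
    rw [h2]
    simp only [h1, P, Finset.sum_mul, Matrix.map_apply, X₀, Matrix.of_apply]
    refine Finset.sum_congr rfl fun g _ => ?_
    simp only [div_eq_mul_inv, map_mul]
    ring
  have hYX' : Y.map (C : ℂ →+* ℂ[X]) * X₀.map (C : ℂ →+* ℂ[X]) = 1 := by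
    rw [← Matrix.map_mul, hYX]
    simp
  have hXY' : X₀.map (C : ℂ →+* ℂ[X]) * Y.map (C : ℂ →+* ℂ[X]) = 1 := by
    rw [← Matrix.map_mul, hXY]
    simp
  refine ⟨A.det, ?_⟩
  have h1 : A.map (mapRingHom S.subtype) = Y.map C *
      Matrix.diagonal (fun χ => P χ * C (χ.1 1)⁻¹) * X₀.map C *
        Matrix.diagonal (fun c : ConjClasses G => C (c.carrier.ncard : ℂ)) := by
    rw [Matrix.mul_assoc, Matrix.mul_assoc, ← Matrix.mul_assoc (Matrix.diagonal _), ← hA,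
      ← Matrix.mul_assoc, hYX', Matrix.one_mul]
  have h2 : A.det.map S.subtype = (A.map (mapRingHom S.subtype)).det := by
    rw [← coe_mapRingHom, RingHom.map_det]
    rfl
  rw [h2, h1, Matrix.det_mul, Matrix.det_conj_of_mul_eq_one hYX' hXY', Matrix.det_diagonal,
    Matrix.det_diagonal, groupH_eq, Finset.prod_mul_distrib, div_eq_mul_inv, map_mul, map_prod,
    ← Finset.prod_inv_distrib, map_prod]
  ring

/-- If every irreducible character takes the value `1` under a functional with coefficients in
a subring `S` taking integral values on all irreducible characters, then `h(G) ∈ S`. -/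
lemma groupH_mem (S : Subring ℂ)
    (hS : ∀ χ ∈ irrChars G, ∃ a : G → ℂ, (∀ g, a g ∈ S) ∧
      (∀ χ' ∈ irrChars G, ∃ z : ℤ, ∑ g, a g * χ' g = z) ∧ ∑ g, a g * χ g = 1) :
    (groupH G : ℂ) ∈ S := by
  classical
  choose! a haS haZ ha1 using hS
  choose! z hz using haZ
  let e := Fintype.equivFin (irrChars G)
  let b : G → S[X] := fun g => ∑ χ : irrChars G,
    C (⟨a χ.1 g, haS χ.1 χ.2 g⟩ : S) * X ^ (e χ : ℕ)
  let p : irrChars G → ℤ[X] := fun χ => ∑ ψ : irrChars G, C (z ψ.1 χ.1) * X ^ (e ψ : ℕ)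
  have hp : ∀ χ : irrChars G,
      ∑ g, (b g).map S.subtype * C (χ.1 g) = (p χ).map (Int.castRingHom ℂ) := by
    intro χ
    simp only [b, p, Polynomial.map_sum, Polynomial.map_mul, map_C, Polynomial.map_pow, map_X,
      Finset.sum_mul]
    rw [Finset.sum_comm]
    refine Finset.sum_congr rfl fun ψ _ => ?_
    rw [eq_intCast, ← hz ψ.1 ψ.2 χ.1 χ.2, map_sum, Finset.sum_mul]
    refine Finset.sum_congr rfl fun g _ => ?_
    simp only [Subring.subtype_apply, map_mul]
    ring
  have hprim : ∀ χ, (p χ).IsPrimitive := by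
    intro χ r hr
    rw [C_dvd_iff_dvd_coeff] at hr
    have h1 : (p χ).coeff (e χ) = 1 := by
      have h2 : ∀ ψ : irrChars G, ((e χ : ℕ) = (e ψ : ℕ)) ↔ ψ = χ := fun ψ => by
        rw [Fin.val_inj, e.injective.eq_iff, eq_comm]
      simp only [p, finsetSum_coeff, coeff_C_mul, coeff_X_pow, h2, mul_ite, mul_one, mul_zero,
        Finset.sum_ite_eq', Finset.mem_univ, if_true]
      have h3 := hz χ.1 χ.2 χ.1 χ.2
      rw [ha1 χ.1 χ.2] at h3
      exact_mod_cast h3.symm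
    exact isUnit_of_dvd_one (h1 ▸ hr (e χ))
  have hprod : (∏ χ, p χ).IsPrimitive := by
    refine Finset.prod_induction p IsPrimitive (fun _ _ => IsPrimitive.mul) isPrimitive_one
      fun χ _ => hprim χ
  obtain ⟨D, hD⟩ := exists_det_eq S b
  simp only [hp, ← Polynomial.map_prod] at hD
  have hcoeff : ∀ i, (groupH G : ℂ) * ((∏ χ, p χ).coeff i : ℤ) ∈ S := by
    intro i
    have h1 := congrArg (fun f => coeff f i) hD
    simp only [coeff_map, coeff_C_mul, eq_intCast] at h1
    rw [← h1]
    exact (D.coeff i).2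
  let J : Ideal ℤ :=
    { carrier := {n | (groupH G : ℂ) * (n : ℂ) ∈ S}
      add_mem' := fun {m n} hm hn => by
        simp only [Set.mem_ofPred_eq, Int.cast_add, mul_add] at *
        exact S.add_mem hm hn
      zero_mem' := by simp
      smul_mem' := fun m n hn => by
        simp only [Set.mem_ofPred_eq, smul_eq_mul, Int.cast_mul] at *
        rw [mul_left_comm]
        exact S.mul_mem (intCast_mem S m) hn }
  have hunit : IsUnit (Submodule.IsPrincipal.generator J) := by
    refine hprod _ ((C_dvd_iff_dvd_coeff _ _).2 fun i => ?_)
    exact (Submodule.IsPrincipal.mem_iff_generator_dvd J).1 (hcoeff i)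
  have h1 : (1 : ℤ) ∈ J :=
    (Submodule.IsPrincipal.mem_iff_generator_dvd J).2 hunit.dvd
  have h2 : (groupH G : ℂ) * ((1 : ℤ) : ℂ) ∈ S := h1
  simpa using h2

end DeterminantCriterion

/-- Structure constants of a graded positive self-adjoint Hopf algebra with a distinguished
multiplicative function `gen` on its basis taking the values `0` and `1`. -/
structure PSHData (Ω : Type) where
  /-- The degree. -/
  deg : Ω → ℕ
  /-- The finite set of basis elements of degree at most a given bound. -/
  ball : ℕ → Finset Ω
  mem_ball : ∀ {N e}, e ∈ ball N ↔ deg e ≤ N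
  /-- The structure constants. -/
  c : Ω → Ω → Ω → ℕ
  deg_eq : ∀ {a b e}, c a b e ≠ 0 → deg e = deg a + deg b
  /-- The unit. -/
  one : Ω
  deg_one : deg one = 0
  eq_one : ∀ {a}, deg a = 0 → a = one
  c_one_left_self : ∀ a, c one a a = 1
  c_one_right_self : ∀ a, c a one a = 1
  c_one_left_ne : ∀ {a e}, a ≠ e → c one a e = 0
  c_one_right_ne : ∀ {a e}, a ≠ e → c a one e = 0
  assoc : ∀ {N a b d}, deg a + deg b + deg d ≤ N → ∀ x,
    ∑ e ∈ ball N, c a b e * c e d x = ∑ e ∈ ball N, c b d e * c a e x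
  hopf : ∀ {N a b}, deg a + deg b ≤ N → ∀ x y,
    ∑ e ∈ ball N, c a b e * c x y e = ∑ p ∈ ball N, ∑ q ∈ ball N, ∑ r ∈ ball N, ∑ s ∈ ball N,
      c p q a * c r s b * (c p r x * c q s y)
  /-- The distinguished multiplicative function. -/
  gen : Ω → ℕ
  gen_le_one : ∀ a, gen a ≤ 1
  gen_one : gen one = 1
  gen_mul : ∀ {N a b}, deg a + deg b ≤ N → ∑ e ∈ ball N, c a b e * gen e = gen a * gen b
  exists_gen : ∀ {x}, 0 < deg x → ∃ s b, gen s = 1 ∧ 0 < deg s ∧ c b s x ≠ 0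

namespace PSHData

variable {Ω : Type} (H : PSHData Ω)

lemma deg_pos {a : Ω} (h : a ≠ H.one) : 0 < H.deg a :=
  Nat.pos_of_ne_zero fun h' => h (H.eq_one h')

lemma c_eq_zero {a b e : Ω} (h : H.deg e ≠ H.deg a + H.deg b) : H.c a b e = 0 := by
  by_contra h'
  exact h (H.deg_eq h')

/-- The Hopf axiom forces commutativity. -/
lemma c_comm (a b e : Ω) : H.c a b e = H.c b a e := by
  classical
  induction hn : H.deg a + H.deg b using Nat.strong_induction_on generalizing a b e with
  | _ n ih =>
    by_cases ha : a = H.one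
    · subst ha
      by_cases hb : b = e
      · rw [hb, H.c_one_left_self, H.c_one_right_self]
      · rw [H.c_one_left_ne hb, H.c_one_right_ne hb]
    by_cases hb : b = H.one
    · subst hb
      by_cases hb : a = e
      · rw [hb, H.c_one_left_self, H.c_one_right_self]
      · rw [H.c_one_left_ne hb, H.c_one_right_ne hb]
    have hA : ∀ p q, H.c p q a = H.c q p a := fun p q => by
      by_cases h : H.deg a = H.deg p + H.deg q
      · exact ih _ (by have := H.deg_pos hb; omega) p q a rfl
      · rw [H.c_eq_zero h, H.c_eq_zero (by omega)]
    have hB : ∀ p q, H.c p q b = H.c q p b := fun p q => by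
      by_cases h : H.deg b = H.deg p + H.deg q
      · exact ih _ (by have := H.deg_pos ha; omega) p q b rfl
      · rw [H.c_eq_zero h, H.c_eq_zero (by omega)]
    have key : ∀ x y N, (∀ p q, H.c p q x = H.c q p x) → (∀ p q, H.c p q y = H.c q p y) →
        ∑ p ∈ H.ball N, ∑ q ∈ H.ball N, ∑ r ∈ H.ball N, ∑ s ∈ H.ball N,
          H.c p q x * H.c r s y * (H.c p r x * H.c q s y) =
        ∑ p ∈ H.ball N, ∑ q ∈ H.ball N, ∑ r ∈ H.ball N, ∑ s ∈ H.ball N,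
          H.c p q x * H.c r s y * (H.c p r y * H.c q s x) := by
      intro x y N hx hy
      rw [Finset.sum_comm]
      refine Finset.sum_congr rfl fun p _ => Finset.sum_congr rfl fun q _ => ?_
      rw [Finset.sum_comm]
      refine Finset.sum_congr rfl fun r _ => Finset.sum_congr rfl fun s _ => ?_
      rw [hx q p, hy s r]
      ring
    have hX := H.hopf (le_refl (H.deg a + H.deg b)) a b
    have hY := H.hopf (le_refl (H.deg a + H.deg b)) b a
    have hZ := H.hopf (le_of_eq (add_comm (H.deg b) (H.deg a))) b a
    rw [key a b _ hA hB] at hX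
    rw [key b a _ hB hA] at hZ
    have hYY : ∑ e ∈ H.ball (H.deg a + H.deg b), H.c b a e * H.c a b e =
        ∑ e ∈ H.ball (H.deg a + H.deg b), H.c a b e * H.c b a e :=
      Finset.sum_congr rfl fun e _ => mul_comm _ _
    have hW := H.hopf (le_of_eq (add_comm (H.deg b) (H.deg a))) a b
    by_cases he : H.deg e = H.deg a + H.deg b
    · have h0 : ∑ e ∈ H.ball (H.deg a + H.deg b), ((H.c a b e : ℤ) - H.c b a e) ^ 2 = 0 := by
        have h1 : ∑ e ∈ H.ball (H.deg a + H.deg b), H.c a b e * H.c a b e =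
            ∑ e ∈ H.ball (H.deg a + H.deg b), H.c a b e * H.c b a e := hX.trans hY.symm
        have h2 : ∑ e ∈ H.ball (H.deg a + H.deg b), H.c b a e * H.c b a e =
            ∑ e ∈ H.ball (H.deg a + H.deg b), H.c a b e * H.c b a e :=
          (hZ.trans hW.symm).trans hYY
        zify at h1 h2
        have h3 : ∀ e, ((H.c a b e : ℤ) - H.c b a e) ^ 2 = H.c a b e * H.c a b e +
            H.c b a e * H.c b a e - 2 * (H.c a b e * H.c b a e) := fun e => by ring
        simp only [h3, Finset.sum_add_distrib, Finset.sum_sub_distrib, h1, h2, ← Finset.mul_sum]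
        ring
      rw [Finset.sum_eq_zero_iff_of_nonneg fun _ _ => sq_nonneg _] at h0
      have h1 := h0 e (H.mem_ball.2 he.le)
      have h2 := pow_eq_zero_iff two_ne_zero |>.1 h1
      omega
    · rw [H.c_eq_zero he, H.c_eq_zero (by omega)]

/-- The product of two basis elements. -/
noncomputable def mulBasis (a b : Ω) : Ω →₀ ℤ :=
  Finsupp.onFinset (H.ball (H.deg a + H.deg b)) (fun e => (H.c a b e : ℤ)) fun e he =>
    H.mem_ball.2 (H.deg_eq (by exact_mod_cast he)).le

@[simp]
lemma mulBasis_apply (a b e : Ω) : H.mulBasis a b e = H.c a b e := rfl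

/-- The adjoint of multiplication by `s`, on basis elements. -/
noncomputable def adjBasis (s x : Ω) : Ω →₀ ℤ :=
  Finsupp.onFinset (H.ball (H.deg x)) (fun b => (H.c b s x : ℤ)) fun b hb =>
    H.mem_ball.2 (by have := H.deg_eq (a := b) (b := s) (e := x) (by exact_mod_cast hb); omega)

@[simp]
lemma adjBasis_apply (s x b : Ω) : H.adjBasis s x b = H.c b s x := rfl

/-- The bilinear multiplication. -/
noncomputable def mul : (Ω →₀ ℤ) →ₗ[ℤ] (Ω →₀ ℤ) →ₗ[ℤ] (Ω →₀ ℤ) :=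
  Finsupp.linearCombination ℤ fun a => Finsupp.linearCombination ℤ fun b => H.mulBasis a b

/-- The adjoint of multiplication by the basis element `s`. -/
noncomputable def adj (s : Ω) : (Ω →₀ ℤ) →ₗ[ℤ] (Ω →₀ ℤ) :=
  Finsupp.linearCombination ℤ fun x => H.adjBasis s x

@[simp]
lemma mul_single (a b : Ω) :
    H.mul (Finsupp.single a 1) (Finsupp.single b 1) = H.mulBasis a b := by
  simp [mul]

@[simp]
lemma adj_single (s x : Ω) : H.adj s (Finsupp.single x 1) = H.adjBasis s x := by
  simp [adj]

lemma apply_eq_sum {M : Type*} [AddCommGroup M] (φ : (Ω →₀ ℤ) →ₗ[ℤ] M) (f : Ω →₀ ℤ)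
    {s : Finset Ω} (hs : f.support ⊆ s) : φ f = ∑ e ∈ s, f e • φ (Finsupp.single e 1) := by
  have h1 : f = ∑ e ∈ s, f e • Finsupp.single e (1 : ℤ) := by
    conv_lhs => rw [← Finsupp.sum_single f, Finsupp.sum_of_support_subset f hs _ (by simp)]
    simp
  conv_lhs => rw [h1]
  rw [map_sum]
  exact Finset.sum_congr rfl fun e _ => map_smul φ _ _

lemma support_mulBasis {a b : Ω} {N : ℕ} (hN : H.deg a + H.deg b ≤ N) :
    (H.mulBasis a b).support ⊆ H.ball N := fun e he => by
  rw [Finsupp.mem_support_iff, mulBasis_apply] at he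
  rw [H.mem_ball, H.deg_eq (by exact_mod_cast he)]
  exact hN

lemma support_adjBasis {s x : Ω} {N : ℕ} (hN : H.deg x ≤ N) :
    (H.adjBasis s x).support ⊆ H.ball N := fun e he => by
  rw [Finsupp.mem_support_iff, adjBasis_apply] at he
  rw [H.mem_ball]
  have := H.deg_eq (a := e) (b := s) (e := x) (by exact_mod_cast he)
  omega

lemma mul_comm' (f g : Ω →₀ ℤ) : H.mul f g = H.mul g f := by
  have : H.mul = H.mul.flip := by
    ext a b e
    simp [H.c_comm a b e]
  conv_lhs => rw [this]
  rfl

lemma sum_comm_four (B : Finset Ω) (F : Ω → Ω → Ω → Ω → ℤ) :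
    ∑ p ∈ B, ∑ q ∈ B, ∑ r ∈ B, ∑ t ∈ B, F p q r t =
      ∑ q ∈ B, ∑ t ∈ B, ∑ p ∈ B, ∑ r ∈ B, F p q r t := by
  rw [Finset.sum_comm]
  exact Finset.sum_congr rfl fun q _ =>
    (Finset.sum_congr rfl fun p _ => Finset.sum_comm).trans Finset.sum_comm

lemma mul_adjBasis_apply {q t a b x : Ω} {M : ℕ} (ha : H.deg a ≤ M) (hb : H.deg b ≤ M) :
    (H.mul (H.adjBasis q a) (H.adjBasis t b)) x =
      ∑ p ∈ H.ball M, ∑ r ∈ H.ball M, (H.c p q a * (H.c r t b * H.c p r x) : ℤ) := by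
  rw [apply_eq_sum H.mul _ (H.support_adjBasis ha)]
  simp only [LinearMap.sum_apply, Finsupp.finsetSum_apply]
  refine Finset.sum_congr rfl fun p _ => ?_
  rw [LinearMap.smul_apply, apply_eq_sum (H.mul _) _ (H.support_adjBasis hb)]
  simp [Finset.mul_sum]

lemma adj_mulBasis_of_le {s a b : Ω} {M : ℕ} (hM : H.deg a + H.deg b ≤ M) :
    H.adj s (H.mulBasis a b) =
      ∑ q ∈ H.ball M, ∑ t ∈ H.ball M,
        (H.c q t s : ℤ) • H.mul (H.adjBasis q a) (H.adjBasis t b) := by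
  ext x
  have h2 := H.hopf hM x s
  zify at h2
  rw [apply_eq_sum (H.adj s) _ (H.support_mulBasis hM)]
  simp only [Finsupp.finsetSum_apply, Finsupp.smul_apply, adj_single, mulBasis_apply,
    adjBasis_apply, smul_eq_mul]
  rw [h2, sum_comm_four]
  refine Finset.sum_congr rfl fun q _ => Finset.sum_congr rfl fun t _ => ?_
  rw [H.mul_adjBasis_apply (M := M) (by omega) (by omega), Finset.mul_sum]
  refine Finset.sum_congr rfl fun p _ => ?_
  rw [Finset.mul_sum]
  refine Finset.sum_congr rfl fun r _ => ?_
  ring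

lemma sum_ball_eq {M : Type*} [AddCommGroup M] {s : Ω} {N N' : ℕ} (hN : H.deg s ≤ N)
    (hN' : N ≤ N') (F : Ω → Ω → M) :
    ∑ q ∈ H.ball N, ∑ t ∈ H.ball N, (H.c q t s : ℤ) • F q t =
      ∑ q ∈ H.ball N', ∑ t ∈ H.ball N', (H.c q t s : ℤ) • F q t := by
  have hc : ∀ {q t}, q ∉ H.ball N ∨ t ∉ H.ball N → H.c q t s = 0 := by
    intro q t h
    refine H.c_eq_zero ?_
    rw [H.mem_ball, H.mem_ball] at h
    omega
  have hsub : H.ball N ⊆ H.ball N' := fun e he => by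
    rw [H.mem_ball] at *
    omega
  have h1 : ∀ q, ∑ t ∈ H.ball N, (H.c q t s : ℤ) • F q t =
      ∑ t ∈ H.ball N', (H.c q t s : ℤ) • F q t := fun q =>
    Finset.sum_subset hsub fun t _ ht => by rw [hc (Or.inr ht), Nat.cast_zero, zero_smul]
  simp only [h1]
  exact Finset.sum_subset hsub fun q _ hq => Finset.sum_eq_zero fun t _ => by
    rw [hc (Or.inl hq), Nat.cast_zero, zero_smul]

/-- The operator `adj s` applied to a product. -/
lemma adj_mul {s : Ω} {N : ℕ} (hN : H.deg s ≤ N) (f g : Ω →₀ ℤ) :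
    H.adj s (H.mul f g) =
      ∑ q ∈ H.ball N, ∑ t ∈ H.ball N, (H.c q t s : ℤ) • H.mul (H.adj q f) (H.adj t g) := by
  have h : H.mul.compr₂ (H.adj s) = ∑ q ∈ H.ball N, ∑ t ∈ H.ball N,
      (H.c q t s : ℤ) • (H.mul.compl₁₂ (H.adj q) (H.adj t)) := by
    refine Finsupp.lhom_ext' fun a => LinearMap.ext_ring (Finsupp.lhom_ext' fun b =>
      LinearMap.ext_ring ?_)
    have key := H.adj_mulBasis_of_le (s := s) (a := a) (b := b) (M := N + (H.deg a + H.deg b))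
      (Nat.le_add_left _ _)
    rw [← H.sum_ball_eq hN (Nat.le_add_right _ _)] at key
    simpa using key
  have := LinearMap.congr_fun₂ h f g
  simpa using this

/-- Composition of the adjoint operators. -/
lemma adj_adj {s t : Ω} {N : ℕ} (hN : H.deg s + H.deg t ≤ N) (f : Ω →₀ ℤ) :
    H.adj s (H.adj t f) = ∑ e ∈ H.ball N, H.c s t e • H.adj e f := by
  have key : ∀ x, H.adj s (H.adjBasis t x) = ∑ e ∈ H.ball N, H.c s t e • H.adjBasis e x := by
    intro x
    ext b
    let M := N + H.deg x + H.deg b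
    have hsub : H.ball N ⊆ H.ball M := fun e he => by
      rw [H.mem_ball] at *
      omega
    have h1 := H.assoc (N := M) (a := b) (b := s) (d := t) (by omega) x
    zify at h1
    rw [apply_eq_sum (H.adj s) _ (H.support_adjBasis (N := M) (by omega)),
      Finset.sum_subset hsub fun e _ he => by
        rw [H.c_eq_zero (fun h => he (H.mem_ball.2 (h.le.trans hN))), zero_smul]]
    simp only [Finsupp.finsetSum_apply, Finsupp.smul_apply, adj_single, adjBasis_apply,
      smul_eq_mul, nsmul_eq_mul]
    rw [← h1]
    exact Finset.sum_congr rfl fun e _ => mul_comm _ _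
  have h : H.adj s ∘ₗ H.adj t = ∑ e ∈ H.ball N, H.c s t e • H.adj e := by
    ext1 x
    ext1
    simpa using key x
  simpa using LinearMap.congr_fun h f

end PSHData

namespace PSHData

variable {Ω : Type} (H : PSHData Ω)

/-- The basis elements on which `gen` takes the value `1`. -/
def Gen : Type := {s : Ω // H.gen s = 1}

namespace Gen

variable {H}

/-- The underlying basis element. -/
def val (s : H.Gen) : Ω := Subtype.val s

lemma gen_val (s : H.Gen) : H.gen s.val = 1 := s.2

lemma val_injective : Function.Injective (val : H.Gen → Ω) := Subtype.val_injective

/-- Factors of a constituent on which `gen` is nonzero. -/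
lemma gen_of_c_ne_zero {a b e : Ω} (h : H.c a b e ≠ 0) (he : H.gen e = 1) :
    H.gen a = 1 ∧ H.gen b = 1 := by
  have h1 := H.gen_mul (le_refl (H.deg a + H.deg b))
  have h2 : H.c a b e * H.gen e ≤ H.gen a * H.gen b :=
    h1 ▸ Finset.single_le_sum (f := fun e => H.c a b e * H.gen e) (fun _ _ => Nat.zero_le _)
      (H.mem_ball.2 (H.deg_eq h).le)
  have ha := H.gen_le_one a
  have hb := H.gen_le_one b
  rw [he] at h2
  interval_cases H.gen a <;> interval_cases H.gen b <;> omega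

lemma exists_mul (a b : H.Gen) : ∃ e : H.Gen, H.c a.val b.val e.val = 1 ∧
    ∀ e' : H.Gen, H.c a.val b.val e'.val ≠ 0 → e' = e := by
  classical
  have h1 := H.gen_mul (le_refl (H.deg a.val + H.deg b.val))
  rw [a.gen_val, b.gen_val, mul_one] at h1
  obtain ⟨e, he, hne⟩ := Finset.exists_ne_zero_of_sum_ne_zero (h1 ▸ one_ne_zero)
  have he1 : H.gen e = 1 := by
    have := H.gen_le_one e
    have := right_ne_zero_of_mul hne
    omega
  rw [← Finset.add_sum_erase _ _ he, he1, mul_one] at h1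
  have hc := left_ne_zero_of_mul hne
  refine ⟨⟨e, he1⟩, ?_, fun e' he' => ?_⟩
  · change H.c a.val b.val e = 1
    omega
  · by_contra hee
    have h2 := Finset.single_le_sum (f := fun e => H.c a.val b.val e * H.gen e)
      (fun _ _ => Nat.zero_le _) (Finset.mem_erase.2
        ⟨fun h => hee (val_injective h), H.mem_ball.2 (H.deg_eq he').le⟩ :
        e'.val ∈ (H.ball (H.deg a.val + H.deg b.val)).erase e)
    simp only [e'.gen_val, mul_one] at h2
    omega

noncomputable instance : Mul H.Gen := ⟨fun a b => (exists_mul a b).choose⟩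

instance : One H.Gen := ⟨⟨H.one, H.gen_one⟩⟩

lemma c_mul (a b : H.Gen) : H.c a.val b.val (a * b).val = 1 := (exists_mul a b).choose_spec.1

lemma eq_mul {a b e : H.Gen} (h : H.c a.val b.val e.val ≠ 0) : e = a * b :=
  (exists_mul a b).choose_spec.2 e h

lemma exists_of_c_ne_zero {a b : Ω} {e : H.Gen} (h : H.c a b e.val ≠ 0) :
    ∃ a' b' : H.Gen, a'.val = a ∧ b'.val = b ∧ e = a' * b' :=
  have h1 := gen_of_c_ne_zero h e.gen_val
  ⟨⟨a, h1.1⟩, ⟨b, h1.2⟩, rfl, rfl, eq_mul (a := ⟨a, h1.1⟩) (b := ⟨b, h1.2⟩) h⟩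

noncomputable instance : CommMonoid H.Gen where
  mul_assoc a b d := by
    have h1 := H.assoc (le_refl (H.deg a.val + H.deg b.val + H.deg d.val)) (a * b * d).val
    have h2 : H.deg (a * b).val = H.deg a.val + H.deg b.val := H.deg_eq (by rw [c_mul]; simp)
    have h3 := Finset.single_le_sum
      (f := fun e => H.c a.val b.val e * H.c e d.val (a * b * d).val)
      (fun _ _ => Nat.zero_le _) (H.mem_ball.2 (h2.le.trans (Nat.le_add_right _ (H.deg d.val))))
    rw [h1] at h3
    simp only [c_mul, mul_one] at h3
    obtain ⟨e, -, hne⟩ := Finset.exists_ne_zero_of_sum_ne_zero (Nat.one_le_iff_ne_zero.1 h3)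
    obtain ⟨a', e', ha', rfl, h⟩ := exists_of_c_ne_zero (right_ne_zero_of_mul hne)
    rw [h, ← eq_mul (left_ne_zero_of_mul hne), val_injective ha']
  one_mul a := (eq_mul (a := 1) (b := a) (e := a)
    (by rw [show (1 : H.Gen).val = H.one from rfl, H.c_one_left_self]; simp)).symm
  mul_one a := (eq_mul (a := a) (b := 1) (e := a)
    (by rw [show (1 : H.Gen).val = H.one from rfl, H.c_one_right_self]; simp)).symm
  mul_comm a b := eq_mul (by rw [H.c_comm, c_mul]; simp)

lemma deg_mul (a b : H.Gen) : H.deg (a * b).val = H.deg a.val + H.deg b.val :=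
  H.deg_eq (by rw [c_mul]; simp)

lemma deg_one : H.deg (1 : H.Gen).val = 0 := H.deg_one

lemma eq_one_of_deg {a : H.Gen} (h : H.deg a.val = 0) : a = 1 := val_injective (H.eq_one h)

lemma deg_pow (a : H.Gen) (m : ℕ) : H.deg (a ^ m).val = m * H.deg a.val := by
  induction m with
  | zero => simp [deg_one]
  | succ m ih => rw [pow_succ, deg_mul, ih]; ring

lemma eq_one_of_mul_eq_one {a b : H.Gen} (h : a * b = 1) : a = 1 ∧ b = 1 := by
  have h1 := deg_mul a b
  rw [h, deg_one] at h1
  exact ⟨eq_one_of_deg (by omega), eq_one_of_deg (by omega)⟩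

lemma isUnit_iff {a : H.Gen} : IsUnit a ↔ a = 1 :=
  ⟨fun h => let ⟨_, hb⟩ := isUnit_iff_exists_inv.1 h; (eq_one_of_mul_eq_one hb).1,
    fun h => h ▸ isUnit_one⟩

/-- The monoid of generic elements has the refinement property. -/
lemma refinement {u v s t : H.Gen} (h : u * v = s * t) :
    ∃ p q r w : H.Gen, s = p * q ∧ t = r * w ∧ u = p * r ∧ v = q * w := by
  have h1 := H.hopf (le_refl (H.deg s.val + H.deg t.val)) u.val v.val
  have h2 := Finset.single_le_sum
    (f := fun e => H.c s.val t.val e * H.c u.val v.val e)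
    (fun _ _ => Nat.zero_le _) (H.mem_ball.2 (deg_mul s t).le)
  rw [h1] at h2
  rw [c_mul, ← h, c_mul, mul_one] at h2
  obtain ⟨p, -, h2⟩ := Finset.exists_ne_zero_of_sum_ne_zero (Nat.one_le_iff_ne_zero.1 h2)
  obtain ⟨q, -, h2⟩ := Finset.exists_ne_zero_of_sum_ne_zero h2
  obtain ⟨r, -, h2⟩ := Finset.exists_ne_zero_of_sum_ne_zero h2
  obtain ⟨w, -, h2⟩ := Finset.exists_ne_zero_of_sum_ne_zero h2
  simp only [ne_eq, mul_eq_zero, not_or] at h2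
  obtain ⟨⟨k1, k2⟩, k3, k4⟩ := h2
  obtain ⟨p, q, rfl, rfl, hs⟩ := exists_of_c_ne_zero k1
  obtain ⟨r, w, rfl, rfl, ht⟩ := exists_of_c_ne_zero k2
  exact ⟨p, q, r, w, hs, ht, eq_mul k3, eq_mul k4⟩

lemma eq_one_or_eq_one {ρ a b : H.Gen} (hρ : Irreducible ρ) (h : ρ = a * b) : a = 1 ∨ b = 1 :=
  (hρ.isUnit_or_isUnit h).imp isUnit_iff.1 isUnit_iff.1

lemma deg_pos_of_irreducible {ρ : H.Gen} (hρ : Irreducible ρ) : 0 < H.deg ρ.val :=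
  Nat.pos_of_ne_zero fun h => hρ.not_isUnit (isUnit_iff.2 (eq_one_of_deg h))

lemma mul_irreducible_cancel {ρ u v : H.Gen} (hρ : Irreducible ρ) (h : u * ρ = v * ρ) : u = v := by
  obtain ⟨p, q, r, w, rfl, h1, rfl, h2⟩ := refinement h
  rcases eq_one_or_eq_one hρ h1 with rfl | rfl
  · rcases eq_one_or_eq_one hρ h2 with rfl | rfl
    · rfl
    · simp at h1
      exact absurd (isUnit_iff.2 h1) hρ.not_isUnit
  · rw [mul_one] at h1 h2
    rw [← h1, ← h2]

lemma dvd_or_dvd {ρ s t : H.Gen} (hρ : Irreducible ρ) (h : ρ ∣ s * t) : ρ ∣ s ∨ ρ ∣ t := by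
  obtain ⟨u, hu⟩ := h
  obtain ⟨p, q, r, w, rfl, rfl, -, h2⟩ := refinement ((mul_comm u ρ).trans hu.symm)
  rcases eq_one_or_eq_one hρ h2 with rfl | rfl
  · exact Or.inr ⟨r, by rw [h2, one_mul, mul_comm]⟩
  · exact Or.inl ⟨p, by rw [h2, mul_one, mul_comm]⟩

lemma mul_pow_cancel {ρ u v : H.Gen} (hρ : Irreducible ρ) (m : ℕ) (h : u * ρ ^ m = v * ρ ^ m) :
    u = v := by
  induction m with
  | zero => simpa using h
  | succ m ih =>
    rw [pow_succ, ← mul_assoc, ← mul_assoc] at h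
    exact ih (mul_irreducible_cancel hρ h)

lemma pow_injective {ρ : H.Gen} (hρ : Irreducible ρ) : Function.Injective fun m : ℕ => ρ ^ m := by
  intro i j h
  have := congrArg (fun s : H.Gen => H.deg s.val) h
  simp only [deg_pow] at this
  exact Nat.eq_of_mul_eq_mul_right (deg_pos_of_irreducible hρ) this

lemma exists_pow_of_mul_eq_pow {ρ a b : H.Gen} (hρ : Irreducible ρ) {m : ℕ} (h : a * b = ρ ^ m) :
    ∃ i j, i + j = m ∧ a = ρ ^ i ∧ b = ρ ^ j := by
  induction m generalizing a b with
  | zero =>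
    obtain ⟨rfl, rfl⟩ := eq_one_of_mul_eq_one (h.trans (pow_zero _))
    exact ⟨0, 0, rfl, by simp, by simp⟩
  | succ m ih =>
    rw [pow_succ] at h
    obtain ⟨p, q, r, w, rfl, rfl, h1, h2⟩ := refinement h.symm
    obtain ⟨i, j, rfl, rfl, rfl⟩ := ih h1.symm
    rcases eq_one_or_eq_one hρ h2 with rfl | rfl
    · rw [one_mul] at h2
      exact ⟨i, j + 1, by omega, by simp, by rw [pow_succ, h2]⟩
    · rw [mul_one] at h2
      exact ⟨i + 1, j, by omega, by rw [pow_succ, h2], by simp⟩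

lemma finite_factorizations (s : H.Gen) : {p : H.Gen × H.Gen | p.1 * p.2 = s}.Finite := by
  have hinj : Function.Injective (Prod.map val val : H.Gen × H.Gen → Ω × Ω) :=
    val_injective.prodMap val_injective
  refine Set.Finite.of_finite_image (f := Prod.map val val) (Set.Finite.subset
    ((H.ball (H.deg s.val)) ×ˢ (H.ball (H.deg s.val)) : Finset (Ω × Ω)).finite_toSet ?_)
    hinj.injOn
  rintro _ ⟨⟨a, b⟩, hab, rfl⟩
  have := deg_mul a b
  rw [show a * b = s from hab] at this
  simp only [Prod.map, Finset.coe_product, Set.mem_prod, Finset.mem_coe, H.mem_ball]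
  omega

/-- The adjoint of a generic element on a product. -/
lemma adj_mul (s : H.Gen) (f g : Ω →₀ ℤ) :
    H.adj s.val (H.mul f g) = ∑ p ∈ (finite_factorizations s).toFinset,
      H.mul (H.adj p.1.val f) (H.adj p.2.val g) := by
  rw [H.adj_mul le_rfl, ← Finset.sum_product']
  symm
  refine Finset.sum_of_injOn (Prod.map val val) (val_injective.prodMap val_injective).injOn
    ?_ ?_ ?_
  · rintro ⟨a, b⟩ hab
    have := deg_mul a b
    rw [show a * b = s by simpa using hab] at this
    simp only [Prod.map, Finset.coe_product, Set.mem_prod, Finset.mem_coe, H.mem_ball]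
    omega
  · rintro ⟨a, b⟩ - hab
    by_contra hne
    have hc : H.c a b s.val ≠ 0 := fun h => hne (by simp [h])
    obtain ⟨a', b', rfl, rfl, h⟩ := exists_of_c_ne_zero hc
    exact hab ⟨(a', b'), by simp [h], rfl⟩
  · rintro ⟨a, b⟩ hab
    have : a * b = s := by simpa using hab
    subst this
    simp [c_mul]

lemma adj_pow_mul {ρ : H.Gen} (hρ : Irreducible ρ) (m : ℕ) (f g : Ω →₀ ℤ) :
    H.adj (ρ ^ m).val (H.mul f g) = ∑ p ∈ Finset.HasAntidiagonal.antidiagonal m,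
      H.mul (H.adj (ρ ^ p.1).val f) (H.adj (ρ ^ p.2).val g) := by
  rw [adj_mul]
  symm
  refine Finset.sum_of_injOn (fun p => (ρ ^ p.1, ρ ^ p.2)) ?_ ?_ ?_ ?_
  · rintro ⟨i, j⟩ - ⟨i', j'⟩ - h
    simp only [Prod.mk.injEq] at h
    exact Prod.ext (pow_injective hρ h.1) (pow_injective hρ h.2)
  · rintro ⟨i, j⟩ h
    simp only [Finset.mem_coe, Finset.HasAntidiagonal.mem_antidiagonal] at h
    simp [← pow_add, h]
  · rintro ⟨a, b⟩ hab hn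
    obtain ⟨i, j, h, rfl, rfl⟩ := exists_pow_of_mul_eq_pow hρ (show a * b = ρ ^ m by simpa using hab)
    exact absurd ⟨(i, j), by simpa using h, rfl⟩ hn
  · intro p _
    rfl

/-- The adjoint of a generic element on a generic element. -/
lemma adjBasis_mul {u s : H.Gen} (h : ∀ v : H.Gen, v * s = u * s → v = u) :
    H.adjBasis s.val (u * s).val = Finsupp.single u.val 1 := by
  classical
  ext b
  rw [adjBasis_apply, Finsupp.single_apply]
  split_ifs with hb
  · rw [← hb, c_mul, Nat.cast_one]
  · by_contra hc
    obtain ⟨b', s', rfl, hs', h'⟩ := exists_of_c_ne_zero (by exact_mod_cast hc)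
    rw [val_injective hs'] at h'
    exact hb (congrArg val (h b' h'.symm)).symm

lemma adjBasis_eq_zero {s t : H.Gen} (h : ¬ s ∣ t) : H.adjBasis s.val t.val = 0 := by
  ext b
  by_contra hc
  obtain ⟨b', s', rfl, hs', h'⟩ := exists_of_c_ne_zero (a := b) (b := s.val) (e := t)
    (by simpa using hc)
  rw [val_injective hs'] at h'
  exact h ⟨b', by rw [h', mul_comm]⟩

end Gen

end PSHData

lemma sum_range_range_eq_sum_antidiagonal {M : Type*} [AddCommMonoid M] {N E : ℕ}
    {F : ℕ → ℕ → M} (hN : ∀ i e, N ≤ i → F i e = 0) (hE : ∀ i e, E ≤ e → F i e = 0) :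
    ∑ i ∈ Finset.range N, ∑ e ∈ Finset.range E, F i e =
      ∑ p ∈ Finset.range (N + E), ∑ x ∈ Finset.HasAntidiagonal.antidiagonal p, F x.1 x.2 := by
  rw [← Finset.sum_product', Finset.sum_sigma']
  refine Finset.sum_of_injOn (fun x => ⟨x.1 + x.2, x⟩) ?_ ?_ ?_ ?_
  · intro x _ y _ h
    simp only [Sigma.mk.injEq] at h
    exact eq_of_heq h.2
  · rintro ⟨i, e⟩ h
    simp only [Finset.coe_product, Set.mem_prod, Finset.mem_coe, Finset.mem_range] at h
    simp only [Finset.coe_sigma, Set.mem_sigma_iff, Finset.mem_coe, Finset.mem_range,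
      Finset.HasAntidiagonal.mem_antidiagonal, and_true]
    omega
  · rintro ⟨p, i, e⟩ h hn
    simp only [Finset.mem_sigma, Finset.mem_range, Finset.HasAntidiagonal.mem_antidiagonal] at h
    by_cases h1 : N ≤ i
    · exact hN _ _ h1
    by_cases h2 : E ≤ e
    · exact hE _ _ h2
    refine absurd ⟨(i, e), ?_, ?_⟩ hn
    · simp
      omega
    · rw [← h.2]
  · intro x _
    rfl

namespace PSHData

variable {Ω : Type} (H : PSHData Ω)

/-- The inner product for which the basis is orthonormal. -/
noncomputable def ip : (Ω →₀ ℤ) →ₗ[ℤ] (Ω →₀ ℤ) →ₗ[ℤ] ℤ :=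
  Finsupp.linearCombination ℤ fun a => Finsupp.lapply a

@[simp]
lemma ip_single (a : Ω) (f : Ω →₀ ℤ) : ip (Finsupp.single a 1) f = f a := by
  simp [ip]

lemma ip_comm (f g : Ω →₀ ℤ) : ip f g = ip g f := by
  classical
  have : (ip : (Ω →₀ ℤ) →ₗ[ℤ] _) = ip.flip := by
    refine Finsupp.lhom_ext' fun a => LinearMap.ext_ring (Finsupp.lhom_ext' fun b =>
      LinearMap.ext_ring ?_)
    simp [Finsupp.single_apply, eq_comm]
  conv_lhs => rw [this]
  rfl

lemma ip_self (f : Ω →₀ ℤ) : ip f f = ∑ e ∈ f.support, f e ^ 2 := by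
  rw [ip, Finsupp.linearCombination_apply, Finsupp.sum]
  simp [pow_two]

lemma sq_le_ip_self (f : Ω →₀ ℤ) (e : Ω) : f e ^ 2 ≤ ip f f := by
  rw [ip_self]
  by_cases h : e ∈ f.support
  · exact Finset.single_le_sum (f := fun e => f e ^ 2) (fun _ _ => sq_nonneg _) h
  · rw [Finsupp.notMem_support_iff.1 h]
    exact Finset.sum_nonneg fun _ _ => sq_nonneg _

lemma eq_single_of_ip_self_eq_one {f : Ω →₀ ℤ} (h0 : 0 ≤ f) (h : ip f f = 1) :
    ∃ e, f = Finsupp.single e 1 := by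
  classical
  have hne : f ≠ 0 := by
    rintro rfl
    simp at h
  obtain ⟨e, he⟩ := Finsupp.ne_iff.1 hne
  have hpos : 0 ≤ f e := h0 e
  have h1 : f e = 1 := by
    have := sq_le_ip_self f e
    rw [h] at this
    have : f e ≠ 0 := he
    nlinarith [Int.lt_iff_add_one_le.1 (lt_of_le_of_ne hpos this.symm)]
  refine ⟨e, Finsupp.ext fun x => ?_⟩
  rw [Finsupp.single_apply]
  split_ifs with hx
  · rw [← hx, h1]
  · by_contra hfx
    rw [ip_self, ← Finset.add_sum_erase _ _ (Finsupp.mem_support_iff.2 he)] at h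
    have h2 := Finset.single_le_sum (f := fun e => f e ^ 2) (fun _ _ => sq_nonneg _)
      (Finset.mem_erase.2 ⟨Ne.symm hx, Finsupp.mem_support_iff.2 hfx⟩)
    have h3 : 0 < f x ^ 2 := by positivity
    simp only [h1] at h h2
    omega

lemma ip_mul_single (f g : Ω →₀ ℤ) (s : Ω) :
    ip (H.mul f (Finsupp.single s 1)) g = ip f (H.adj s g) := by
  have : (ip.compl₂ (H.adj s)) = ip.comp (H.mul.flip (Finsupp.single s 1)) := by
    refine Finsupp.lhom_ext' fun a => LinearMap.ext_ring (Finsupp.lhom_ext' fun b =>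
      LinearMap.ext_ring ?_)
    simp only [LinearMap.coe_comp, Function.comp_apply, LinearMap.compl₂_apply,
      Finsupp.lsingle_apply, LinearMap.flip_apply, mul_single, adj_single, ip_single]
    rw [ip_comm, ip_single]
    simp
  exact (LinearMap.congr_fun₂ this f g).symm

lemma ip_single_mul (f g : Ω →₀ ℤ) (s : Ω) :
    ip (H.mul (Finsupp.single s 1) f) g = ip f (H.adj s g) := by
  rw [mul_comm', ip_mul_single]

lemma adjBasis_nonneg (s x : Ω) : 0 ≤ H.adjBasis s x := fun e => by simp

lemma mulBasis_nonneg (a b : Ω) : 0 ≤ H.mulBasis a b := fun e => by simp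

lemma map_nonneg_of_single {φ : (Ω →₀ ℤ) →ₗ[ℤ] (Ω →₀ ℤ)}
    (hφ : ∀ x, 0 ≤ φ (Finsupp.single x 1)) {f : Ω →₀ ℤ} (hf : 0 ≤ f) : 0 ≤ φ f := by
  rw [apply_eq_sum φ f (subset_refl _)]
  refine Finset.sum_nonneg fun e _ => fun x => ?_
  exact mul_nonneg (hf e) (hφ e x)

lemma adj_nonneg (s : Ω) {f : Ω →₀ ℤ} (hf : 0 ≤ f) : 0 ≤ H.adj s f :=
  map_nonneg_of_single (fun x => by rw [adj_single]; exact H.adjBasis_nonneg s x) hf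

lemma exists_of_adj_ne_zero {s b : Ω} {f : Ω →₀ ℤ} (h : H.adj s f b ≠ 0) :
    ∃ x, f x ≠ 0 ∧ H.c b s x ≠ 0 := by
  rw [apply_eq_sum (H.adj s) f (subset_refl _)] at h
  simp only [Finsupp.finsetSum_apply, adj_single, Finsupp.smul_apply, adjBasis_apply] at h
  obtain ⟨x, -, hx⟩ := Finset.exists_ne_zero_of_sum_ne_zero h
  exact ⟨x, left_ne_zero_of_mul hx, by exact_mod_cast right_ne_zero_of_mul hx⟩

lemma adj_comm (s t : Ω) (f : Ω →₀ ℤ) : H.adj s (H.adj t f) = H.adj t (H.adj s f) := by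
  rw [H.adj_adj le_rfl, H.adj_adj (add_comm _ _).le]
  simp only [H.c_comm s t]

lemma adj_one (f : Ω →₀ ℤ) : H.adj H.one f = f := by
  classical
  have : H.adj H.one = LinearMap.id := by
    refine Finsupp.lhom_ext' fun a => LinearMap.ext_ring (Finsupp.ext fun b => ?_)
    simp only [LinearMap.coe_comp, Function.comp_apply, Finsupp.lsingle_apply, adj_single,
      adjBasis_apply, LinearMap.id_apply, Finsupp.single_apply]
    split_ifs with h
    · rw [h, H.c_one_right_self, Nat.cast_one]
    · rw [H.c_one_right_ne (Ne.symm h), Nat.cast_zero]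
  rw [this, LinearMap.id_apply]

namespace Gen

variable {H}

/-- The generating series of the operators `adj (ρ ^ j)`. -/
noncomputable def adjSeries (ρ : H.Gen) : PowerSeries (Module.End ℤ (Ω →₀ ℤ)) :=
  PowerSeries.mk fun j => H.adj (ρ ^ j).val

/-- The coefficients of the inverse of `adjSeries`. -/
noncomputable def invAdj (ρ : H.Gen) (i : ℕ) : Module.End ℤ (Ω →₀ ℤ) :=
  PowerSeries.coeff i (PowerSeries.invOfUnit (adjSeries ρ) 1)

lemma invOfUnit_mul_adjSeries (ρ : H.Gen) :
    PowerSeries.invOfUnit (adjSeries ρ) 1 * adjSeries ρ = 1 := by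
  refine PowerSeries.invOfUnit_mul _ _ (LinearMap.ext fun f => ?_)
  rw [adjSeries, ← PowerSeries.coeff_zero_eq_constantCoeff_apply, PowerSeries.coeff_mk, pow_zero]
  exact H.adj_one f

lemma sum_invAdj_adj (ρ : H.Gen) (p : ℕ) (f : Ω →₀ ℤ) :
    ∑ x ∈ Finset.HasAntidiagonal.antidiagonal p, invAdj ρ x.1 (H.adj (ρ ^ x.2).val f) =
      if p = 0 then f else 0 := by
  have h := congrArg (PowerSeries.coeff p) (invOfUnit_mul_adjSeries ρ)
  rw [PowerSeries.coeff_mul, PowerSeries.coeff_one] at h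
  have h1 := LinearMap.congr_fun h f
  rw [LinearMap.sum_apply] at h1
  simp only [adjSeries, PowerSeries.coeff_mk] at h1
  refine h1.trans ?_
  split_ifs <;> rfl

lemma invAdj_zero (ρ : H.Gen) (f : Ω →₀ ℤ) : invAdj ρ 0 f = f := by
  have := sum_invAdj_adj ρ 0 f
  simp only [Finset.Nat.antidiagonal_zero, Finset.sum_singleton, pow_zero, if_true] at this
  rwa [show (1 : H.Gen).val = H.one from rfl, H.adj_one] at this

lemma adj_invAdj_comm (ρ : H.Gen) (s : Ω) (i : ℕ) (f : Ω →₀ ℤ) :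
    H.adj s (invAdj ρ i f) = invAdj ρ i (H.adj s f) := by
  induction i using Nat.strong_induction_on generalizing f with
  | _ i ih =>
    rcases Nat.eq_zero_or_pos i with rfl | hi
    · rw [invAdj_zero, invAdj_zero]
    have h1 := congrArg (H.adj s) (sum_invAdj_adj ρ i f)
    have h2 := sum_invAdj_adj ρ i (H.adj s f)
    rw [if_neg hi.ne', Finset.Nat.sum_antidiagonal_eq_sum_range_succ_mk,
      Finset.sum_range_succ] at h1 h2
    simp only [map_add, map_sum, Nat.sub_self, pow_zero, map_zero] at h1 h2
    rw [show (1 : H.Gen).val = H.one from rfl, H.adj_one] at h1 h2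
    rw [Finset.sum_congr rfl fun j hj => by
      rw [ih j (Finset.mem_range.1 hj), H.adj_comm]] at h1
    exact add_left_cancel (h1.trans h2.symm)

lemma invAdj_eq_zero {ρ : H.Gen} (hρ : Irreducible ρ) {i K : ℕ} (hi : K < i) {f : Ω →₀ ℤ}
    (hf : ∀ e, f e ≠ 0 → H.deg e ≤ K) : invAdj ρ i f = 0 := by
  induction i using Nat.strong_induction_on generalizing f K with
  | _ i ih =>
    have h2 := sum_invAdj_adj ρ i f
    rw [if_neg (by omega), Finset.Nat.sum_antidiagonal_eq_sum_range_succ_mk,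
      Finset.sum_range_succ] at h2
    simp only [Nat.sub_self, pow_zero] at h2
    rw [show (1 : H.Gen).val = H.one from rfl, H.adj_one, Finset.sum_eq_zero, zero_add] at h2
    · exact h2
    intro j hj
    rw [Finset.mem_range] at hj
    have hdeg : ∀ e, H.adj (ρ ^ (i - j)).val f e ≠ 0 → H.deg e + (i - j) ≤ K := by
      intro e he
      obtain ⟨x, hx, hc⟩ := H.exists_of_adj_ne_zero he
      have h1 := H.deg_eq hc
      have h3 := hf x hx
      rw [deg_pow] at h1
      have := Nat.le_mul_of_pos_right (i - j) (deg_pos_of_irreducible hρ)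
      omega
    by_cases hK : i - j ≤ K
    · exact ih j hj (K := K - (i - j)) (by omega) fun e he => by have := hdeg e he; omega
    · have : H.adj (ρ ^ (i - j)).val f = 0 := by
        ext e
        by_contra he
        have := hdeg e he
        omega
      rw [this, map_zero]

/-- An element whose images under all `adj (ρ ^ t)` for `t ≥ m` are prescribed. -/
lemma exists_adj_eq {ρ : H.Gen} (hρ : Irreducible ρ) {m : ℕ} {σ : Ω →₀ ℤ}
    (hσ : ∀ j, m < j → H.adj (ρ ^ j).val σ = 0) :
    ∃ N : ℕ, ∀ d, H.adj (ρ ^ (m + d)).val (∑ i ∈ Finset.range (N + 1),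
      H.mul (Finsupp.single (ρ ^ (m + i)).val 1) (invAdj ρ i σ)) = if d = 0 then σ else 0 := by
  classical
  let K := σ.support.sup H.deg
  have hK : ∀ e, σ e ≠ 0 → H.deg e ≤ K := fun e he =>
    Finset.le_sup (f := H.deg) (Finsupp.mem_support_iff.2 he)
  refine ⟨K, fun d => ?_⟩
  let F : ℕ → ℕ → (Ω →₀ ℤ) := fun i e => if d ≤ i + e then
    H.mul (Finsupp.single (ρ ^ (i + e - d)).val 1) (invAdj ρ i (H.adj (ρ ^ e).val σ)) else 0
  have h1 : ∀ i, H.adj (ρ ^ (m + d)).val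
      (H.mul (Finsupp.single (ρ ^ (m + i)).val 1) (invAdj ρ i σ)) =
        ∑ e ∈ Finset.range (m + d + 1), F i e := by
    intro i
    rw [adj_pow_mul hρ, ← Finset.Nat.sum_antidiagonal_swap,
      Finset.Nat.sum_antidiagonal_eq_sum_range_succ_mk]
    refine Finset.sum_congr rfl fun e he => ?_
    rw [Finset.mem_range] at he
    simp only [Prod.swap, F, adj_invAdj_comm, adj_single]
    split_ifs with hde
    · have : ρ ^ (m + i) = ρ ^ (i + e - d) * ρ ^ (m + d - e) := by
        rw [← pow_add]
        congr 1
        omega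
      rw [this, adjBasis_mul fun v hv => mul_pow_cancel hρ _ hv]
    · rw [adjBasis_eq_zero, map_zero, LinearMap.zero_apply]
      intro hdvd
      obtain ⟨u, hu⟩ := hdvd
      have := congrArg (fun s : H.Gen => H.deg s.val) hu
      simp only [deg_mul, deg_pow] at this
      have h3 : (m + i) * H.deg ρ.val < (m + d - e) * H.deg ρ.val :=
        Nat.mul_lt_mul_of_pos_right (by omega) (deg_pos_of_irreducible hρ)
      omega
  rw [map_sum, Finset.sum_congr rfl fun i _ => h1 i, sum_range_range_eq_sum_antidiagonal,
    Finset.sum_eq_single 0]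
  · simp only [Finset.Nat.antidiagonal_zero, Finset.sum_singleton, F, add_zero, invAdj_zero]
    split_ifs with h h' h'
    · subst h'
      rw [pow_zero, show (1 : H.Gen).val = H.one from rfl, H.adj_one, mul_comm']
      refine Finsupp.ext fun e => ?_
      rw [← ip_single, ip_comm, ip_mul_single, H.adj_one, ip_comm, ip_single]
    · omega
    · omega
    · rfl
  · intro p _ hp
    have h2 := sum_invAdj_adj ρ p σ
    rw [if_neg hp] at h2
    by_cases hdp : d ≤ p
    · rw [Finset.sum_congr rfl (g := fun x => H.mul (Finsupp.single (ρ ^ (p - d)).val 1)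
        (invAdj ρ x.1 (H.adj (ρ ^ x.2).val σ))), ← map_sum, h2, map_zero]
      intro x hx
      rw [Finset.HasAntidiagonal.mem_antidiagonal] at hx
      simp only [F, hx, if_pos hdp]
    · refine Finset.sum_eq_zero fun x hx => ?_
      rw [Finset.HasAntidiagonal.mem_antidiagonal] at hx
      simp only [F, hx, if_neg hdp]
  · intro h
    simp at h
  · intro i e hi
    have : invAdj ρ i (H.adj (ρ ^ e).val σ) = 0 := by
      refine invAdj_eq_zero hρ (K := K) (by omega) fun b hb => ?_
      obtain ⟨x, hx, hc⟩ := H.exists_of_adj_ne_zero hb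
      have h3 := hK x hx
      have h4 := H.deg_eq hc
      omega
    simp only [F, this, map_zero, ite_self]
  · intro i e he
    simp only [F, hσ e (by omega), map_zero, ite_self]

/-- The leading term of an irreducible element along powers of `ρ` is irreducible. -/
lemma exists_adj_pow_eq_single {ρ : H.Gen} (hρ : Irreducible ρ) {m : ℕ} {x : Ω}
    (h0 : H.adjBasis (ρ ^ m).val x ≠ 0) (hm : ∀ j, m < j → H.adjBasis (ρ ^ j).val x = 0) :
    ∃ e, H.adjBasis (ρ ^ m).val x = Finsupp.single e 1 := by
  set σ := H.adjBasis (ρ ^ m).val x with hσ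
  obtain ⟨N, hN⟩ := exists_adj_eq hρ (m := m) (σ := σ) fun j hj => by
    rw [hσ, ← adj_single, H.adj_comm, adj_single, hm j hj, map_zero]
  set P := ∑ i ∈ Finset.range (N + 1),
    H.mul (Finsupp.single (ρ ^ (m + i)).val 1) (invAdj ρ i σ) with hP
  have hPf : ∀ f, ip P f = ∑ i ∈ Finset.range (N + 1),
      ip (invAdj ρ i σ) (H.adj (ρ ^ (m + i)).val f) := by
    intro f
    rw [hP, map_sum, LinearMap.sum_apply]
    exact Finset.sum_congr rfl fun i _ => H.ip_single_mul _ _ _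
  have h1 : ip P P = ip σ σ := by
    rw [hPf, Finset.sum_eq_single 0]
    · rw [hN, if_pos rfl, invAdj_zero]
    · intro i _ hi
      rw [hN, if_neg hi, map_zero]
    · simp
  have h2 : ip P (Finsupp.single x 1) = ip σ σ := by
    rw [hPf, Finset.sum_eq_single 0]
    · rw [add_zero, adj_single, ← hσ, invAdj_zero]
    · intro i _ hi
      rw [adj_single, hm _ (by omega), map_zero]
    · simp
  rw [ip_comm, ip_single] at h2
  have h3 := sq_le_ip_self P x
  rw [h1, h2] at h3
  refine eq_single_of_ip_self_eq_one (H.adjBasis_nonneg _ _) ?_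
  have h4 : 0 < ip σ σ := by
    obtain ⟨e, he⟩ := Finsupp.ne_iff.1 h0
    have := sq_le_ip_self σ e
    have h5 : 0 < σ e ^ 2 := pow_pos (lt_of_le_of_ne (H.adjBasis_nonneg _ _ e) (Ne.symm he)) 2
    omega
  nlinarith

end Gen

end PSHData

namespace PSHData

variable {Ω : Type} (H : PSHData Ω)

lemma one_mul' (f : Ω →₀ ℤ) : H.mul (Finsupp.single H.one 1) f = f := by
  rw [mul_comm']
  refine Finsupp.ext fun e => ?_
  rw [← ip_single, ip_comm, ip_mul_single, H.adj_one, ip_comm, ip_single]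

namespace Gen

variable {H}

lemma exists_val {s : Ω} (hs : H.gen s = 1) : ∃ t : H.Gen, t.val = s := ⟨⟨s, hs⟩, rfl⟩

lemma adjBasis_self_pow {ρ : H.Gen} (hρ : Irreducible ρ) (m : ℕ) :
    H.adjBasis (ρ ^ m).val (ρ ^ m).val = Finsupp.single H.one 1 := by
  have := adjBasis_mul (u := 1) (s := ρ ^ m) fun v hv => mul_pow_cancel hρ _ hv
  rwa [one_mul] at this

/-- Coprime generic elements multiply to an irreducible element. -/
lemma mulBasis_pow {ρ t : H.Gen} (hρ : Irreducible ρ) (ht : ¬ ρ ∣ t) (m : ℕ) :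
    H.mulBasis (ρ ^ m).val t.val = Finsupp.single (ρ ^ m * t).val 1 := by
  classical
  have h1 : H.adj (ρ ^ m).val (H.mulBasis (ρ ^ m).val t.val) = Finsupp.single t.val 1 := by
    rw [← mul_single, adj_pow_mul hρ, Finset.sum_eq_single (m, 0)]
    · simp only [adj_single, pow_zero, adjBasis_self_pow hρ]
      rw [← adj_single, show (1 : H.Gen).val = H.one from rfl, H.adj_one, H.one_mul']
    · rintro ⟨i, j⟩ hij hne
      rw [Finset.HasAntidiagonal.mem_antidiagonal] at hij
      have hj : j ≠ 0 := by
        rintro rfl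
        exact hne (by simp_all)
      rw [adj_single _ _ t.val, adjBasis_eq_zero fun h => ht ((dvd_pow_self ρ hj).trans h), map_zero]
    · intro h
      simp at h
  have h2 : ip (H.mulBasis (ρ ^ m).val t.val) (H.mulBasis (ρ ^ m).val t.val) = 1 := by
    conv_lhs => enter [1, 2]; rw [← mul_single]
    rw [ip_single_mul, h1, ip_single, Finsupp.single_eq_same]
  obtain ⟨e, he⟩ := eq_single_of_ip_self_eq_one (H.mulBasis_nonneg _ _) h2
  have h3 := c_mul (ρ ^ m) t
  have h4 := DFunLike.congr_fun he (ρ ^ m * t).val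
  rw [mulBasis_apply, h3, Finsupp.single_apply] at h4
  split_ifs at h4 with h5
  · rw [he, h5]
  · simp at h4

lemma adj_pow_mul_val {ρ t : H.Gen} (hρ : Irreducible ρ) (ht : ¬ ρ ∣ t) (m : ℕ) (f : Ω →₀ ℤ) :
    H.adj (ρ ^ m * t).val f = H.adj t.val (H.adj (ρ ^ m).val f) := by
  classical
  have h := fun e => DFunLike.congr_fun (mulBasis_pow hρ ht m) e
  rw [H.adj_comm, H.adj_adj le_rfl, Finset.sum_eq_single (ρ ^ m * t).val]
  · rw [c_mul, one_smul]
  · intro e _ he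
    have := h e
    rw [mulBasis_apply, Finsupp.single_apply, if_neg (Ne.symm he)] at this
    rw [Nat.cast_eq_zero.1 this, zero_smul]
  · intro h'
    exact absurd (H.mem_ball.2 (deg_mul _ _).le) h'

lemma exists_irreducible_dvd {s : H.Gen} (hs : s ≠ 1) : ∃ ρ, Irreducible ρ ∧ ρ ∣ s := by
  induction hn : H.deg s.val using Nat.strong_induction_on generalizing s with
  | _ n ih =>
    by_cases h : Irreducible s
    · exact ⟨s, h, dvd_rfl⟩
    rw [irreducible_iff, isUnit_iff] at h
    push Not at h
    obtain ⟨a, b, hab, ha, hb⟩ := h hs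
    rw [isUnit_iff] at ha hb
    have hb' : H.deg b.val ≠ 0 := fun h' => hb (eq_one_of_deg h')
    have := deg_mul a b
    rw [← hab] at this
    obtain ⟨ρ, h1, h2⟩ := ih (H.deg a.val) (by omega) ha rfl
    exact ⟨ρ, h1, h2.trans ⟨b, hab⟩⟩

lemma exists_eq_pow_mul {ρ : H.Gen} (hρ : Irreducible ρ) (s : H.Gen) :
    ∃ m t, s = ρ ^ m * t ∧ ¬ ρ ∣ t := by
  induction hn : H.deg s.val using Nat.strong_induction_on generalizing s with
  | _ n ih =>
    by_cases h : ρ ∣ s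
    · obtain ⟨t, rfl⟩ := h
      have := deg_pos_of_irreducible hρ
      have h2 := deg_mul ρ t
      obtain ⟨m, u, rfl, hu⟩ := ih (H.deg t.val) (by omega) t rfl
      exact ⟨m + 1, u, by rw [pow_succ']; ac_rfl, hu⟩
    · exact ⟨0, s, by simp, h⟩

lemma eq_of_dvd_pow {ρ σ : H.Gen} (hρ : Irreducible ρ) (hσ : Irreducible σ) {m : ℕ}
    (h : σ ∣ ρ ^ m) : σ = ρ := by
  induction m with
  | zero =>
    exact absurd (isUnit_of_dvd_one (by simpa using h)) hσ.not_isUnit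
  | succ m ih =>
    rw [pow_succ] at h
    rcases dvd_or_dvd hσ h with h | ⟨b, hb⟩
    · exact ih h
    · rcases eq_one_or_eq_one hρ hb with h1 | h1
      · exact absurd (isUnit_iff.2 h1) hσ.not_isUnit
      · rw [hb, h1, mul_one]

lemma exists_max_pow {ρ : H.Gen} (hρ : Irreducible ρ) (x : Ω) :
    ∃ m, H.adjBasis (ρ ^ m).val x ≠ 0 ∧ ∀ j, m < j → H.adjBasis (ρ ^ j).val x = 0 := by
  classical
  let P : ℕ → Prop := fun j => H.adjBasis (ρ ^ j).val x ≠ 0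
  have h0 : P 0 := by
    simp only [P, pow_zero]
    rw [← adj_single, show (1 : H.Gen).val = H.one from rfl, H.adj_one]
    simp
  have hP : ∀ j, P j → j ≤ H.deg x := by
    intro j hj
    obtain ⟨b, hb⟩ := Finsupp.ne_iff.1 hj
    have h1 := H.deg_eq (a := b) (b := (ρ ^ j).val) (e := x) (by simpa using hb)
    rw [deg_pow] at h1
    have := Nat.le_mul_of_pos_right j (deg_pos_of_irreducible hρ)
    omega
  refine ⟨Nat.findGreatest P (H.deg x), Nat.findGreatest_spec (Nat.zero_le _) h0, fun j hj => ?_⟩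
  by_contra hc
  exact absurd (Nat.le_findGreatest (P := P) (hP j hc) hc) (by omega)

/-- If `x` is a constituent of `ρ ^ m * σ` and `s` is prime to `ρ`, then `s` acts nontrivially
on `σ` as soon as it does so on `x`. -/
lemma adjBasis_ne_zero_of_pow {ρ s : H.Gen} (hρ : Irreducible ρ) (hs : ¬ ρ ∣ s) {m : ℕ} {x e : Ω}
    (he : H.c e (ρ ^ m).val x ≠ 0) (hx : H.adjBasis s.val x ≠ 0) : H.adjBasis s.val e ≠ 0 := by
  intro h0
  have h1 : H.adj s.val (H.mulBasis (ρ ^ m).val e) = 0 := by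
    rw [← mul_single, adj_mul]
    refine Finset.sum_eq_zero fun p hp => ?_
    have hp : p.1 * p.2 = s := by simpa using hp
    by_cases h : p.1 ∣ ρ ^ m
    · obtain ⟨u, hu⟩ := h
      obtain ⟨i, j, -, hi, -⟩ := exists_pow_of_mul_eq_pow hρ hu.symm
      have hi0 : i = 0 := by
        by_contra hi0
        exact hs ((dvd_pow_self ρ hi0).trans (hi ▸ ⟨p.2, hp.symm⟩))
      rw [hi0, pow_zero] at hi
      rw [hi, one_mul] at hp
      rw [hp, adj_single _ _ e, h0, map_zero]
    · rw [adj_single, adjBasis_eq_zero h, map_zero, LinearMap.zero_apply]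
  have h2 : 0 ≤ H.mulBasis (ρ ^ m).val e - Finsupp.single x 1 := by
    classical
    intro b
    rw [Finsupp.sub_apply, mulBasis_apply, Finsupp.single_apply, H.c_comm]
    split_ifs with hb
    · subst hb
      simp only [Finsupp.coe_zero, Pi.zero_apply]
      omega
    · simp
  have h3 := H.adj_nonneg s.val h2
  rw [map_sub, h1, adj_single] at h3
  refine hx (le_antisymm (by simpa using h3) (H.adjBasis_nonneg _ _))

/-- The leading generic factor of an irreducible element, relative to a finite set of primes. -/
lemma exists_leading (A : Finset H.Gen) (hA : ∀ ρ ∈ A, Irreducible ρ) (x : Ω) :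
    ∃ t e, (∀ ρ, Irreducible ρ → ρ ∣ t → ρ ∈ A) ∧ H.adjBasis t.val x = Finsupp.single e 1 ∧
      ∀ s : H.Gen, (∀ ρ, Irreducible ρ → ρ ∣ s → ρ ∈ A) → H.adjBasis s.val x ≠ 0 → s ∣ t := by
  classical
  induction A using Finset.induction_on generalizing x with
  | empty =>
    refine ⟨1, x, fun ρ hρ h => absurd (isUnit_of_dvd_one h) hρ.not_isUnit, ?_, fun s hs _ => ?_⟩
    · rw [← adj_single, show (1 : H.Gen).val = H.one from rfl, H.adj_one]
    · by_cases h : s = 1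
      · rw [h]
      · obtain ⟨ρ, h1, h2⟩ := exists_irreducible_dvd h
        exact absurd (hs ρ h1 h2) (Finset.notMem_empty _)
  | insert ρ A hρA ih =>
    have hρ := hA ρ (Finset.mem_insert_self _ _)
    obtain ⟨m, hm, hmax⟩ := exists_max_pow hρ x
    obtain ⟨σ, hσ⟩ := exists_adj_pow_eq_single hρ hm hmax
    obtain ⟨t, e, ht, hte, htmax⟩ := ih (fun ρ' h => hA ρ' (Finset.mem_insert_of_mem h)) σ
    have hρt : ¬ ρ ∣ t := fun h => hρA (ht ρ hρ h)
    refine ⟨ρ ^ m * t, e, fun ρ' hρ' h => ?_, ?_, fun s hs hx => ?_⟩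
    · rcases dvd_or_dvd hρ' h with h | h
      · rw [eq_of_dvd_pow hρ hρ' h]
        exact Finset.mem_insert_self _ _
      · exact Finset.mem_insert_of_mem (ht ρ' hρ' h)
    · rw [← adj_single, adj_pow_mul_val hρ hρt, adj_single, hσ, adj_single, hte]
    · obtain ⟨i, s', rfl, hs'⟩ := exists_eq_pow_mul hρ s
      rw [← adj_single, adj_pow_mul_val hρ hs'] at hx
      have h1 : H.adjBasis (ρ ^ i).val x ≠ 0 := fun h => hx (by rw [adj_single, h, map_zero])
      have h2 : H.adjBasis s'.val x ≠ 0 := fun h => hx (by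
        rw [H.adj_comm, adj_single, h, map_zero])
      have him : i ≤ m := by
        by_contra hc
        exact h1 (hmax i (by omega))
      refine mul_dvd_mul (pow_dvd_pow ρ him) (htmax s' (fun ρ' hρ' h => ?_) ?_)
      · refine Finset.mem_of_mem_insert_of_ne (hs ρ' hρ' (h.mul_left _)) ?_
        rintro rfl
        exact hs' h
      · refine adjBasis_ne_zero_of_pow hρ hs' (m := m) (x := x) ?_ h2
        have := DFunLike.congr_fun hσ σ
        rw [adjBasis_apply, Finsupp.single_eq_same] at this
        omega

end Gen

/-- Some generic derivative of an irreducible element is again irreducible. -/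
theorem exists_derivative {x : Ω} (hx : 0 < H.deg x) :
    ∃ k e, 0 < k ∧ H.deg e + k = H.deg x ∧ ∀ e' [Decidable (e' = e)],
      ∑ s ∈ H.ball (H.deg x) with H.deg s = k, H.gen s * H.c e' s x = if e' = e then 1 else 0 := by
  classical
  have hfin : {ρ : H.Gen | Irreducible ρ ∧ H.deg ρ.val ≤ H.deg x}.Finite :=
    (Set.Finite.preimage Gen.val_injective.injOn (H.ball (H.deg x)).finite_toSet).subset
      fun ρ hρ => H.mem_ball.2 hρ.2
  obtain ⟨t, e, ht, hte, hmax⟩ := Gen.exists_leading hfin.toFinset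
    (fun ρ hρ => ((Set.Finite.mem_toFinset _).1 hρ).1) x
  have hdvd : ∀ (s : H.Gen) b, H.c b s.val x ≠ 0 → s ∣ t := by
    intro s b hb
    refine hmax s (fun ρ hρ h => (Set.Finite.mem_toFinset _).2 ⟨hρ, ?_⟩) fun h => ?_
    · obtain ⟨u, rfl⟩ := h
      have := H.deg_eq hb
      rw [Gen.deg_mul] at this
      omega
    · exact hb (by simpa using DFunLike.congr_fun h b)
  have hc : ∀ e', (H.c e' t.val x : ℤ) = if e' = e then 1 else 0 := fun e' => by
    rw [← adjBasis_apply, hte, Finsupp.single_apply]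
    simp only [eq_comm]
  have hce := hc e
  rw [if_pos rfl] at hce
  have hdeg := H.deg_eq (a := e) (b := t.val) (e := x) (by omega)
  refine ⟨H.deg t.val, e, ?_, hdeg.symm, fun e' _ => ?_⟩
  · obtain ⟨s, b, hs, hs0, hb⟩ := H.exists_gen hx
    obtain ⟨s, rfl⟩ := Gen.exists_val hs
    obtain ⟨u, rfl⟩ := hdvd s b hb
    rw [Gen.deg_mul]
    exact Nat.add_pos_left hs0 _
  · rw [Finset.sum_eq_single t.val]
    · have := hc e'
      rw [Gen.gen_val, one_mul]
      split_ifs at this ⊢ <;> omega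
    · intro s hs hst
      by_contra hne
      obtain ⟨s, rfl⟩ : ∃ s' : H.Gen, s'.val = s := Gen.exists_val (by
        have := H.gen_le_one s
        have := left_ne_zero_of_mul hne
        omega)
      obtain ⟨u, rfl⟩ := hdvd s e' (right_ne_zero_of_mul hne)
      have h1 := Gen.deg_mul s u
      rw [Finset.mem_filter] at hs
      have h3 : u = 1 := Gen.eq_one_of_deg (by omega)
      exact hst (by rw [h3, mul_one])
    · intro h
      exact absurd (by simp [H.mem_ball]; omega) h

end PSHData

section Average

/-- The average of a function on a finite type. -/
noncomputable def avg {X : Type*} (F : X → ℂ) : ℂ := (Nat.card X : ℂ)⁻¹ * ∑ᶠ x, F x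

lemma avg_eq_sum {X : Type*} [Fintype X] (F : X → ℂ) :
    avg F = (Nat.card X : ℂ)⁻¹ * ∑ x, F x := by
  rw [avg, finsum_eq_sum_of_fintype]

lemma avg_equiv {X Y : Type*} (e : X ≃ Y) (F : Y → ℂ) : avg (fun x => F (e x)) = avg F := by
  rw [avg, avg, Nat.card_congr e, finsum_comp_equiv e]

variable {X Y : Type*} [Finite X]

lemma avg_const [Nonempty X] (z : ℂ) : avg (fun _ : X => z) = z := by
  have := Fintype.ofFinite X
  rw [avg_eq_sum, Finset.sum_const, nsmul_eq_mul, ← mul_assoc, Finset.card_univ,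
    Nat.card_eq_fintype_card, inv_mul_cancel₀ (by simp), one_mul]

omit [Finite X] in
lemma avg_zero : avg (fun _ : X => (0 : ℂ)) = 0 := by
  simp [avg]

omit [Finite X] in
lemma avg_unique [Unique X] (F : X → ℂ) : avg F = F default := by
  rw [avg_eq_sum]
  simp

lemma avg_add (F G : X → ℂ) : avg (fun x => F x + G x) = avg F + avg G := by
  have := Fintype.ofFinite X
  simp only [avg_eq_sum, Finset.sum_add_distrib, mul_add]

lemma avg_mul_left (z : ℂ) (F : X → ℂ) : avg (fun x => z * F x) = z * avg F := by
  have := Fintype.ofFinite X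
  simp only [avg_eq_sum, ← Finset.mul_sum]
  ring

lemma avg_mul_right (z : ℂ) (F : X → ℂ) : avg (fun x => F x * z) = avg F * z := by
  simp only [mul_comm _ z, avg_mul_left]

lemma avg_sum {ι : Type*} (s : Finset ι) (F : ι → X → ℂ) :
    avg (fun x => ∑ i ∈ s, F i x) = ∑ i ∈ s, avg (F i) := by
  have := Fintype.ofFinite X
  simp only [avg_eq_sum, ← Finset.mul_sum]
  rw [Finset.sum_comm]

lemma avg_prod [Finite Y] (F : X → Y → ℂ) :
    avg (fun p : X × Y => F p.1 p.2) = avg fun x => avg fun y => F x y := by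
  have := Fintype.ofFinite X
  have := Fintype.ofFinite Y
  simp only [avg_eq_sum, ← Finset.mul_sum, Fintype.sum_prod_type, Nat.card_prod]
  push_cast
  rw [mul_inv, mul_assoc]

lemma avg_comm [Finite Y] (F : X → Y → ℂ) :
    (avg fun x => avg fun y => F x y) = avg fun y => avg fun x => F x y := by
  rw [← avg_prod, ← avg_prod, ← avg_equiv (Equiv.prodComm Y X)]
  rfl

/-- Averaging along a surjective homomorphism. -/
lemma avg_comp_surjective {A B : Type*} [AddGroup A] [AddGroup B] [Finite A] (π : A →+ B)
    (hπ : Function.Surjective π) (F : B → ℂ) : (avg fun a => F (π a)) = avg F := by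
  have : Finite B := Finite.of_surjective π hπ
  choose s hs using hπ
  let e : B × π.ker ≃ A :=
    { toFun := fun p => s p.1 + p.2
      invFun := fun a => (π a, ⟨-s (π a) + a, by simp [AddMonoidHom.mem_ker, hs]⟩)
      left_inv := by
        rintro ⟨b, c, hc⟩
        rw [AddMonoidHom.mem_ker] at hc
        simp [hs, hc]
      right_inv := fun a => by simp }
  rw [← avg_equiv e]
  have h : ∀ p : B × π.ker, F (π (e p)) = F p.1 := by
    rintro ⟨b, c, hc⟩
    rw [AddMonoidHom.mem_ker] at hc
    simp [e, hs, hc]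
  simp only [h]
  rw [avg_prod (fun b (_ : π.ker) => F b)]
  simp only [avg_const]

open Classical in
/-- Averaging over a subgroup. -/
lemma avg_indicator_mul {A : Type*} [AddGroup A] [Finite A] (B : AddSubgroup A) (F : A → ℂ) :
    avg (fun a => if a ∈ B then F a else 0) =
      (avg fun a => if a ∈ B then (1 : ℂ) else 0) * avg fun b : B => F b := by
  have := Fintype.ofFinite A
  have h : ∀ F : A → ℂ, ∑ a, (if a ∈ B then F a else 0) = ∑ b : B, F b := fun F => by
    rw [← Finset.sum_filter]
    exact (Finset.sum_subtype (Finset.univ.filter (· ∈ B)) (by simp) F)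
  simp only [avg_eq_sum, h]
  have : (Nat.card B : ℂ) ≠ 0 := Nat.cast_ne_zero.2 Nat.card_pos.ne'
  simp only [Finset.sum_const, Finset.card_univ, nsmul_eq_mul, mul_one, ← Nat.card_eq_fintype_card]
  field_simp

open Classical in
lemma avg_indicator_ne_zero {A : Type*} [AddGroup A] [Finite A] (B : AddSubgroup A) :
    (avg fun a => if a ∈ B then (1 : ℂ) else 0) ≠ 0 := by
  have := Fintype.ofFinite A
  rw [avg_eq_sum, ← Finset.sum_filter, Finset.sum_const, nsmul_eq_mul, mul_one]
  refine mul_ne_zero (inv_ne_zero (Nat.cast_ne_zero.2 Nat.card_pos.ne'))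
    (Nat.cast_ne_zero.2 (Finset.card_ne_zero.2 ⟨0, by simp [B.zero_mem]⟩))

open Classical in
/-- The average of a nontrivial character vanishes. -/
lemma avg_addChar {A : Type*} [AddGroup A] [Finite A] (ψ : AddChar A ℂ) :
    avg (fun a => ψ a) = if ψ = 0 then 1 else 0 := by
  have := Fintype.ofFinite A
  rw [avg_eq_sum, AddChar.sum_eq_ite]
  split_ifs
  · rw [Nat.card_eq_fintype_card, inv_mul_cancel₀ (by simp)]
  · rw [mul_zero]

end Average

section Subspaces

variable {k V V₁ V₂ : Type} [Field k] [AddCommGroup V] [Module k V] [AddCommGroup V₁]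
  [Module k V₁] [AddCommGroup V₂] [Module k V₂]

instance LinearMap.finite_of_finite [Finite V₁] [Finite V₂] : Finite (V₁ →ₗ[k] V₂) :=
  DFunLike.finite _

instance LinearEquiv.finite_of_finite [Finite V₁] [Finite V₂] : Finite (V₁ ≃ₗ[k] V₂) :=
  DFunLike.finite _

instance Submodule.finite_quotient_of_finite [Finite V] (W : Submodule k V) : Finite (V ⧸ W) :=
  Finite.of_surjective W.mkQ W.mkQ_surjective

noncomputable instance Submodule.fintypeOfFinite [Finite V] : Fintype (Submodule k V) :=
  Fintype.ofFinite _

/-- The homomorphisms mapping `W₂` to `W₁`. -/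
def homSubgroup (W₁ : Submodule k V₁) (W₂ : Submodule k V₂) : AddSubgroup (V₂ →ₗ[k] V₁) where
  carrier := {u | ∀ w ∈ W₂, u w ∈ W₁}
  add_mem' ha hb w hw := W₁.add_mem (ha w hw) (hb w hw)
  zero_mem' _ _ := W₁.zero_mem
  neg_mem' ha w hw := W₁.neg_mem (ha w hw)

lemma mem_homSubgroup {W₁ : Submodule k V₁} {W₂ : Submodule k V₂} {u : V₂ →ₗ[k] V₁} :
    u ∈ homSubgroup W₁ W₂ ↔ ∀ w ∈ W₂, u w ∈ W₁ := Iff.rfl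

/-- The automorphism `(v₁, v₂) ↦ (v₁ + θ v₂, v₂)`. -/
def shear (θ : V₂ →ₗ[k] V₁) : (V₁ × V₂) ≃ₗ[k] V₁ × V₂ where
  toFun p := (p.1 + θ p.2, p.2)
  invFun p := (p.1 - θ p.2, p.2)
  map_add' p q := by
    ext
    · simp
      abel
    · simp
  map_smul' c p := by simp
  left_inv p := by simp
  right_inv p := by simp

@[simp]
lemma shear_apply (θ : V₂ →ₗ[k] V₁) (p : V₁ × V₂) : shear θ p = (p.1 + θ p.2, p.2) := rfl

/-- The image of `W₁ × W₂` under a shear. -/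
def shearSubmodule (W₁ : Submodule k V₁) (W₂ : Submodule k V₂) (θ : V₂ →ₗ[k] V₁) :
    Submodule k (V₁ × V₂) := (W₁.prod W₂).comap (shear (-θ)).toLinearMap

lemma mem_shearSubmodule {W₁ : Submodule k V₁} {W₂ : Submodule k V₂} {θ : V₂ →ₗ[k] V₁}
    {p : V₁ × V₂} : p ∈ shearSubmodule W₁ W₂ θ ↔ p.1 - θ p.2 ∈ W₁ ∧ p.2 ∈ W₂ := by
  simp [shearSubmodule, Submodule.mem_prod, sub_eq_add_neg]

lemma comap_inl_shearSubmodule (W₁ : Submodule k V₁) (W₂ : Submodule k V₂) (θ : V₂ →ₗ[k] V₁) :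
    (shearSubmodule W₁ W₂ θ).comap (LinearMap.inl k V₁ V₂) = W₁ := by
  ext v
  simp [mem_shearSubmodule]

lemma map_snd_shearSubmodule (W₁ : Submodule k V₁) (W₂ : Submodule k V₂) (θ : V₂ →ₗ[k] V₁) :
    (shearSubmodule W₁ W₂ θ).map (LinearMap.snd k V₁ V₂) = W₂ := by
  ext v
  simp only [Submodule.mem_map, mem_shearSubmodule, LinearMap.snd_apply, Prod.exists]
  constructor
  · rintro ⟨a, b, h, rfl⟩
    exact h.2
  · intro h
    exact ⟨θ v, v, by simpa using h, rfl⟩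

lemma exists_shearSubmodule_eq (W : Submodule k (V₁ × V₂)) :
    ∃ θ, shearSubmodule (W.comap (LinearMap.inl k V₁ V₂)) (W.map (LinearMap.snd k V₁ V₂)) θ =
      W := by
  let f : W →ₗ[k] W.map (LinearMap.snd k V₁ V₂) := (LinearMap.snd k V₁ V₂).submoduleMap W
  obtain ⟨s, hs⟩ := f.exists_rightInverse_of_surjective
    (LinearMap.range_eq_top.2 ((LinearMap.snd k V₁ V₂).submoduleMap_surjective W))
  obtain ⟨θ, hθ⟩ := LinearMap.exists_extend ((LinearMap.fst k V₁ V₂) ∘ₗ W.subtype ∘ₗ s)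
  have key : ∀ w (hw : w ∈ W.map (LinearMap.snd k V₁ V₂)), (θ w, w) ∈ W := by
    intro w hw
    have h1 : θ w = (s ⟨w, hw⟩ : V₁ × V₂).1 := LinearMap.congr_fun hθ ⟨w, hw⟩
    have h2 : w = (s ⟨w, hw⟩ : V₁ × V₂).2 :=
      (congrArg Subtype.val (LinearMap.congr_fun hs ⟨w, hw⟩)).symm
    have h3 : ((θ w, w) : V₁ × V₂) = s ⟨w, hw⟩ := Prod.ext h1 h2
    rw [h3]
    exact (s ⟨w, hw⟩).2
  refine ⟨θ, ?_⟩
  ext p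
  rw [mem_shearSubmodule, Submodule.mem_comap, LinearMap.inl_apply]
  have hp : p = (p.1 - θ p.2, 0) + (θ p.2, p.2) := by simp
  constructor
  · rintro ⟨h1, h2⟩
    rw [hp]
    exact W.add_mem h1 (key _ h2)
  · intro h
    have h2 : p.2 ∈ W.map (LinearMap.snd k V₁ V₂) := ⟨p, h, rfl⟩
    refine ⟨?_, h2⟩
    rw [hp] at h
    exact (W.add_mem_iff_left (key _ h2)).1 h

lemma shearSubmodule_eq_iff {W₁ : Submodule k V₁} {W₂ : Submodule k V₂} {θ θ' : V₂ →ₗ[k] V₁} :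
    shearSubmodule W₁ W₂ θ = shearSubmodule W₁ W₂ θ' ↔ θ - θ' ∈ homSubgroup W₁ W₂ := by
  rw [mem_homSubgroup]
  constructor
  · intro h w hw
    have : (θ w, w) ∈ shearSubmodule W₁ W₂ θ := mem_shearSubmodule.2 (by simpa using hw)
    rw [h, mem_shearSubmodule] at this
    exact this.1
  · intro h
    ext p
    simp only [mem_shearSubmodule]
    refine and_congr_left fun hp => ?_
    have := h _ hp
    rw [LinearMap.sub_apply] at this
    rw [← W₁.add_mem_iff_left this]
    simp

variable [Finite V₁] [Finite V₂]

open Classical in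
lemma avg_shearSubmodule (W₁ : Submodule k V₁) (W₂ : Submodule k V₂)
    (F : Submodule k (V₁ × V₂) → ℂ) :
    avg (fun θ => F (shearSubmodule W₁ W₂ θ)) =
      (avg fun θ => if θ ∈ homSubgroup W₁ W₂ then (1 : ℂ) else 0) *
        ∑ W with W.comap (LinearMap.inl k V₁ V₂) = W₁ ∧ W.map (LinearMap.snd k V₁ V₂) = W₂,
          F W := by
  have h1 : ∀ θ : V₂ →ₗ[k] V₁, F (shearSubmodule W₁ W₂ θ) =
      ∑ W with W.comap (LinearMap.inl k V₁ V₂) = W₁ ∧ W.map (LinearMap.snd k V₁ V₂) = W₂,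
        (if shearSubmodule W₁ W₂ θ = W then 1 else 0) * F W := by
    intro θ
    rw [Finset.sum_eq_single (shearSubmodule W₁ W₂ θ)]
    · simp
    · intro W _ hW
      rw [if_neg hW.symm, zero_mul]
    · intro h
      simp [comap_inl_shearSubmodule, map_snd_shearSubmodule] at h
  simp only [h1]
  rw [avg_sum, Finset.mul_sum]
  refine Finset.sum_congr rfl fun W hW => ?_
  rw [avg_mul_right]
  congr 1
  obtain ⟨θ₀, hθ₀⟩ := exists_shearSubmodule_eq W
  obtain ⟨-, h2, h3⟩ := Finset.mem_filter.1 hW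
  rw [h2, h3] at hθ₀
  refine Eq.trans (congrArg avg (funext fun θ => ?_)) (avg_equiv (Equiv.subRight θ₀) _)
  simp only [← hθ₀, shearSubmodule_eq_iff, Equiv.subRight_apply]

/-- Summation over the subspaces of `V₁ × V₂` when the summand is averaged over shears. -/
lemma avg_sum_submodule (F : (V₂ →ₗ[k] V₁) → Submodule k (V₁ × V₂) → ℂ)
    (s : (V₂ →ₗ[k] V₁) → (V₂ →ₗ[k] V₁))
    (hs : ∀ u θ W₁ W₂, F u (shearSubmodule W₁ W₂ θ) = F (u + s θ) (W₁.prod W₂))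
    (h0 : ∀ u W₁ W₂, u ∉ homSubgroup W₁ W₂ → F u (W₁.prod W₂) = 0) :
    (avg fun u => ∑ W, F u W) =
      ∑ W₁, ∑ W₂, avg fun u : homSubgroup W₁ W₂ => F u (W₁.prod W₂) := by
  classical
  have h1 : ∀ u, ∑ W, F u W = ∑ W₁, ∑ W₂,
      (avg fun θ => if θ ∈ homSubgroup W₁ W₂ then (1 : ℂ) else 0)⁻¹ *
        avg fun θ => F (u + s θ) (W₁.prod W₂) := by
    intro u
    simp only [← hs]
    simp only [avg_shearSubmodule, ← mul_assoc, inv_mul_cancel₀ (avg_indicator_ne_zero _), one_mul]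
    rw [← Fintype.sum_prod_type', ← Finset.sum_fiberwise Finset.univ (fun W : Submodule k (V₁ × V₂) =>
      (W.comap (LinearMap.inl k V₁ V₂), W.map (LinearMap.snd k V₁ V₂)))]
    simp only [Prod.ext_iff]
  simp only [h1]
  rw [avg_sum]
  refine Finset.sum_congr rfl fun W₁ _ => ?_
  rw [avg_sum]
  refine Finset.sum_congr rfl fun W₂ _ => ?_
  rw [avg_mul_left, avg_comm]
  have h2 : ∀ θ, (avg fun u => F (u + s θ) (W₁.prod W₂)) = avg fun u => F u (W₁.prod W₂) :=
    fun θ => avg_equiv (Equiv.addRight (s θ)) fun u => F u (W₁.prod W₂)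
  simp only [h2, avg_const]
  rw [inv_mul_eq_iff_eq_mul₀ (avg_indicator_ne_zero _), 
    ← avg_indicator_mul (homSubgroup W₁ W₂) fun u => F u (W₁.prod W₂)]
  refine congrArg avg (funext fun u => ?_)
  split_ifs with h
  · rfl
  · exact h0 _ _ _ h

omit [Finite V₁] [Finite V₂] in
lemma exists_restrict_mapQ {W₁ : Submodule k V₁} {W₂ : Submodule k V₂} (α : W₂ →ₗ[k] W₁)
    (β : V₂ ⧸ W₂ →ₗ[k] V₁ ⧸ W₁) : ∃ u : V₂ →ₗ[k] V₁, (∀ w : W₂, u w = α w) ∧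
      ∀ v, W₁.mkQ (u v) = β (W₂.mkQ v) := by
  obtain ⟨α', hα⟩ := LinearMap.exists_extend (W₁.subtype ∘ₗ α)
  obtain ⟨σ, hσ⟩ := W₁.mkQ.exists_rightInverse_of_surjective W₁.range_mkQ
  have h1 : W₂ ≤ LinearMap.ker (β ∘ₗ W₂.mkQ - W₁.mkQ ∘ₗ α') := by
    intro w hw
    have : α' w = α ⟨w, hw⟩ := LinearMap.congr_fun hα ⟨w, hw⟩
    simp [this, (Submodule.Quotient.mk_eq_zero W₂).2 hw]
  refine ⟨α' + σ ∘ₗ W₂.liftQ _ h1 ∘ₗ W₂.mkQ, fun w => ?_, fun v => ?_⟩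
  · have h2 : α' w = α w := LinearMap.congr_fun hα w
    have h3 : W₂.mkQ w = 0 := by simp
    rw [LinearMap.add_apply, LinearMap.comp_apply, LinearMap.comp_apply, h3, map_zero, map_zero,
      add_zero, h2]
  · have h2 : ∀ y, W₁.mkQ (σ y) = y := LinearMap.congr_fun hσ
    rw [LinearMap.add_apply, map_add, LinearMap.comp_apply, h2]
    simp

/-- Averaging over homomorphisms preserving subspaces. -/
lemma avg_homSubgroup (W₁ : Submodule k V₁) (W₂ : Submodule k V₂)
    (F : (W₂ →ₗ[k] W₁) → (V₂ ⧸ W₂ →ₗ[k] V₁ ⧸ W₁) → ℂ) :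
    (avg fun u : homSubgroup W₁ W₂ => F (u.1.restrict u.2) (W₂.mapQ W₁ u.1 u.2)) =
      avg fun α => avg fun β => F α β := by
  rw [← avg_prod]
  let π : homSubgroup W₁ W₂ →+ (W₂ →ₗ[k] W₁) × (V₂ ⧸ W₂ →ₗ[k] V₁ ⧸ W₁) :=
    { toFun := fun u => (u.1.restrict u.2, W₂.mapQ W₁ u.1 u.2)
      map_zero' := by
        ext <;> simp
      map_add' := fun u v => by
        ext <;> rfl }
  refine avg_comp_surjective π ?_ (fun p => F p.1 p.2)
  rintro ⟨α, β⟩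
  obtain ⟨u, h1, h2⟩ := exists_restrict_mapQ α β
  refine ⟨⟨u, fun w hw => h1 ⟨w, hw⟩ ▸ (α ⟨w, hw⟩).2⟩, Prod.ext ?_ ?_⟩
  · ext w
    exact h1 w
  · ext v
    exact h2 v

end Subspaces

section EndFunctions

/-- Functions of a vector space with an endomorphism. -/
abbrev EndFn (k : Type) [Field k] :=
  ∀ (V : Type) [AddCommGroup V] [Module k V], Module.End k V → ℂ

/-- Functions of a vector space with a linear form and an endomorphism. -/
abbrev MarkedFn (k : Type) [Field k] :=
  ∀ (V : Type) [AddCommGroup V] [Module k V], (V →ₗ[k] k) → Module.End k V → ℂ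

variable {k : Type} [Field k]

/-- Invariance under isomorphisms. -/
def EndFn.Invariant (f : EndFn k) : Prop :=
  ∀ (V W : Type) [AddCommGroup V] [Module k V] [AddCommGroup W] [Module k W] (e : V ≃ₗ[k] W)
    (x : Module.End k V) (y : Module.End k W), (∀ v, y (e v) = e (x v)) → f V x = f W y

/-- Invariance under isomorphisms. -/
def MarkedFn.Invariant (h : MarkedFn k) : Prop :=
  ∀ (V W : Type) [AddCommGroup V] [Module k V] [AddCommGroup W] [Module k W] (e : V ≃ₗ[k] W)
    (l : V →ₗ[k] k) (x : Module.End k V) (m : W →ₗ[k] k) (y : Module.End k W),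
    (∀ v, m (e v) = l v) → (∀ v, y (e v) = e (x v)) → h V l x = h W m y

/-- Forgetting the linear form. -/
def EndFn.mark (f : EndFn k) : MarkedFn k := fun V _ _ _ x => f V x

/-- Specialization to the zero form. -/
def MarkedFn.unmark (h : MarkedFn k) : EndFn k := fun V _ _ x => h V 0 x

lemma EndFn.Invariant.mark {f : EndFn k} (hf : f.Invariant) : f.mark.Invariant :=
  fun V W _ _ _ _ e _ x _ y _ hx => hf V W e x y hx

lemma MarkedFn.Invariant.unmark {h : MarkedFn k} (hh : h.Invariant) : h.unmark.Invariant :=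
  fun V W _ _ _ _ e x y hx => hh V W e 0 x 0 y (fun _ => rfl) hx

variable {V W S Q V₁ V₂ : Type} [AddCommGroup V] [Module k V] [AddCommGroup W] [Module k W]
  [AddCommGroup S] [Module k S] [AddCommGroup Q] [Module k Q]
  [AddCommGroup V₁] [Module k V₁] [AddCommGroup V₂] [Module k V₂]

lemma MarkedFn.Invariant.restrict {h : MarkedFn k} (hh : h.Invariant) {ι : S →ₗ[k] V}
    (hι : Function.Injective ι) {U : Submodule k V} (hU : LinearMap.range ι = U)
    {l : V →ₗ[k] k} {m : S →ₗ[k] k} (hl : ∀ s, m s = l (ι s))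
    {x : Module.End k V} (hx : ∀ w ∈ U, x w ∈ U) {y : Module.End k S}
    (hy : ∀ s, ι (y s) = x (ι s)) :
    h U (l ∘ₗ U.subtype) (x.restrict hx) = h S m y := by
  subst hU
  refine (hh _ _ (LinearEquiv.ofInjective ι hι) m y _ _ (fun s => (hl s).symm) fun s => ?_).symm
  ext
  simp [hy]

lemma MarkedFn.Invariant.mapQ {h : MarkedFn k} (hh : h.Invariant) {π : V →ₗ[k] Q}
    (hπ : Function.Surjective π) {U : Submodule k V} (hU : LinearMap.ker π = U)
    {l : V →ₗ[k] k} {m : Q →ₗ[k] k} (hl : ∀ v, m (π v) = l v) (hl' : U ≤ LinearMap.ker l)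
    {x : Module.End k V} (hx : ∀ w ∈ U, x w ∈ U) {y : Module.End k Q}
    (hy : ∀ v, y (π v) = π (x v)) :
    h (V ⧸ U) (U.liftQ l hl') (U.mapQ U x hx) = h Q m y := by
  subst hU
  refine hh _ _ (π.quotKerEquivOfSurjective hπ) _ _ _ _ (fun v => ?_) (fun v => ?_) <;>
  obtain ⟨v, rfl⟩ := Submodule.Quotient.mk_surjective _ v
  · exact hl v
  · exact hy v

lemma EndFn.Invariant.restrict {f : EndFn k} (hf : f.Invariant) {ι : S →ₗ[k] V}
    (hι : Function.Injective ι) {U : Submodule k V} (hU : LinearMap.range ι = U)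
    {x : Module.End k V} (hx : ∀ w ∈ U, x w ∈ U) {y : Module.End k S}
    (hy : ∀ s, ι (y s) = x (ι s)) :
    f U (x.restrict hx) = f S y :=
  hf.mark.restrict hι hU (l := 0) (m := 0) (fun _ => rfl) hx hy

lemma EndFn.Invariant.mapQ {f : EndFn k} (hf : f.Invariant) {π : V →ₗ[k] Q}
    (hπ : Function.Surjective π) {U : Submodule k V} (hU : LinearMap.ker π = U)
    {x : Module.End k V} (hx : ∀ w ∈ U, x w ∈ U) {y : Module.End k Q}
    (hy : ∀ v, y (π v) = π (x v)) :
    f (V ⧸ U) (U.mapQ U x hx) = f Q y :=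
  hf.mark.mapQ hπ hU (l := 0) (m := 0) (fun _ => rfl) (fun _ _ => rfl) hx hy

open Classical in
/-- The contribution of a subspace to the product of a marked and an unmarked function. -/
noncomputable def prodTerm (h : MarkedFn k) (b : EndFn k) (l : V →ₗ[k] k) (x : Module.End k V)
    (U : Submodule k V) : ℂ :=
  if hx : ∀ w ∈ U, x w ∈ U then
    h U (l ∘ₗ U.subtype) (x.restrict hx) * b (V ⧸ U) (U.mapQ U x hx)
  else 0

open Classical in
/-- The contribution of a subspace to the product of an unmarked and a marked function. -/
noncomputable def prodTermRight (b : EndFn k) (h : MarkedFn k) (l : V →ₗ[k] k)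
    (x : Module.End k V) (U : Submodule k V) : ℂ :=
  if hx : (∀ w ∈ U, x w ∈ U) ∧ U ≤ LinearMap.ker l then
    b U (x.restrict hx.1) * h (V ⧸ U) (U.liftQ l hx.2) (U.mapQ U x hx.1)
  else 0

lemma stable_of_range {ι : S →ₗ[k] V} {U : Submodule k V} (hι' : LinearMap.range ι = U)
    {x : Module.End k V} {y : Module.End k S} (hy : ∀ s, ι (y s) = x (ι s)) :
    ∀ w ∈ U, x w ∈ U := by
  rintro w hw
  rw [← hι'] at hw ⊢
  obtain ⟨s, rfl⟩ := hw
  exact ⟨y s, hy s⟩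

lemma prodTerm_eq {h : MarkedFn k} {b : EndFn k} (hh : h.Invariant) (hb : b.Invariant)
    {ι : S →ₗ[k] V} {π : V →ₗ[k] Q} (hι : Function.Injective ι) (hπ : Function.Surjective π)
    {U : Submodule k V} (hι' : LinearMap.range ι = U) (hπ' : LinearMap.ker π = U)
    {l : V →ₗ[k] k} {m : S →ₗ[k] k} (hl : ∀ s, m s = l (ι s)) {x : Module.End k V}
    {y : Module.End k S} {z : Module.End k Q} (hy : ∀ s, ι (y s) = x (ι s))
    (hz : ∀ v, z (π v) = π (x v)) : prodTerm h b l x U = h S m y * b Q z := by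
  have hx := stable_of_range hι' hy
  rw [prodTerm, dif_pos hx, hh.restrict hι hι' hl hx hy, hb.mapQ hπ hπ' hx hz]

lemma prodTermRight_eq {b : EndFn k} {h : MarkedFn k} (hb : b.Invariant) (hh : h.Invariant)
    {ι : S →ₗ[k] V} {π : V →ₗ[k] Q} (hι : Function.Injective ι) (hπ : Function.Surjective π)
    {U : Submodule k V} (hι' : LinearMap.range ι = U) (hπ' : LinearMap.ker π = U)
    {l : V →ₗ[k] k} {m : Q →ₗ[k] k} (hl : ∀ v, m (π v) = l v) {x : Module.End k V}
    {y : Module.End k S} {z : Module.End k Q} (hy : ∀ s, ι (y s) = x (ι s))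
    (hz : ∀ v, z (π v) = π (x v)) : prodTermRight b h l x U = b S y * h Q m z := by
  have hx := stable_of_range hι' hy
  have hl' : U ≤ LinearMap.ker l := by
    intro v hv
    rw [← hπ', LinearMap.mem_ker] at hv
    rw [LinearMap.mem_ker, ← hl, hv, map_zero]
  rw [prodTermRight, dif_pos ⟨hx, hl'⟩, hb.restrict hι hι' hx hy, hh.mapQ hπ hπ' hl hl' hx hz]

lemma prodTerm_equiv {h : MarkedFn k} {b : EndFn k} (hh : h.Invariant) (hb : b.Invariant)
    (e : V ≃ₗ[k] W) {l : V →ₗ[k] k} {x : Module.End k V} {m : W →ₗ[k] k} {y : Module.End k W}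
    (hl : ∀ v, m (e v) = l v) (hx : ∀ v, y (e v) = e (x v)) {U : Submodule k V}
    {U' : Submodule k W} (hU : ∀ v, e v ∈ U' ↔ v ∈ U) :
    prodTerm h b l x U = prodTerm h b m y U' := by
  by_cases hs : ∀ w ∈ U, x w ∈ U
  · rw [prodTerm, dif_pos hs]
    refine (prodTerm_eq hh hb (ι := e.toLinearMap ∘ₗ U.subtype)
      (π := U.mkQ ∘ₗ e.symm.toLinearMap) ?_ ?_ ?_ ?_ ?_ ?_ ?_).symm
    · exact e.injective.comp U.subtype_injective
    · exact U.mkQ_surjective.comp e.symm.surjective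
    · rw [LinearMap.range_comp, Submodule.range_subtype]
      ext w
      obtain ⟨v, rfl⟩ := e.surjective w
      simp [hU]
    · ext w
      obtain ⟨v, rfl⟩ := e.surjective w
      simp [hU]
    · simp [hl]
    · simp [hx]
    · intro w
      obtain ⟨v, rfl⟩ := e.surjective w
      simp [hx]
  · rw [prodTerm, dif_neg hs, prodTerm, dif_neg]
    intro hs'
    refine hs fun v hv => ?_
    rw [← hU, ← hx]
    exact hs' _ ((hU v).2 hv)

/-- The product of a marked and an unmarked function. -/
noncomputable def prodLeft (h : MarkedFn k) (b : EndFn k) : MarkedFn k :=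
  fun _ _ _ l x => ∑ᶠ U, prodTerm h b l x U

/-- The product of an unmarked and a marked function. -/
noncomputable def prodRight (b : EndFn k) (h : MarkedFn k) : MarkedFn k :=
  fun _ _ _ l x => ∑ᶠ U, prodTermRight b h l x U

/-- The product of unmarked functions. -/
noncomputable def EndFn.prod (a b : EndFn k) : EndFn k := (prodLeft a.mark b).unmark

lemma prodLeft_invariant {h : MarkedFn k} {b : EndFn k} (hh : h.Invariant) (hb : b.Invariant) :
    (prodLeft h b).Invariant := by
  intro V W _ _ _ _ e l x m y hl hx
  rw [prodLeft, prodLeft, ← finsum_comp_equiv (Submodule.orderIsoMapComap e).toEquiv]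
  exact finsum_congr fun U => prodTerm_equiv hh hb e hl hx (by simp)

lemma EndFn.Invariant.prod {a b : EndFn k} (ha : a.Invariant) (hb : b.Invariant) :
    (a.prod b).Invariant :=
  (prodLeft_invariant ha.mark hb).unmark

lemma mark_prod (a b : EndFn k) : (a.prod b).mark = prodLeft a.mark b := rfl

/-- The block upper triangular endomorphism `(v₁, v₂) ↦ (x v₁ + u v₂, y v₂)`. -/
def blk (x : Module.End k V₁) (u : V₂ →ₗ[k] V₁) (y : Module.End k V₂) :
    Module.End k (V₁ × V₂) where
  toFun p := (x p.1 + u p.2, y p.2)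
  map_add' p q := by
    ext
    · simp
      abel
    · simp
  map_smul' c p := by simp

@[simp]
lemma blk_apply (x : Module.End k V₁) (u : V₂ →ₗ[k] V₁) (y : Module.End k V₂) (p : V₁ × V₂) :
    blk x u y p = (x p.1 + u p.2, y p.2) := rfl

/-- The coproduct of an unmarked function. -/
noncomputable def EndFn.coprod (f : EndFn k) (x₁ : Module.End k V₁) (x₂ : Module.End k V₂) : ℂ :=
  avg fun u : V₂ →ₗ[k] V₁ => f (V₁ × V₂) (blk x₁ u x₂)

/-- Averaging the product of two functions over block triangular endomorphisms. -/
lemma avg_prodLeft [Finite V₁] [Finite V₂] {h : MarkedFn k} {b : EndFn k} (hh : h.Invariant)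
    (hb : b.Invariant) (x₁ : Module.End k V₁) (x₂ : Module.End k V₂) (m : V₂ →ₗ[k] k)
    (w : (V₂ →ₗ[k] V₁) → ℂ) (hw : ∀ u θ, w (u + (x₁ ∘ₗ θ - θ ∘ₗ x₂)) = w u) :
    (avg fun u => w u * prodLeft h b (V₁ × V₂) (m ∘ₗ LinearMap.snd k V₁ V₂) (blk x₁ u x₂)) =
      ∑ W₁ : Submodule k V₁, ∑ W₂ : Submodule k V₂, avg fun u : homSubgroup W₁ W₂ =>
        w u * prodTerm h b (m ∘ₗ LinearMap.snd k V₁ V₂) (blk x₁ u x₂) (W₁.prod W₂) := by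
  simp only [prodLeft, finsum_eq_sum_of_fintype, Finset.mul_sum]
  refine avg_sum_submodule (fun u U => w u * prodTerm h b (m ∘ₗ LinearMap.snd k V₁ V₂)
    (blk x₁ u x₂) U) (fun θ => x₁ ∘ₗ θ - θ ∘ₗ x₂) (fun u θ W₁ W₂ => ?_) fun u W₁ W₂ hu => ?_
  · rw [hw]
    congr 1
    refine prodTerm_equiv hh hb (shear (-θ)) (by simp) (fun p => ?_) fun p => ?_
    · ext
      · simp
        abel
      · simp
    · rw [mem_shearSubmodule]
      simp [sub_eq_add_neg]
  · rw [prodTerm, dif_neg, mul_zero]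
    intro hs
    refine hu fun v hv => ?_
    have := (hs (0, v) ⟨W₁.zero_mem, hv⟩).1
    simpa using this

open Classical in
/-- The compatibility of product and coproduct. -/
lemma coprod_prod [Finite V₁] [Finite V₂] {a b : EndFn k} (ha : a.Invariant)
    (hb : b.Invariant) (x₁ : Module.End k V₁) (x₂ : Module.End k V₂) :
    (a.prod b).coprod x₁ x₂ = ∑ W₁ : Submodule k V₁, ∑ W₂ : Submodule k V₂,
      if hs : (∀ w ∈ W₁, x₁ w ∈ W₁) ∧ ∀ w ∈ W₂, x₂ w ∈ W₂ then
        a.coprod (x₁.restrict hs.1) (x₂.restrict hs.2) *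
          b.coprod (W₁.mapQ W₁ x₁ hs.1) (W₂.mapQ W₂ x₂ hs.2) else 0 := by
  have h1 := avg_prodLeft ha.mark hb x₁ x₂ 0 (fun _ => 1) (fun _ _ => rfl)
  simp only [one_mul, LinearMap.zero_comp] at h1
  refine h1.trans (Finset.sum_congr rfl fun W₁ _ => Finset.sum_congr rfl fun W₂ _ => ?_)
  split_ifs with hs
  · rw [EndFn.coprod, EndFn.coprod, ← avg_mul_right]
    simp only [← avg_mul_left]
    rw [← avg_homSubgroup]
    refine congrArg avg (funext fun u => ?_)
    refine prodTerm_eq ha.mark hb (ι := W₁.subtype.prodMap W₂.subtype)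
      (π := W₁.mkQ.prodMap W₂.mkQ) ?_ ?_ ?_ ?_ (m := 0) (fun _ => rfl) ?_ ?_
    · exact W₁.subtype_injective.prodMap W₂.subtype_injective
    · exact W₁.mkQ_surjective.prodMap W₂.mkQ_surjective
    · simp [LinearMap.range_prodMap]
    · simp [LinearMap.ker_prodMap]
    · rintro ⟨s, t⟩
      simp
      rfl
    · rintro ⟨s, t⟩
      simp
      rfl
  · refine (congrArg avg (funext fun u => ?_)).trans avg_zero
    rw [prodTerm, dif_neg]
    refine fun hs' => hs ⟨fun v hv => ?_, fun v hv => ?_⟩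
    · have := (hs' (v, 0) ⟨hv, W₂.zero_mem⟩).1
      simpa using this
    · exact (hs' (0, v) ⟨W₁.zero_mem, hv⟩).2

end EndFunctions

section Descent

variable {k : Type} [Field k]

variable (ψ : AddChar k ℂ)

/-- The descent operator: averaging the extensions by a line against an additive character. -/
noncomputable def descent (h : MarkedFn k) : MarkedFn k := fun V _ _ l x =>
  avg fun u : k →ₗ[k] V => ψ (l (u 1)) * h (V × k) (LinearMap.snd k V k) (blk x u 1)

lemma MarkedFn.Invariant.descent {h : MarkedFn k} (hh : h.Invariant) :
    (descent ψ h).Invariant := by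
  intro V W _ _ _ _ e l x m y hl hx
  rw [_root_.descent, _root_.descent,
    ← avg_equiv (LinearEquiv.congrRight e : (k →ₗ[k] V) ≃ₗ[k] (k →ₗ[k] W)).toEquiv]
  refine congrArg avg (funext fun u => ?_)
  congr 1
  · exact congrArg ψ (hl _).symm
  · refine hh _ _ (e.prodCongr (LinearEquiv.refl k k)) _ _ _ _ (fun v => rfl) ?_
    rintro ⟨v, c⟩
    simp [hx]
    rfl

lemma MarkedFn.Invariant.iterate_descent {h : MarkedFn k} (hh : h.Invariant) (n : ℕ) :
    ((_root_.descent ψ)^[n] h).Invariant := by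
  induction n with
  | zero => exact hh
  | succ n ih =>
    rw [Function.iterate_succ_apply']
    exact ih.descent ψ

lemma avg_eq_zero_of_shift {A : Type*} [AddGroup A] (F : A → ℂ) (a : A) {z : ℂ} (hz : z ≠ 1)
    (h : ∀ x, F (x + a) = z * F x) (hA : Finite A) : avg F = 0 := by
  have h1 := avg_equiv (Equiv.addRight a) F
  simp only [Equiv.coe_addRight, h, avg_mul_left] at h1
  have h2 : (z - 1) * avg F = 0 := by
    rw [sub_mul, h1, one_mul, sub_self]
  exact (mul_eq_zero.1 h2).resolve_left (sub_ne_zero.2 hz)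

variable {ψ} {V : Type} [AddCommGroup V] [Module k V]

lemma mem_map_inl {U : Submodule k V} {p : V × k} :
    p ∈ U.map (LinearMap.inl k V k) ↔ p.1 ∈ U ∧ p.2 = 0 := by
  rw [Submodule.map_inl, Submodule.mem_prod, Submodule.mem_bot]

lemma range_inl_comp_subtype (U : Submodule k V) :
    LinearMap.range (LinearMap.inl k V k ∘ₗ U.subtype) = U.map (LinearMap.inl k V k) := by
  rw [LinearMap.range_comp, Submodule.range_subtype]

lemma ker_mkQ_prodMap_id (U : Submodule k V) :
    LinearMap.ker (U.mkQ.prodMap (LinearMap.id : k →ₗ[k] k)) = U.map (LinearMap.inl k V k) := by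
  rw [Submodule.map_inl, LinearMap.ker_prodMap, LinearMap.ker_id, Submodule.ker_mkQ]

lemma sum_submodule_self [Fintype (Submodule k k)] (F : Submodule k k → ℂ) :
    ∑ W, F W = F ⊤ + F ⊥ := by
  classical
  have h1 : (Finset.univ : Finset (Submodule k k)) = {⊤, ⊥} := by
    ext W
    simp only [Finset.mem_univ, Finset.mem_insert, Finset.mem_singleton, true_iff]
    exact (eq_bot_or_eq_top W).symm
  rw [h1, Finset.sum_pair top_ne_bot]

/-- Every homomorphism preserves the zero subspace. -/
def homSubgroupBotEquiv (U : Submodule k V) :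
    homSubgroup U (⊥ : Submodule k k) ≃ (k →ₗ[k] V) where
  toFun u := u.1
  invFun u := ⟨u, fun c hc => by
    rw [Submodule.mem_bot] at hc
    rw [hc, map_zero]
    exact U.zero_mem⟩
  left_inv _ := rfl
  right_inv _ := rfl

/-- The homomorphisms into a subspace. -/
def homSubgroupTopEquiv (U : Submodule k V) :
    homSubgroup U (⊤ : Submodule k k) ≃ (k →ₗ[k] U) where
  toFun u := u.1.codRestrict U fun c => u.2 c trivial
  invFun u := ⟨U.subtype ∘ₗ u, fun c _ => (u c).2⟩
  left_inv _ := rfl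
  right_inv _ := rfl

variable [Finite k]

open Classical in
lemma avg_descent_quotient [Finite V] (hψ : ψ ≠ 1) (c : MarkedFn k) (l : V →ₗ[k] k)
    (x : Module.End k V) (U : Submodule k V) (hU : ∀ w ∈ U, x w ∈ U) :
    (avg fun u : k →ₗ[k] V => ψ (l (u 1)) *
      c ((V ⧸ U) × k) (LinearMap.snd k (V ⧸ U) k) (blk (U.mapQ U x hU) (U.mkQ ∘ₗ u) 1)) =
      if hl : U ≤ LinearMap.ker l then descent ψ c (V ⧸ U) (U.liftQ l hl) (U.mapQ U x hU)
      else 0 := by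
  split_ifs with hl
  · let π : (k →ₗ[k] V) →+ (k →ₗ[k] V ⧸ U) :=
      { toFun := fun u => U.mkQ ∘ₗ u
        map_zero' := by simp
        map_add' := fun u v => LinearMap.comp_add _ _ _ }
    refine Eq.trans ?_ (avg_comp_surjective π ?_ fun u => ψ (U.liftQ l hl (u 1)) *
      c ((V ⧸ U) × k) (LinearMap.snd k (V ⧸ U) k) (blk (U.mapQ U x hU) u 1))
    · rfl
    · intro u
      obtain ⟨v, hv⟩ := U.mkQ_surjective (u 1)
      refine ⟨LinearMap.toSpanSingleton k V v, ?_⟩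
      ext
      simpa [π] using hv
  · obtain ⟨w, hw, hlw⟩ := SetLike.not_le_iff_exists.1 hl
    rw [LinearMap.mem_ker] at hlw
    obtain ⟨c₀, hc₀⟩ := AddChar.ne_one_iff.1 hψ
    refine avg_eq_zero_of_shift _ (LinearMap.toSpanSingleton k V ((c₀ / l w) • w)) hc₀
      (fun u => ?_) inferInstance
    have h1 : U.mkQ ∘ₗ (u + LinearMap.toSpanSingleton k V ((c₀ / l w) • w)) = U.mkQ ∘ₗ u := by
      ext
      simp [(Submodule.Quotient.mk_eq_zero U).2 hw]
    rw [h1, ← mul_assoc, ← AddChar.map_add_eq_mul]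
    congr 3
    simp [hlw, add_comm]

lemma descent_prodRight [Finite V] (hψ : ψ ≠ 1) {b : EndFn k} {h : MarkedFn k}
    (hb : b.Invariant) (hh : h.Invariant) (l : V →ₗ[k] k) (x : Module.End k V) :
    descent ψ (prodRight b h) V l x = prodRight b (descent ψ h) V l x := by
  classical
  have h1 : ∀ u : k →ₗ[k] V, prodRight b h (V × k) (LinearMap.snd k V k) (blk x u 1) =
      ∑ U : Submodule k V,
        prodTermRight b h (LinearMap.snd k V k) (blk x u 1) (U.map (LinearMap.inl k V k)) := by
    intro u
    rw [prodRight, finsum_eq_sum_of_fintype]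
    refine (Finset.sum_of_injOn (fun U : Submodule k V => U.map (LinearMap.inl k V k)) ?_
      (fun _ _ => Finset.mem_coe.2 (Finset.mem_univ _)) ?_ (fun _ _ => rfl)).symm
    · intro U _ U' _ hUU'
      ext v
      have := SetLike.ext_iff.1 hUU' (v, 0)
      simpa only [mem_map_inl, and_true] using this
    · intro U _ hU
      rw [prodTermRight, dif_neg]
      rintro ⟨-, h2⟩
      refine hU ⟨U.comap (LinearMap.inl k V k), Finset.mem_coe.2 (Finset.mem_univ _), ?_⟩
      ext ⟨v, c⟩
      simp only [mem_map_inl, Submodule.mem_comap, LinearMap.inl_apply]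
      constructor
      · rintro ⟨h3, rfl⟩
        exact h3
      · intro h3
        have : c = 0 := h2 h3
        subst this
        exact ⟨h3, rfl⟩
  rw [descent]
  simp only [h1, Finset.mul_sum]
  rw [avg_sum, prodRight, finsum_eq_sum_of_fintype]
  refine Finset.sum_congr rfl fun U _ => ?_
  by_cases hU : ∀ w ∈ U, x w ∈ U
  · have h2 : ∀ u : k →ₗ[k] V,
        prodTermRight b h (LinearMap.snd k V k) (blk x u 1) (U.map (LinearMap.inl k V k)) =
        b U (x.restrict hU) * h ((V ⧸ U) × k) (LinearMap.snd k (V ⧸ U) k)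
          (blk (U.mapQ U x hU) (U.mkQ ∘ₗ u) 1) := by
      intro u
      refine prodTermRight_eq hb hh (ι := LinearMap.inl k V k ∘ₗ U.subtype)
        (π := U.mkQ.prodMap LinearMap.id) ?_ ?_ ?_ ?_ ?_ ?_ ?_
      · exact LinearMap.inl_injective.comp U.subtype_injective
      · exact U.mkQ_surjective.prodMap Function.surjective_id
      · exact range_inl_comp_subtype U
      · exact ker_mkQ_prodMap_id U
      · simp
      · simp
      · rintro ⟨v, c⟩
        simp
    simp only [h2, mul_left_comm _ (b U _)]
    rw [avg_mul_left, avg_descent_quotient hψ, prodTermRight]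
    split_ifs with h3 h4 h4
    · rfl
    · exact absurd ⟨hU, h3⟩ h4
    · exact absurd h4.2 h3
    · rw [mul_zero]
  · rw [prodTermRight, dif_neg fun h2 => hU h2.1]
    refine (congrArg avg (funext fun u => ?_)).trans avg_zero
    rw [prodTermRight, dif_neg, mul_zero]
    refine fun h2 => hU fun w hw => ?_
    have := (mem_map_inl.1 (h2.1 (w, 0) (mem_map_inl.2 ⟨hw, rfl⟩))).1
    simpa using this

lemma descent_prodLeft [Finite V] (hψ : ψ ≠ 1) {h : MarkedFn k} {b : EndFn k}
    (hh : h.Invariant) (hb : b.Invariant) (l : V →ₗ[k] k) (x : Module.End k V)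
    (hl : ∀ v, l (x v) = l v) :
    descent ψ (prodLeft h b) V l x =
      prodLeft (descent ψ h) b V l x + prodRight h.unmark (descent ψ b.mark) V l x := by
  classical
  have h0 := avg_prodLeft hh hb x (1 : Module.End k k) LinearMap.id (fun u => ψ (l (u 1)))
    (by simp [hl])
  rw [LinearMap.id_comp] at h0
  rw [descent, h0]
  simp only [sum_submodule_self, ← Submodule.map_inl]
  rw [Finset.sum_add_distrib, prodLeft, prodRight, finsum_eq_sum_of_fintype,
    finsum_eq_sum_of_fintype]
  congr 1
  · refine Finset.sum_congr rfl fun U _ => ?_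
    by_cases hU : ∀ w ∈ U, x w ∈ U
    · rw [prodTerm, dif_pos hU, descent, ← avg_mul_right]
      rw [← avg_equiv (homSubgroupTopEquiv U)]
      refine congrArg avg (funext fun u => ?_)
      rw [mul_assoc]
      refine congrArg₂ _ rfl (prodTerm_eq hh hb (ι := U.subtype.prodMap LinearMap.id)
        (π := U.mkQ ∘ₗ LinearMap.fst k V k) ?_ ?_ ?_ ?_ ?_ ?_ ?_)
      · exact U.subtype_injective.prodMap Function.injective_id
      · exact U.mkQ_surjective.comp Prod.fst_surjective
      · simp [LinearMap.range_prodMap]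
      · ext ⟨v, c⟩
        simp
      · simp
      · rintro ⟨v, c⟩
        simp
        rfl
      · rintro ⟨v, c⟩
        have : (Submodule.Quotient.mk (u.1 c) : V ⧸ U) = 0 :=
          (Submodule.Quotient.mk_eq_zero U).2 (u.2 c trivial)
        simp [this]
    · rw [prodTerm, dif_neg hU]
      refine (congrArg avg (funext fun u => ?_)).trans avg_zero
      rw [prodTerm, dif_neg, mul_zero]
      refine fun h2 => hU fun w hw => ?_
      have := (h2 (w, 0) ⟨hw, trivial⟩).1
      simpa using this
  · refine Finset.sum_congr rfl fun U _ => ?_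
    by_cases hU : ∀ w ∈ U, x w ∈ U
    · have h2 : ∀ u : k →ₗ[k] V,
          prodTerm h b (LinearMap.snd k V k) (blk x u 1) (U.map (LinearMap.inl k V k)) =
          h U 0 (x.restrict hU) * b ((V ⧸ U) × k) (blk (U.mapQ U x hU) (U.mkQ ∘ₗ u) 1) := by
        intro u
        refine prodTerm_eq hh hb (ι := LinearMap.inl k V k ∘ₗ U.subtype)
          (π := U.mkQ.prodMap LinearMap.id) ?_ ?_ ?_ ?_ ?_ ?_ ?_
        · exact LinearMap.inl_injective.comp U.subtype_injective
        · exact U.mkQ_surjective.prodMap Function.surjective_id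
        · exact range_inl_comp_subtype U
        · exact ker_mkQ_prodMap_id U
        · simp
        · simp
        · rintro ⟨v, c⟩
          simp
      refine (avg_equiv (homSubgroupBotEquiv U) fun u => ψ (l (u 1)) *
        prodTerm h b (LinearMap.snd k V k) (blk x u 1) (U.map (LinearMap.inl k V k))).trans ?_
      simp only [h2, mul_left_comm _ (h U _ _)]
      have h5 := avg_descent_quotient hψ b.mark l x U hU
      simp only [EndFn.mark] at h5
      rw [avg_mul_left, h5, prodTermRight]
      split_ifs with h3 h4 h4
      · rfl
      · exact absurd ⟨hU, h3⟩ h4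
      · exact absurd h4.2 h3
      · rw [mul_zero]
    · rw [prodTermRight, dif_neg fun h2 => hU h2.1]
      refine (congrArg avg (funext fun u => ?_)).trans avg_zero
      rw [prodTerm, dif_neg, mul_zero]
      refine fun h2 => hU fun w hw => ?_
      have := (mem_map_inl.1 (h2 (w, 0) (mem_map_inl.2 ⟨hw, rfl⟩))).1
      simpa using this

lemma iterate_descent_prodLeft (hψ : ψ ≠ 1) {h : MarkedFn k} {b : EndFn k}
    (hh : h.Invariant) (hb : b.Invariant) (n : ℕ) : ∀ (V : Type) [AddCommGroup V] [Module k V]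
    [Finite V] (l : V →ₗ[k] k) (x : Module.End k V) (_ : ∀ v, l (x v) = l v),
    (descent ψ)^[n] (prodLeft h b) V l x = prodLeft ((descent ψ)^[n] h) b V l x +
      ∑ i ∈ Finset.range n, prodRight ((descent ψ)^[i] h).unmark
        ((descent ψ)^[n - i] b.mark) V l x := by
  induction n with
  | zero => simp
  | succ n ih =>
    intro V _ _ _ l x hl
    rw [Function.iterate_succ_apply', descent]
    have h1 : ∀ u : k →ₗ[k] V, _ := fun u => ih (V × k) (LinearMap.snd k V k) (blk x u 1)
      (fun v => rfl)
    simp only [h1, mul_add, Finset.mul_sum]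
    rw [avg_add, avg_sum, Finset.sum_range_succ, ← add_assoc, add_right_comm,
      Function.iterate_succ_apply', Nat.add_sub_cancel_left, Function.iterate_one]
    congr 1
    · exact descent_prodLeft hψ (hh.iterate_descent ψ n) hb l x hl
    · refine Finset.sum_congr rfl fun i hi => ?_
      have h2 : n + 1 - i = n - i + 1 := by
        have := Finset.mem_range.1 hi
        omega
      rw [h2, Function.iterate_succ_apply']
      exact descent_prodRight hψ (hh.iterate_descent ψ i).unmark
        (hb.mark.iterate_descent ψ _) l x

/-- The value at the zero space. -/
def MarkedFn.atZero (h : MarkedFn k) : ℂ := h PUnit 0 0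

omit [Finite k] in
lemma atZero_prodLeft {h : MarkedFn k} {b : EndFn k} (hh : h.Invariant) (hb : b.Invariant) :
    (prodLeft h b).atZero = h.atZero * b.mark.atZero := by
  rw [MarkedFn.atZero, prodLeft, finsum_eq_single _ ⊥ fun U hU => (hU (Subsingleton.elim _ _)).elim]
  exact prodTerm_eq hh hb (ι := LinearMap.id) (π := LinearMap.id) Function.injective_id
    Function.surjective_id (Subsingleton.elim _ _) (Subsingleton.elim _ _) (fun _ => rfl)
    (fun _ => rfl) (fun _ => rfl)

omit [Finite k] in
lemma atZero_prodRight {b : EndFn k} {h : MarkedFn k} (hb : b.Invariant) (hh : h.Invariant) :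
    (prodRight b h).atZero = b.mark.atZero * h.atZero := by
  rw [MarkedFn.atZero, prodRight,
    finsum_eq_single _ ⊥ fun U hU => (hU (Subsingleton.elim _ _)).elim]
  exact prodTermRight_eq hb hh (ι := LinearMap.id) (π := LinearMap.id) Function.injective_id
    Function.surjective_id (Subsingleton.elim _ _) (Subsingleton.elim _ _) (fun _ => rfl)
    (fun _ => rfl) (fun _ => rfl)

/-- The Leibniz rule for iterated descents to the zero space. -/
lemma atZero_iterate_descent_prod (hψ : ψ ≠ 1) {a b : EndFn k} (ha : a.Invariant)
    (hb : b.Invariant) (n : ℕ) : ((descent ψ)^[n] (a.prod b).mark).atZero =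
      ∑ i ∈ Finset.range (n + 1), ((descent ψ)^[i] a.mark).atZero *
        ((descent ψ)^[n - i] b.mark).atZero := by
  rw [mark_prod, MarkedFn.atZero, iterate_descent_prodLeft hψ ha.mark hb n PUnit 0 0
    (fun _ => rfl), Finset.sum_range_succ, Nat.sub_self, add_comm]
  congr 1
  · exact Finset.sum_congr rfl fun i _ => atZero_prodRight (ha.mark.iterate_descent ψ i).unmark
      (hb.mark.iterate_descent ψ _)
  · exact atZero_prodLeft (ha.mark.iterate_descent ψ n) hb

end Descent

section DescentCoproduct

variable {k : Type} [Field k]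

variable {V V₁ V₂ V₃ : Type} [AddCommGroup V] [Module k V] [AddCommGroup V₁] [Module k V₁]
  [AddCommGroup V₂] [Module k V₂] [AddCommGroup V₃] [Module k V₃]

lemma avg_avg_assoc [Finite V₁] [Finite V₂] [Finite V₃]
    (F : (V₂ →ₗ[k] V₁) → (V₃ →ₗ[k] V₁) → (V₃ →ₗ[k] V₂) → ℂ) :
    (avg fun w : V₂ × V₃ →ₗ[k] V₁ => avg fun u : V₃ →ₗ[k] V₂ =>
      F (w ∘ₗ LinearMap.inl k V₂ V₃) (w ∘ₗ LinearMap.inr k V₂ V₃) u) =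
    avg fun u : V₂ →ₗ[k] V₁ => avg fun s : V₃ →ₗ[k] V₁ × V₂ =>
      F u (LinearMap.fst k V₁ V₂ ∘ₗ s) (LinearMap.snd k V₁ V₂ ∘ₗ s) := by
  rw [← avg_equiv (LinearMap.coprodEquiv k (M := V₂) (M₂ := V₃) (M₃ := V₁)).toEquiv]
  refine Eq.trans ?_ ((avg_prod (fun (a : V₂ →ₗ[k] V₁) (b : V₃ →ₗ[k] V₁) =>
    avg fun u : V₃ →ₗ[k] V₂ => F a b u)).trans ?_)
  · refine congrArg avg (funext fun p => congrArg avg (funext fun u => ?_))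
    simp
  · refine congrArg avg (funext fun a => ?_)
    rw [← avg_prod, ← avg_equiv (LinearMap.prodEquiv k (M := V₃) (M₂ := V₁) (M₃ := V₂)).toEquiv]
    refine congrArg avg (funext fun p => ?_)
    simp

/-- Averaging over the block triangular endomorphisms with a fixed upper block. -/
noncomputable def MarkedFn.part (h : MarkedFn k) (x : Module.End k V) : MarkedFn k :=
  fun Y _ _ l y => avg fun u : Y →ₗ[k] V => h (V × Y) (l ∘ₗ LinearMap.snd k V Y) (blk x u y)

lemma descent_part [Finite k] (ψ : AddChar k ℂ) {h : MarkedFn k} (hh : h.Invariant) [Finite V]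
    (x : Module.End k V) (Y : Type) [AddCommGroup Y] [Module k Y] [Finite Y] (l : Y →ₗ[k] k)
    (y : Module.End k Y) :
    descent ψ (h.part x) Y l y = (descent ψ h).part x Y l y := by
  have h1 := avg_avg_assoc (V₁ := V) (V₂ := Y) (V₃ := k) fun u v w => ψ (l (w 1)) *
    h ((V × Y) × k) (LinearMap.snd k (V × Y) k) (blk (blk x u y) (v.prod w) 1)
  refine Eq.trans ?_ h1
  rw [avg_comm]
  refine congrArg avg (funext fun w => ?_)
  rw [MarkedFn.part, ← avg_mul_left]
  refine congrArg avg (funext fun u => congrArg _ ?_)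
  refine hh _ _ (LinearEquiv.prodAssoc k V Y k).symm _ _ _ _ (fun p => rfl) ?_
  rintro ⟨v, a, b⟩
  have : u (a, b) = u (a, 0) + u (0, b) := by
    rw [← map_add]
    simp
  have hs : ∀ p q r, (LinearEquiv.prodAssoc k V Y k).symm (p, q, r) = ((p, q), r) := fun _ _ _ => rfl
  simp [this, add_assoc, hs]

lemma iterate_descent_part [Finite k] (ψ : AddChar k ℂ) {h : MarkedFn k} (hh : h.Invariant)
    [Finite V] (x : Module.End k V) (n : ℕ) : ∀ (Y : Type) [AddCommGroup Y] [Module k Y]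
    [Finite Y] (l : Y →ₗ[k] k) (y : Module.End k Y),
    (descent ψ)^[n] (h.part x) Y l y = ((descent ψ)^[n] h).part x Y l y := by
  induction n with
  | zero => exact fun _ _ _ _ _ _ => rfl
  | succ n ih =>
    intro Y _ _ _ l y
    rw [Function.iterate_succ_apply', Function.iterate_succ_apply', ←
      descent_part ψ (hh.iterate_descent ψ n)]
    refine congrArg avg (funext fun u => congrArg _ ?_)
    exact ih _ _ _

/-- Iterated descents are computed on the second factor of the coproduct. -/
lemma iterate_descent_mark_eq [Finite k] (ψ : AddChar k ℂ) {f : EndFn k} (hf : f.Invariant)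
    [Finite V] (x : Module.End k V) (n : ℕ) :
    (descent ψ)^[n] f.mark V 0 x =
      ((descent ψ)^[n] (EndFn.mark fun _ _ _ y => f.coprod x y)).atZero := by
  refine Eq.trans ?_ (iterate_descent_part ψ hf.mark x n PUnit 0 0).symm
  rw [MarkedFn.part]
  refine Eq.trans ?_ (avg_unique _).symm
  refine hf.mark.iterate_descent ψ n _ _ (LinearEquiv.prodUnique (R := k)).symm _ _ _ _
    (fun _ => rfl) fun v => ?_
  ext
  simp [LinearEquiv.prodUnique]

/-- The coassociativity of the coproduct. -/
lemma coprod_coprod [Finite V₁] [Finite V₂] [Finite V₃] {f : EndFn k} (hf : f.Invariant)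
    (x₁ : Module.End k V₁) (x₂ : Module.End k V₂) (x₃ : Module.End k V₃) :
    (avg fun u : V₃ →ₗ[k] V₂ => f.coprod x₁ (blk x₂ u x₃)) =
      avg fun u : V₂ →ₗ[k] V₁ => f.coprod (blk x₁ u x₂) x₃ := by
  have h1 := avg_avg_assoc (V₁ := V₁) (V₂ := V₂) (V₃ := V₃) fun u v w =>
    f ((V₁ × V₂) × V₃) (blk (blk x₁ u x₂) (v.prod w) x₃)
  refine Eq.trans ?_ h1
  rw [avg_comm]
  refine congrArg avg (funext fun w => congrArg avg (funext fun u => ?_))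
  refine hf _ _ (LinearEquiv.prodAssoc k V₁ V₂ V₃).symm _ _ ?_
  rintro ⟨v, a, b⟩
  have : u (a, b) = u (a, 0) + u (0, b) := by
    rw [← map_add]
    simp
  have hs : ∀ p q r, (LinearEquiv.prodAssoc k V₁ V₂ V₃).symm (p, q, r) = ((p, q), r) := fun _ _ _ => rfl
  simp [this, add_assoc, hs]

open Classical in
lemma avg_dual_apply [Finite V] [Finite k] {ψ : AddChar k ℂ} (hψ : ψ ≠ 1) (v : V) :
    (avg fun l : V →ₗ[k] k => ψ (l v)) = if v = 0 then 1 else 0 := by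
  let Ψ : AddChar (V →ₗ[k] k) ℂ :=
    { toFun := fun l => ψ (l v)
      map_zero_eq_one' := by simp
      map_add_eq_mul' := fun l m => ψ.map_add_eq_mul _ _ }
  refine (avg_addChar Ψ).trans (if_congr ⟨fun h => ?_, fun h => ?_⟩ rfl rfl)
  · by_contra hv
    obtain ⟨l, hl⟩ := Module.Projective.exists_dual_ne_zero k hv
    obtain ⟨c, hc⟩ := AddChar.ne_one_iff.1 hψ
    refine hc ?_
    have := DFunLike.congr_fun h ((c / l v) • l)
    simpa [Ψ, hl] using this
  · subst h
    ext l
    simp [Ψ]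

lemma eq_zero_of_descent_eq_zero [Finite V] [Finite k] {ψ : AddChar k ℂ} (hψ : ψ ≠ 1)
    (h : MarkedFn k) (x : Module.End k V) (h0 : ∀ l, descent ψ h V l x = 0) (u₀ : k →ₗ[k] V) :
    h (V × k) (LinearMap.snd k V k) (blk x u₀ 1) = 0 := by
  classical
  have h1 : (avg fun l : V →ₗ[k] k => ψ (-l (u₀ 1)) * descent ψ h V l x) = 0 := by
    simp only [h0, mul_zero, avg_zero]
  simp only [descent, ← avg_mul_left] at h1
  rw [avg_comm] at h1
  have h2 : ∀ (u : k →ₗ[k] V), (avg fun l : V →ₗ[k] k => ψ (-l (u₀ 1)) * (ψ (l (u 1)) *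
      h (V × k) (LinearMap.snd k V k) (blk x u 1))) =
      if u = u₀ then h (V × k) (LinearMap.snd k V k) (blk x u₀ 1) else 0 := by
    intro u
    have h3 : ∀ l : V →ₗ[k] k, ψ (-l (u₀ 1)) * (ψ (l (u 1)) *
        h (V × k) (LinearMap.snd k V k) (blk x u 1)) =
        ψ (l (u 1 - u₀ 1)) * h (V × k) (LinearMap.snd k V k) (blk x u 1) := by
      intro l
      rw [← mul_assoc, ← AddChar.map_add_eq_mul, map_sub, sub_eq_neg_add]
    simp only [h3]
    rw [avg_mul_right, avg_dual_apply hψ]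
    by_cases hu : u = u₀
    · simp [hu]
    · rw [if_neg, if_neg hu, zero_mul]
      refine fun h4 => hu ?_
      ext
      exact sub_eq_zero.1 h4
  simp only [h2] at h1
  have := Fintype.ofFinite (k →ₗ[k] V)
  rw [avg_eq_sum, Finset.sum_ite_eq' Finset.univ u₀, if_pos (Finset.mem_univ _)] at h1
  exact (mul_eq_zero.1 h1).resolve_left (inv_ne_zero (Nat.cast_ne_zero.2 Nat.card_pos.ne'))

lemma exists_equiv_ker_prod (l : V →ₗ[k] k) (hl : l ≠ 0) :
    ∃ e : (LinearMap.ker l × k) ≃ₗ[k] V, ∀ p, l (e p) = p.2 := by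
  obtain ⟨v, hv⟩ : ∃ v, l v ≠ 0 := by
    by_contra! h
    exact hl (LinearMap.ext h)
  have hw : l ((l v)⁻¹ • v) = 1 := by simp [hv]
  set w := (l v)⁻¹ • v
  let e := LinearMap.coprod (LinearMap.ker l).subtype (LinearMap.toSpanSingleton k V w)
  have he : ∀ p, l (e p) = p.2 := fun p => by simp [e, hw]
  refine ⟨LinearEquiv.ofBijective e ⟨?_, fun v => ?_⟩, he⟩
  · rw [injective_iff_map_eq_zero]
    rintro ⟨a, c⟩ hp
    have hc : c = 0 := by
      have := he (a, c)
      rw [hp, map_zero] at this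
      exact this.symm
    subst hc
    simpa [e] using hp
  · exact ⟨(⟨v - l v • w, by simp [hw]⟩, l v), by simp [e]⟩

lemma eq_zero_of_iterate_descent_eq_zero [Finite k] {ψ : AddChar k ℂ} (hψ : ψ ≠ 1) {f : EndFn k}
    (hf : f.Invariant) {n : ℕ} (hn : 0 < n)
    (h0 : ∀ (V : Type) [AddCommGroup V] [Module k V] [Finite V] (j : ℕ), 0 < j →
      Module.finrank k V + j = n → (descent ψ)^[j] f.mark V 0 1 = 0)
    (V : Type) [AddCommGroup V] [Module k V] [Finite V] (hV : Module.finrank k V = n) :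
    f V 1 = 0 := by
  have h1 : ∀ (d : ℕ) (V : Type) [AddCommGroup V] [Module k V] [Finite V] (j : ℕ)
      (l : V →ₗ[k] k), (l = 0 → 0 < j) → Module.finrank k V = d → d + j = n →
      (descent ψ)^[j] f.mark V l 1 = 0 := by
    intro d
    induction d with
    | zero =>
      intro V _ _ _ j l hl hd hj
      have : Subsingleton V := Module.finrank_zero_iff.1 hd
      have h2 : l = 0 := Subsingleton.elim _ _
      subst h2
      exact h0 V j (hl rfl) (hd ▸ hj)
    | succ d ih =>
      intro V _ _ _ j l hl hd hj
      by_cases hl0 : l = 0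
      · subst hl0
        exact h0 V j (hl rfl) (hd ▸ hj)
      obtain ⟨e, he⟩ := exists_equiv_ker_prod l hl0
      have h3 : Module.finrank k (LinearMap.ker l) = d := by
        have := e.finrank_eq
        rw [Module.finrank_prod, Module.finrank_self, hd] at this
        omega
      rw [← hf.mark.iterate_descent ψ j _ _ e (LinearMap.snd k _ k) 1 l 1 he (fun _ => rfl)]
      have h4 := eq_zero_of_descent_eq_zero hψ ((descent ψ)^[j] f.mark)
        (1 : Module.End k (LinearMap.ker l)) (fun l' => by
          refine (congrFun (congrFun (congrFun (congrFun (congrFun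
            (Function.iterate_succ_apply' (descent ψ) j f.mark) _) _) _) l') _).symm.trans ?_
          exact ih _ (j + 1) l' (fun _ => j.succ_pos) h3 (by omega)) 0
      rwa [show blk (1 : Module.End k (LinearMap.ker l)) (0 : k →ₗ[k] _) 1 = 1 by
        ext <;> simp] at h4
  have : Nontrivial V := Module.nontrivial_of_finrank_pos (R := k) (by omega)
  obtain ⟨v, hv⟩ := exists_ne (0 : V)
  obtain ⟨l, hl⟩ := Module.Projective.exists_dual_ne_zero k hv
  exact h1 n V 0 l (fun h => (hl (by simp [h])).elim) hV rfl

end DescentCoproduct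

section Labels

variable {k : Type} [Field k]

variable (k) in
/-- The automorphisms of the standard space. -/
abbrev StdAut (n : ℕ) := (Fin n → k) ≃ₗ[k] (Fin n → k)

open Classical in
/-- The extension of a class function of the automorphisms of the standard space to all spaces. -/
noncomputable def extend {n : ℕ} (χ : StdAut k n → ℂ) : EndFn k := fun V _ _ x =>
  if h : ∃ (e : (Fin n → k) ≃ₗ[k] V) (g : StdAut k n), ∀ v, x (e v) = e (g v) then
    χ h.choose_spec.choose else 0

variable {V W : Type} [AddCommGroup V] [Module k V] [AddCommGroup W] [Module k W]

lemma extend_eq {n : ℕ} {χ : StdAut k n → ℂ} (hχ : ∀ g h, χ (h * g * h⁻¹) = χ g)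
    (e : (Fin n → k) ≃ₗ[k] V) (g : StdAut k n) {x : Module.End k V}
    (hx : ∀ v, x (e v) = e (g v)) : extend χ V x = χ g := by
  have h : ∃ (e : (Fin n → k) ≃ₗ[k] V) (g : StdAut k n), ∀ v, x (e v) = e (g v) := ⟨e, g, hx⟩
  rw [extend, dif_pos h, ← hχ g (e.trans h.choose.symm)]
  congr 1
  ext1 v
  have h1 := h.choose_spec.choose_spec v
  change _ = h.choose.symm (e (g (e.symm (h.choose v))))
  rw [← hx, LinearEquiv.apply_symm_apply, h1, LinearEquiv.symm_apply_apply]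

lemma extend_eq_zero {n : ℕ} {χ : StdAut k n → ℂ} {x : Module.End k V}
    (h : Module.finrank k V ≠ n) : extend χ V x = 0 := by
  rw [extend, dif_neg]
  rintro ⟨e, -⟩
  refine h ?_
  rw [← e.finrank_eq, Module.finrank_fin_fun]

lemma extend_invariant {n : ℕ} {χ : StdAut k n → ℂ} (hχ : ∀ g h, χ (h * g * h⁻¹) = χ g) :
    (extend χ).Invariant := by
  intro V W _ _ _ _ e x y hx
  by_cases h : ∃ (i : (Fin n → k) ≃ₗ[k] V) (g : StdAut k n), ∀ v, x (i v) = i (g v)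
  · obtain ⟨i, g, hg⟩ := h
    rw [extend_eq hχ i g hg, extend_eq hχ (i.trans e) g]
    simp [hx, hg]
  · rw [extend, dif_neg h, extend, dif_neg]
    rintro ⟨i, g, hg⟩
    refine h ⟨i.trans e.symm, g, fun v => e.injective ?_⟩
    rw [← hx]
    simp [hg]

variable (k) in
/-- The irreducible characters of all general linear groups. -/
abbrev IrrLabel := Σ n : ℕ, {χ : StdAut k n → ℂ // IsIrrCharacter χ}

/-- The function of endomorphisms attached to an irreducible character. -/
noncomputable def IrrLabel.fn (a : IrrLabel k) : EndFn k := extend a.2.1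

lemma IrrLabel.conj (a : IrrLabel k) (g h : StdAut k a.1) : a.2.1 (h * g * h⁻¹) = a.2.1 g :=
  a.2.2.isCharacter.conj_mul g h

lemma IrrLabel.fn_invariant (a : IrrLabel k) : a.fn.Invariant := extend_invariant a.conj

lemma IrrLabel.fn_std (a : IrrLabel k) (g : StdAut k a.1) :
    a.fn (Fin a.1 → k) g.toLinearMap = a.2.1 g :=
  extend_eq a.conj (LinearEquiv.refl k _) g fun _ => rfl

lemma IrrLabel.fn_eq_zero (a : IrrLabel k) {x : Module.End k V} (h : Module.finrank k V ≠ a.1) :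
    a.fn V x = 0 :=
  extend_eq_zero h

/-- The multiplicity of an irreducible character. -/
noncomputable def coef (f : EndFn k) (a : IrrLabel k) : ℂ :=
  avg fun g : StdAut k a.1 => f (Fin a.1 → k) g.toLinearMap * star (a.2.1 g)

variable [Finite k]

noncomputable instance fintypeIrrCharacter {G : Type} [Group G] [Finite G] :
    Fintype {χ : G → ℂ // IsIrrCharacter χ} :=
  have := Fintype.ofFinite G
  finite_setOf_isIrrCharacter.fintype

noncomputable instance fintypeStdAut (n : ℕ) : Fintype (StdAut k n) := Fintype.ofFinite _

variable (k) in
/-- The irreducible characters of bounded degree. -/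
noncomputable def labelBall (N : ℕ) : Finset (IrrLabel k) :=
  (Finset.range (N + 1)).sigma fun _ => Finset.univ

lemma mem_labelBall {a : IrrLabel k} {N : ℕ} : a ∈ labelBall k N ↔ a.1 ≤ N := by
  simp [labelBall]

lemma avg_mul_star {G : Type} [Group G] [Fintype G] (f χ : G → ℂ) :
    avg (fun g => f g * star (χ g)) = pairing f (star χ) := by
  rw [avg_eq_sum, pairing]
  rfl

omit [Finite k] in
lemma coef_congr {f f' : EndFn k} {a : IrrLabel k}
    (h : ∀ g : StdAut k a.1, f (Fin a.1 → k) g.toLinearMap = f' (Fin a.1 → k) g.toLinearMap) :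
    coef f a = coef f' a := by
  simp only [coef, h]

lemma coef_sum {ι : Type*} (s : Finset ι) (z : ι → ℂ) (F : ι → EndFn k) (a : IrrLabel k) :
    coef (fun V _ _ x => ∑ i ∈ s, z i * F i V x) a = ∑ i ∈ s, z i * coef (F i) a := by
  simp only [coef, Finset.sum_mul, mul_assoc]
  rw [avg_sum]
  simp only [avg_mul_left]

open Classical in
lemma coef_fn (a b : IrrLabel k) : coef a.fn b = if a = b then 1 else 0 := by
  rw [coef]
  split_ifs with h
  · subst h
    simp only [a.fn_std]
    rw [avg_mul_star, a.2.2.pairing a.2.2, if_pos rfl]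
  · obtain ⟨n, χ, hχ⟩ := a
    obtain ⟨m, χ', hχ'⟩ := b
    by_cases hnm : n = m
    · subst hnm
      have h1 := (IrrLabel.fn_std (⟨n, χ, hχ⟩ : IrrLabel k))
      simp only at h1
      simp only [h1]
      rw [avg_mul_star, hχ.pairing hχ', if_neg]
      rintro rfl
      exact h rfl
    · refine (congrArg avg (funext fun g => ?_)).trans avg_zero
      rw [IrrLabel.fn_eq_zero, zero_mul]
      simpa using Ne.symm hnm

/-- Expansion in irreducible characters. -/
lemma expand {f : EndFn k} (hf : f.Invariant) {V : Type} [AddCommGroup V] [Module k V] [Finite V]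
    {N : ℕ} (hN : Module.finrank k V ≤ N) {x : Module.End k V} (hx : Function.Injective x) :
    f V x = ∑ e ∈ labelBall k N, coef f e * e.fn V x := by
  let n := Module.finrank k V
  let i : (Fin n → k) ≃ₗ[k] V := (Module.finBasis k V).equivFun.symm
  let g : StdAut k n := i.trans ((LinearEquiv.ofInjectiveEndo x hx).trans i.symm)
  have hg : ∀ v, x (i v) = i (g v) := fun v => by simp [g]
  rw [labelBall, Finset.sum_sigma, Finset.sum_eq_single n]
  · have h1 : f V x = f (Fin n → k) g.toLinearMap := (hf _ _ i _ _ hg).symm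
    have h2 := classFunction_expand (G := StdAut k n) (f := fun g => f (Fin n → k) g.toLinearMap)
      (fun a b => hf _ _ b⁻¹ _ _ fun v => by
        change a (b.symm v) = b.symm (b (a (b.symm v)))
        simp) g
    rw [h1, h2, Finset.sum_subtype (irrChars (StdAut k n)) (fun χ => mem_irrChars)]
    refine Finset.sum_congr rfl fun χ _ => congrArg₂ _ (avg_mul_star _ _).symm ?_
    exact (extend_eq (IrrLabel.conj ⟨n, χ⟩) i g hg).symm
  · intro m _ hm
    refine Finset.sum_eq_zero fun χ _ => ?_
    rw [IrrLabel.fn_eq_zero _ hm.symm, mul_zero]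
  · intro h
    exact absurd (Finset.mem_range.2 (Nat.lt_succ_of_le hN)) h

end Labels

section Multiplicities

variable {k : Type} [Field k]

variable {V₁ V₂ W₁ W₂ : Type} [AddCommGroup V₁] [Module k V₁] [AddCommGroup V₂] [Module k V₂]
  [AddCommGroup W₁] [Module k W₁] [AddCommGroup W₂] [Module k W₂]

lemma EndFn.Invariant.coprod_eq {f : EndFn k} (hf : f.Invariant) (e₁ : V₁ ≃ₗ[k] W₁)
    (e₂ : V₂ ≃ₗ[k] W₂) {x₁ : Module.End k V₁} {x₂ : Module.End k V₂} {y₁ : Module.End k W₁}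
    {y₂ : Module.End k W₂} (h₁ : ∀ v, y₁ (e₁ v) = e₁ (x₁ v)) (h₂ : ∀ v, y₂ (e₂ v) = e₂ (x₂ v)) :
    f.coprod x₁ x₂ = f.coprod y₁ y₂ := by
  rw [EndFn.coprod, EndFn.coprod, ← avg_equiv (LinearEquiv.arrowCongr e₂ e₁).toEquiv]
  refine congrArg avg (funext fun u => ?_)
  refine hf _ _ (e₁.prodCongr e₂) _ _ ?_
  rintro ⟨v, w⟩
  simp [h₁, h₂]

lemma EndFn.Invariant.coprod_left {f : EndFn k} (hf : f.Invariant) (x₂ : Module.End k V₂) :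
    EndFn.Invariant fun V _ _ x₁ => f.coprod (V₁ := V) x₁ x₂ :=
  fun _ _ _ _ _ _ e _ _ h => hf.coprod_eq e (LinearEquiv.refl k V₂) h fun _ => rfl

lemma EndFn.Invariant.coprod_right {f : EndFn k} (hf : f.Invariant) (x₁ : Module.End k V₁) :
    EndFn.Invariant fun V _ _ x₂ => f.coprod (V₂ := V) x₁ x₂ :=
  fun _ _ _ _ _ _ e _ _ h => hf.coprod_eq (LinearEquiv.refl k V₁) e (fun _ => rfl) h

lemma blk_injective {x₁ : Module.End k V₁} {x₂ : Module.End k V₂} (h₁ : Function.Injective x₁)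
    (h₂ : Function.Injective x₂) (u : V₂ →ₗ[k] V₁) : Function.Injective (blk x₁ u x₂) := by
  rintro ⟨a, b⟩ ⟨a', b'⟩ h
  simp only [blk_apply, Prod.mk.injEq] at h
  obtain rfl := h₂ h.2
  rw [h₁ (add_right_cancel h.1)]

/-- The multiplicity of a pair of irreducible characters in the coproduct. -/
noncomputable def cof (f : EndFn k) (a b : IrrLabel k) : ℂ :=
  coef (fun V₁ _ _ x₁ => coef (fun V₂ _ _ x₂ => f.coprod (V₁ := V₁) (V₂ := V₂) x₁ x₂) b) a

variable [Finite k]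

lemma coef_comm (F : ∀ (V₁ : Type) [AddCommGroup V₁] [Module k V₁], Module.End k V₁ →
    ∀ (V₂ : Type) [AddCommGroup V₂] [Module k V₂], Module.End k V₂ → ℂ) (a b : IrrLabel k) :
    coef (fun V₁ _ _ x₁ => coef (fun V₂ _ _ x₂ => F V₁ x₁ V₂ x₂) b) a =
      coef (fun V₂ _ _ x₂ => coef (fun V₁ _ _ x₁ => F V₁ x₁ V₂ x₂) a) b := by
  simp only [coef, ← avg_mul_right]
  rw [avg_comm]
  simp only [mul_right_comm]

lemma coef_coef_coprod (f : EndFn k) (a b : IrrLabel k) :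
    coef (fun V₂ _ _ x₂ => coef (fun V₁ _ _ x₁ => f.coprod (V₁ := V₁) (V₂ := V₂) x₁ x₂) a) b =
      cof f a b :=
  coef_comm (fun V₂ _ _ x₂ V₁ _ _ x₁ => f.coprod (V₁ := V₁) (V₂ := V₂) x₁ x₂) b a

lemma coprod_expand [Finite V₁] [Finite V₂] {f : EndFn k} (hf : f.Invariant) {N : ℕ}
    (h₁ : Module.finrank k V₁ ≤ N) (h₂ : Module.finrank k V₂ ≤ N) {x₁ : Module.End k V₁}
    {x₂ : Module.End k V₂} (hx₁ : Function.Injective x₁) (hx₂ : Function.Injective x₂) :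
    f.coprod x₁ x₂ = ∑ a ∈ labelBall k N, ∑ b ∈ labelBall k N,
      cof f a b * (a.fn V₁ x₁ * b.fn V₂ x₂) := by
  rw [expand (hf.coprod_left x₂) h₁ hx₁]
  refine Finset.sum_congr rfl fun a _ => ?_
  have h3 : EndFn.Invariant fun V₂ _ _ x₂ =>
      coef (fun V₁ _ _ x₁ => f.coprod (V₁ := V₁) (V₂ := V₂) x₁ x₂) a := by
    intro V W _ _ _ _ e x y h
    exact coef_congr fun g => hf.coprod_right _ V W e x y h
  rw [expand h3 h₂ hx₂, Finset.sum_mul]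
  refine Finset.sum_congr rfl fun b _ => ?_
  rw [coef_coef_coprod]
  ring

lemma coprod_expand_left [Finite V₁] [Finite V₂] {f : EndFn k} (hf : f.Invariant) {N : ℕ}
    (h : Module.finrank k V₁ + Module.finrank k V₂ ≤ N) {x₁ : Module.End k V₁}
    {x₂ : Module.End k V₂} (hx₁ : Function.Injective x₁) (hx₂ : Function.Injective x₂) :
    f.coprod x₁ x₂ = ∑ e ∈ labelBall k N, coef f e * e.fn.coprod x₁ x₂ := by
  simp only [EndFn.coprod, ← avg_mul_left]
  rw [← avg_sum]
  refine congrArg avg (funext fun u => ?_)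
  exact expand hf (by rwa [Module.finrank_prod]) (blk_injective hx₁ hx₂ u)

lemma cof_expand {f : EndFn k} (hf : f.Invariant) {a b : IrrLabel k} {N : ℕ} (h : a.1 + b.1 ≤ N) :
    cof f a b = ∑ e ∈ labelBall k N, coef f e * cof e.fn a b := by
  simp only [cof]
  rw [← coef_sum]
  refine coef_congr fun g₁ => ?_
  rw [← coef_sum]
  refine coef_congr fun g₂ => coprod_expand_left hf ?_ g₁.injective g₂.injective
  rwa [Module.finrank_fin_fun, Module.finrank_fin_fun]

lemma cof_assoc {f : EndFn k} (hf : f.Invariant) {a b d : IrrLabel k} {N : ℕ}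
    (h : a.1 + b.1 + d.1 ≤ N) :
    ∑ e ∈ labelBall k N, cof e.fn a b * cof f e d =
      ∑ e ∈ labelBall k N, cof e.fn b d * cof f a e := by
  have h1 : coef (fun V₁ _ _ x₁ => cof (fun V _ _ y => f.coprod (V₁ := V₁) (V₂ := V) x₁ y) b d) a =
      ∑ e ∈ labelBall k N, cof e.fn b d * cof f a e := by
    refine Eq.trans (coef_congr fun g => ?_) (coef_sum (labelBall k N) (fun e => cof e.fn b d)
      (fun e V₁ _ _ x₁ => coef (fun V₂ _ _ x₂ => f.coprod (V₁ := V₁) (V₂ := V₂) x₁ x₂) e) a)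
    rw [cof_expand (hf.coprod_right _) (by omega : b.1 + d.1 ≤ N)]
    exact Finset.sum_congr rfl fun e _ => mul_comm _ _
  have h2 : coef (fun V₃ _ _ x₃ => cof (fun V _ _ y => f.coprod (V₁ := V) (V₂ := V₃) y x₃) a b) d =
      ∑ e ∈ labelBall k N, cof e.fn a b * cof f e d := by
    simp only [← coef_coef_coprod f]
    rw [← coef_sum]
    refine coef_congr fun g => ?_
    rw [cof_expand (hf.coprod_left _) (by omega : a.1 + b.1 ≤ N)]
    exact Finset.sum_congr rfl fun e _ => mul_comm _ _
  rw [← h1, ← h2]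
  simp only [cof]
  rw [coef_comm]
  refine coef_congr fun g₁ => ?_
  rw [coef_comm]
  refine coef_congr fun g₂ => coef_congr fun g₃ => ?_
  exact (coprod_coprod hf _ _ _).symm

end Multiplicities

section Adjointness

variable {k : Type} [Field k]

variable {V₁ V₂ V W : Type} [AddCommGroup V₁] [Module k V₁] [AddCommGroup V₂] [Module k V₂]
  [AddCommGroup V] [Module k V] [AddCommGroup W] [Module k W]

/-- The isomorphism of automorphism groups induced by an isomorphism. -/
def autConj (e : V ≃ₗ[k] W) : (V ≃ₗ[k] V) ≃* (W ≃ₗ[k] W) where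
  toFun g := (e.symm.trans g).trans e
  invFun g := (e.trans g).trans e.symm
  left_inv g := by
    ext
    simp
  right_inv g := by
    ext
    simp
  map_mul' g h := by
    ext
    simp

@[simp]
lemma autConj_apply (e : V ≃ₗ[k] W) (g : V ≃ₗ[k] V) (w : W) : autConj e g w = e (g (e.symm w)) :=
  rfl

variable (V₁ V₂) in
/-- The block diagonal automorphisms. -/
def diagHom : (V₁ ≃ₗ[k] V₁) × (V₂ ≃ₗ[k] V₂) →* ((V₁ × V₂) ≃ₗ[k] (V₁ × V₂)) where
  toFun g := g.1.prodCongr g.2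
  map_one' := rfl
  map_mul' _ _ := rfl

variable (V₁ V₂) in
/-- The unipotent block triangular automorphisms. -/
def shearHom : Multiplicative (V₂ →ₗ[k] V₁) →* ((V₁ × V₂) ≃ₗ[k] (V₁ × V₂)) where
  toFun u := shear u.toAdd
  map_one' := by
    ext1 p
    simp
  map_mul' u v := by
    ext1 p
    ext
    · simp
      abel
    · simp

@[simp]
lemma diagHom_apply (g : (V₁ ≃ₗ[k] V₁) × (V₂ ≃ₗ[k] V₂)) (p : V₁ × V₂) :
    diagHom V₁ V₂ g p = (g.1 p.1, g.2 p.2) := rfl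

@[simp]
lemma shearHom_apply (u : Multiplicative (V₂ →ₗ[k] V₁)) (p : V₁ × V₂) :
    shearHom V₁ V₂ u p = shear u.toAdd p := rfl

variable [Finite k]

omit [Finite k] in
lemma cof_eq_zero {x a b : IrrLabel k} (h : a.1 + b.1 ≠ x.1) : cof x.fn a b = 0 := by
  have h1 : ∀ (x₁ : Module.End k (Fin a.1 → k)) (x₂ : Module.End k (Fin b.1 → k)),
      x.fn.coprod x₁ x₂ = 0 := by
    intro x₁ x₂
    refine (congrArg avg (funext fun u => ?_)).trans avg_zero
    refine x.fn_eq_zero ?_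
    rwa [Module.finrank_prod, Module.finrank_fin_fun, Module.finrank_fin_fun]
  simp only [cof, coef, h1, zero_mul, avg_zero]

lemma exists_cof_eq (x a b : IrrLabel k) : ∃ n : ℕ, cof x.fn a b = n := by
  by_cases h : a.1 + b.1 = x.1
  swap
  · exact ⟨0, by simpa using cof_eq_zero h⟩
  let A := Fin a.1 → k
  let B := Fin b.1 → k
  have : Finite (Multiplicative (B →ₗ[k] A)) := inferInstanceAs (Finite (B →ₗ[k] A))
  have := Fintype.ofFinite (Multiplicative (B →ₗ[k] A))
  let e : (A × B) ≃ₗ[k] (Fin x.1 → k) := LinearEquiv.ofFinrankEq _ _ (by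
    rw [Module.finrank_prod, Module.finrank_fin_fun, Module.finrank_fin_fun,
      Module.finrank_fin_fun, h])
  have h1 := x.2.2.isCharacter.average ((autConj e).toMonoidHom.comp (diagHom A B))
    ((autConj e).toMonoidHom.comp (shearHom A B)) (fun g => ⟨Multiplicative.toAdd.trans
      ((LinearEquiv.arrowCongr g.2 g.1).toEquiv.trans Multiplicative.ofAdd), fun u => by
      ext1 v
      simp⟩)
  have h2 : ∀ g : (A ≃ₗ[k] A) × (B ≃ₗ[k] B),
      x.fn.coprod g.1.toLinearMap g.2.toLinearMap = (Nat.card (Multiplicative (B →ₗ[k] A)) : ℂ)⁻¹ *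
        ∑ u, x.2.1 ((autConj e).toMonoidHom.comp (shearHom A B) u *
          (autConj e).toMonoidHom.comp (diagHom A B) g) := by
    intro g
    rw [← avg_eq_sum, EndFn.coprod,
      ← avg_equiv ((LinearEquiv.congrLeft A k g.2).toEquiv.trans Multiplicative.ofAdd)]
    refine congrArg avg (funext fun u => ?_)
    refine extend_eq x.conj e.symm _ fun v => ?_
    simp
  have h3 := (a.2.2.isCharacter.comp (MonoidHom.fst (A ≃ₗ[k] A) (B ≃ₗ[k] B))).mul
    (b.2.2.isCharacter.comp (MonoidHom.snd (A ≃ₗ[k] A) (B ≃ₗ[k] B)))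
  obtain ⟨n, hn⟩ := h1.pairing_nat h3
  refine ⟨n, ?_⟩
  rw [← hn, ← avg_mul_star]
  simp only [← h2]
  simp only [cof, coef, ← avg_mul_right]
  refine (avg_prod fun (g₁ : A ≃ₗ[k] A) (g₂ : B ≃ₗ[k] B) => _).symm.trans ?_
  refine congrArg avg (funext fun g => ?_)
  simp
  ring

lemma sum_eq_of_orbit {G X : Type*} [Group G] [Finite G] [Fintype X] [MulAction G X] (x₀ : X)
    (F : X → ℂ) (h₁ : ∀ g : G, F (g • x₀) = F x₀) (h₂ : ∀ x, x ∉ MulAction.orbit G x₀ → F x = 0) :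
    ∑ x, F x = (Nat.card G : ℂ) / Nat.card (MulAction.stabilizer G x₀) * F x₀ := by
  classical
  have h3 : ∑ x, F x = ∑ x : MulAction.orbit G x₀, F x := by
    rw [← Finset.sum_subtype (Finset.univ.filter (· ∈ MulAction.orbit G x₀)) (by simp),
      Finset.sum_filter]
    refine Finset.sum_congr rfl fun x _ => ?_
    split_ifs with h
    · rfl
    · exact h₂ x h
  have h4 : ∀ x : MulAction.orbit G x₀, F x = F x₀ := by
    rintro ⟨_, g, rfl⟩
    exact h₁ g
  rw [h3, Finset.sum_congr rfl fun x _ => h4 x, Finset.sum_const, nsmul_eq_mul, Finset.card_univ,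
    ← Nat.card_eq_fintype_card, ← Nat.card_congr (MulAction.orbitProdStabilizerEquivGroup G x₀),
    Nat.card_prod]
  push_cast
  rw [mul_div_cancel_right₀]
  exact Nat.cast_ne_zero.2 Nat.card_pos.ne'

/-- The block triangular automorphism with given blocks. -/
noncomputable def blkEquiv [Finite V₁] [Finite V₂] (p : ((V₁ ≃ₗ[k] V₁) × (V₂ ≃ₗ[k] V₂)) ×
    (V₂ →ₗ[k] V₁)) : (V₁ × V₂) ≃ₗ[k] (V₁ × V₂) :=
  LinearEquiv.ofInjectiveEndo _ (blk_injective p.1.1.injective p.1.2.injective p.2)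

omit [Finite k] in
@[simp]
lemma blkEquiv_apply [Finite V₁] [Finite V₂] (p : ((V₁ ≃ₗ[k] V₁) × (V₂ ≃ₗ[k] V₂)) ×
    (V₂ →ₗ[k] V₁)) (v : V₁ × V₂) : blkEquiv p v = (p.1.1 v.1 + p.2 v.2, p.1.2 v.2) := rfl

open scoped Pointwise

omit [Finite k] in
lemma mem_smul_submodule {g : V ≃ₗ[k] V} {U : Submodule k V} {v : V} :
    g v ∈ g • U ↔ v ∈ U := by
  refine ⟨fun h => ?_, fun h => Submodule.smul_mem_pointwise_smul v g U h⟩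
  obtain ⟨w, hw, hwv⟩ := (Submodule.mem_smul_pointwise_iff_exists _ _ _).1 h
  rwa [← g.injective hwv]

omit [Finite k] in
lemma finrank_smul_submodule (g : V ≃ₗ[k] V) (U : Submodule k V) :
    Module.finrank k (g • U : Submodule k V) = Module.finrank k U :=
  LinearEquiv.finrank_map_eq g U

omit [Finite k] in
lemma mem_orbit_range_inl [Finite V₁] [Finite V₂] {W : Submodule k (V₁ × V₂)}
    (h : Module.finrank k W = Module.finrank k V₁) :
    W ∈ MulAction.orbit ((V₁ × V₂) ≃ₗ[k] (V₁ × V₂)) (LinearMap.range (LinearMap.inl k V₁ V₂)) := by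
  obtain ⟨W', hW⟩ := Submodule.exists_isCompl W
  have h1 := Submodule.finrank_add_eq_of_isCompl hW
  rw [Module.finrank_prod] at h1
  let p : (V₁ × V₂) ≃ₗ[k] (V₁ × V₂) := ((LinearEquiv.ofFinrankEq V₁ W h.symm).prodCongr
    (LinearEquiv.ofFinrankEq V₂ W' (by lia))).trans (Submodule.prodEquivOfIsCompl W W' hW)
  refine ⟨p, Submodule.eq_of_le_of_finrank_eq ?_ ?_⟩
  · intro v hv
    obtain ⟨w, hw, rfl⟩ := (Submodule.mem_smul_pointwise_iff_exists _ _ _).1 hv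
    obtain ⟨w, rfl⟩ := hw
    simp [p]
  · refine (finrank_smul_submodule p _).trans ?_
    rw [LinearMap.finrank_range_of_inj LinearMap.inl_injective, h]

omit [Finite k] in
lemma mem_stabilizer_range_inl {g : (V₁ × V₂) ≃ₗ[k] (V₁ × V₂)} [Finite V₁] [Finite V₂] :
    g ∈ MulAction.stabilizer _ (LinearMap.range (LinearMap.inl k V₁ V₂)) ↔
      ∃ p, blkEquiv p = g := by
  rw [MulAction.mem_stabilizer_iff]
  have hW : ∀ v : V₁ × V₂, v ∈ LinearMap.range (LinearMap.inl k V₁ V₂) ↔ v.2 = 0 := by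
    rintro ⟨v, w⟩
    simp [eq_comm]
  constructor
  · intro h
    have h1 : ∀ v, (g v).2 = 0 ↔ v.2 = 0 := fun v => by
      rw [← hW, ← hW]
      nth_rw 1 [← h]
      exact mem_smul_submodule
    let g₁ : V₁ →ₗ[k] V₁ := LinearMap.fst k V₁ V₂ ∘ₗ g.toLinearMap ∘ₗ LinearMap.inl k V₁ V₂
    let g₂ : V₂ →ₗ[k] V₂ := LinearMap.snd k V₁ V₂ ∘ₗ g.toLinearMap ∘ₗ LinearMap.inr k V₁ V₂
    have hg₁ : Function.Injective g₁ := by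
      rw [injective_iff_map_eq_zero]
      intro v hv
      have h2 : g (v, 0) = 0 := Prod.ext hv ((h1 (v, 0)).2 rfl)
      have := g.map_eq_zero_iff.1 h2
      simpa using this
    have hg₂ : Function.Injective g₂ := by
      rw [injective_iff_map_eq_zero]
      exact fun w hw => (h1 (0, w)).1 hw
    refine ⟨((LinearEquiv.ofInjectiveEndo g₁ hg₁, LinearEquiv.ofInjectiveEndo g₂ hg₂),
      LinearMap.fst k V₁ V₂ ∘ₗ g.toLinearMap ∘ₗ LinearMap.inr k V₁ V₂), ?_⟩
    ext1 ⟨v, w⟩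
    have h2 : g (v, w) = g (v, 0) + g (0, w) := by
      rw [← map_add]
      simp
    have h3 : (g (v, 0)).2 = 0 := (h1 (v, 0)).2 rfl
    ext
    · simp [h2, g₁]
    · simp [h2, g₂, h3]
  · rintro ⟨p, rfl⟩
    ext v
    obtain ⟨v, rfl⟩ := (blkEquiv p).surjective v
    rw [mem_smul_submodule, hW, hW]
    simp

omit [Finite k] in
lemma blkEquiv_injective [Finite V₁] [Finite V₂] : Function.Injective
    (blkEquiv : ((V₁ ≃ₗ[k] V₁) × (V₂ ≃ₗ[k] V₂)) × (V₂ →ₗ[k] V₁) → _) := by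
  rintro ⟨⟨g, h⟩, u⟩ ⟨⟨g', h'⟩, u'⟩ he
  have h1 : ∀ v w, (g v + u w, h w) = (g' v + u' w, h' w) := fun v w => LinearEquiv.congr_fun he (v, w)
  simp only [Prod.mk.injEq] at h1 ⊢
  refine ⟨⟨?_, ?_⟩, ?_⟩
  · ext v
    simpa using (h1 v 0).1
  · ext w
    exact (h1 0 w).2
  · ext w
    simpa using (h1 0 w).1

omit [Finite k] in
/-- The product of two functions is adjoint to the coproduct. -/
lemma avg_prod_mul [Finite V₁] [Finite V₂] {a b h : EndFn k} (ha : a.Invariant) (hb : b.Invariant)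
    (hh : h.Invariant) (ha' : ∀ (V : Type) [AddCommGroup V] [Module k V] (x : Module.End k V),
      Module.finrank k V ≠ Module.finrank k V₁ → a V x = 0) :
    (avg fun g : (V₁ × V₂) ≃ₗ[k] (V₁ × V₂) =>
      a.prod b (V₁ × V₂) g.toLinearMap * h (V₁ × V₂) g.toLinearMap) =
    avg fun g₁ : V₁ ≃ₗ[k] V₁ => avg fun g₂ : V₂ ≃ₗ[k] V₂ =>
      a V₁ g₁.toLinearMap * b V₂ g₂.toLinearMap * h.coprod g₁.toLinearMap g₂.toLinearMap := by
  classical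
  let W₀ := LinearMap.range (LinearMap.inl k V₁ V₂)
  let P := MulAction.stabilizer ((V₁ × V₂) ≃ₗ[k] (V₁ × V₂)) W₀
  have := Fintype.ofFinite ((V₁ × V₂) ≃ₗ[k] (V₁ × V₂))
  let F : Submodule k (V₁ × V₂) → ℂ := fun W => avg fun g : (V₁ × V₂) ≃ₗ[k] (V₁ × V₂) =>
    prodTerm a.mark b 0 g.toLinearMap W * h (V₁ × V₂) g.toLinearMap
  have h1 : (avg fun g : (V₁ × V₂) ≃ₗ[k] (V₁ × V₂) =>
      a.prod b (V₁ × V₂) g.toLinearMap * h (V₁ × V₂) g.toLinearMap) = ∑ W, F W := by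
    simp only [EndFn.prod, MarkedFn.unmark, prodLeft, finsum_eq_sum_of_fintype, Finset.sum_mul]
    rw [avg_sum]
  have h2 : ∀ p : (V₁ × V₂) ≃ₗ[k] (V₁ × V₂), F (p • W₀) = F W₀ := by
    intro p
    simp only [F]
    rw [← avg_equiv (autConj p).toEquiv]
    refine congrArg avg (funext fun g => ?_)
    congr 1
    · exact (prodTerm_equiv ha.mark hb p (fun _ => rfl) (fun v => by simp)
        fun v => mem_smul_submodule).symm
    · exact (hh _ _ p _ _ fun v => by simp).symm
  have h3 : ∀ W, W ∉ MulAction.orbit ((V₁ × V₂) ≃ₗ[k] (V₁ × V₂)) W₀ → F W = 0 := by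
    intro W hW
    refine (congrArg avg (funext fun g => ?_)).trans avg_zero
    rw [prodTerm]
    split_ifs with hs
    · rw [EndFn.mark, ha', zero_mul, zero_mul]
      intro hr
      exact hW (mem_orbit_range_inl hr)
    · rw [zero_mul]
  have h4 : F W₀ = (Nat.card ((V₁ × V₂) ≃ₗ[k] (V₁ × V₂)) : ℂ)⁻¹ * ∑ g : P,
      prodTerm a.mark b 0 g.1.toLinearMap W₀ * h (V₁ × V₂) g.1.toLinearMap := by
    simp only [F]
    rw [avg_eq_sum, ← Finset.sum_subtype (Finset.univ.filter (· ∈ P)) (by simp) (fun g =>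
      prodTerm a.mark b 0 g.toLinearMap W₀ * h (V₁ × V₂) g.toLinearMap), Finset.sum_filter]
    refine congrArg _ (Finset.sum_congr rfl fun g _ => ?_)
    split_ifs with hg
    · rfl
    · rw [prodTerm, dif_neg, zero_mul]
      intro hs
      refine hg (Submodule.eq_of_le_of_finrank_eq ?_ ?_)
      · intro v hv
        obtain ⟨w, hw, rfl⟩ := (Submodule.mem_smul_pointwise_iff_exists _ _ _).1 hv
        exact hs _ hw
      · exact finrank_smul_submodule g W₀
  let e : ((V₁ ≃ₗ[k] V₁) × (V₂ ≃ₗ[k] V₂)) × (V₂ →ₗ[k] V₁) ≃ P :=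
    Equiv.ofBijective (fun p => ⟨blkEquiv p, mem_stabilizer_range_inl.2 ⟨p, rfl⟩⟩)
      ⟨fun p q hpq => blkEquiv_injective (congrArg Subtype.val hpq), fun g => by
        obtain ⟨p, hp⟩ := mem_stabilizer_range_inl.1 g.2
        exact ⟨p, Subtype.ext hp⟩⟩
  have h5 : F W₀ = (Nat.card ((V₁ × V₂) ≃ₗ[k] (V₁ × V₂)) : ℂ)⁻¹ * (Nat.card P *
      avg fun g₁ : V₁ ≃ₗ[k] V₁ => avg fun g₂ : V₂ ≃ₗ[k] V₂ =>
      a V₁ g₁.toLinearMap * b V₂ g₂.toLinearMap * h.coprod g₁.toLinearMap g₂.toLinearMap) := by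
    rw [h4]
    congr 1
    have h6 : (Nat.card P : ℂ) ≠ 0 := Nat.cast_ne_zero.2 Nat.card_pos.ne'
    rw [← inv_mul_eq_iff_eq_mul₀ h6, ← avg_eq_sum, ← avg_equiv e]
    simp only [EndFn.coprod, ← avg_mul_left]
    rw [← avg_prod, ← avg_prod]
    refine congrArg avg (funext fun p => ?_)
    refine congrArg₂ _ ?_ rfl
    refine prodTerm_eq ha.mark hb (ι := LinearMap.inl k V₁ V₂) (π := LinearMap.snd k V₁ V₂)
      LinearMap.inl_injective Prod.snd_surjective rfl ?_ (m := 0) (fun _ => rfl) ?_ ?_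
    · exact (LinearMap.range_inl k V₁ V₂).symm
    · intro s
      change _ = blkEquiv p _
      simp
    · intro s
      change _ = (blkEquiv p _).2
      simp
  rw [h1, sum_eq_of_orbit W₀ F h2 h3, h5]
  have h6 : (Nat.card P : ℂ) ≠ 0 := Nat.cast_ne_zero.2 Nat.card_pos.ne'
  have h7 : (Nat.card ((V₁ × V₂) ≃ₗ[k] (V₁ × V₂)) : ℂ) ≠ 0 := Nat.cast_ne_zero.2 Nat.card_pos.ne'
  field_simp
  exact mul_div_cancel_left₀ _ h6

omit [Finite k] in
lemma star_avg {X : Type*} [Finite X] (F : X → ℂ) : star (avg F) = avg fun x => star (F x) := by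
  have := Fintype.ofFinite X
  simp [avg_eq_sum]

omit [Finite k] in
lemma fn_prod_eq_zero [Finite V] (a b : IrrLabel k) {x : Module.End k V}
    (h : Module.finrank k V ≠ a.1 + b.1) : a.fn.prod b.fn V x = 0 := by
  have h1 : ∀ U : Submodule k V, prodTerm a.fn.mark b.fn 0 x U = 0 := by
    intro U
    rw [prodTerm]
    split_ifs with hs
    · by_cases hU : Module.finrank k U = a.1
      · rw [b.fn_eq_zero, mul_zero]
        have := U.finrank_quotient_add_finrank
        lia
      · rw [EndFn.mark, a.fn_eq_zero hU, zero_mul]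
    · rfl
  simp only [EndFn.prod, MarkedFn.unmark, prodLeft, h1, finsum_zero]

lemma coef_prod (a b e : IrrLabel k) : coef (a.fn.prod b.fn) e = cof e.fn a b := by
  by_cases h : a.1 + b.1 = e.1
  swap
  · rw [cof_eq_zero h, coef]
    refine (congrArg avg (funext fun g => ?_)).trans avg_zero
    rw [fn_prod_eq_zero, zero_mul]
    rw [Module.finrank_fin_fun]
    exact Ne.symm h
  let E : ((Fin a.1 → k) × (Fin b.1 → k)) ≃ₗ[k] (Fin e.1 → k) := LinearEquiv.ofFinrankEq _ _ (by
    rw [Module.finrank_prod, Module.finrank_fin_fun, Module.finrank_fin_fun,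
      Module.finrank_fin_fun, h])
  let f : EndFn k := fun V _ _ x => star (e.fn V x)
  have hf : f.Invariant := fun V W _ _ _ _ i x y hx => congrArg star (e.fn_invariant V W i x y hx)
  have h1 := avg_prod_mul (V₁ := Fin a.1 → k) (V₂ := Fin b.1 → k) a.fn_invariant b.fn_invariant hf
    (fun V _ _ x hx => a.fn_eq_zero (by rwa [Module.finrank_fin_fun] at hx))
  have h2 : coef (a.fn.prod b.fn) e = avg fun g : ((Fin a.1 → k) × (Fin b.1 → k)) ≃ₗ[k]
      ((Fin a.1 → k) × (Fin b.1 → k)) => a.fn.prod b.fn _ g.toLinearMap * f _ g.toLinearMap := by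
    rw [coef, ← avg_equiv (autConj E).toEquiv]
    refine congrArg avg (funext fun g => ?_)
    congr 1
    · exact ((a.fn_invariant.prod b.fn_invariant) _ _ E _ _ fun v => by simp).symm
    · rw [← e.fn_std]
      exact (hf _ _ E _ _ fun v => by simp).symm
  have h3 : star (cof e.fn a b) = cof e.fn a b := by
    obtain ⟨n, hn⟩ := exists_cof_eq e a b
    rw [hn]
    exact star_natCast n
  rw [h2, h1, ← h3, cof, coef, star_avg]
  refine congrArg avg (funext fun g₁ => ?_)
  rw [star_mul', star_star, coef, star_avg, ← avg_mul_right]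
  refine congrArg avg (funext fun g₂ => ?_)
  rw [star_mul', star_star, EndFn.coprod, EndFn.coprod, star_avg, a.fn_std, b.fn_std]
  ring

end Adjointness

section HopfAxiom

variable {k : Type} [Field k] [Finite k]

variable {V₁ V₂ V : Type} [AddCommGroup V₁] [Module k V₁] [AddCommGroup V₂] [Module k V₂]
  [AddCommGroup V] [Module k V]

lemma IsIrrCharacter.eq_one_of_subsingleton {G : Type} [Group G] [Finite G] [Subsingleton G]
    {χ : G → ℂ} (hχ : IsIrrCharacter χ) : χ = fun _ => 1 := by
  have := Fintype.ofFinite G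
  obtain ⟨d, hd, h1⟩ := hχ.exists_degree
  have h2 := hχ.pairing hχ
  have : Unique G := ⟨⟨1⟩, fun g => Subsingleton.elim _ _⟩
  have h3 : (default : G) = 1 := Subsingleton.elim _ _
  rw [if_pos rfl, _root_.pairing] at h2
  simp only [Fintype.sum_unique, Nat.card_unique, h3, Pi.star_apply, h1] at h2
  rw [star_natCast] at h2
  have h4 : d * d = 1 := by
    have h5 : ((d * d : ℕ) : ℂ) = 1 := by
      push_cast
      simpa using h2
    exact_mod_cast h5
  funext g
  rw [Subsingleton.elim g 1, h1, Nat.eq_one_of_mul_eq_one_left h4, Nat.cast_one]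

lemma exists_isIrrCharacter (G : Type) [Group G] [Finite G] : ∃ χ : G → ℂ, IsIrrCharacter χ := by
  have := Fintype.ofFinite G
  by_contra! h
  have h1 : irrChars G = ∅ := Finset.eq_empty_of_forall_notMem fun χ hχ => h χ (mem_irrChars.1 hχ)
  have h2 := classFunction_expand (f := fun _ : G => 1) (fun _ _ => rfl) 1
  rw [h1, Finset.sum_empty] at h2
  exact one_ne_zero h2

variable (k) in
/-- The trivial character of the trivial group. -/
noncomputable def oneLabel : IrrLabel k := ⟨0, _, (exists_isIrrCharacter (StdAut k 0)).choose_spec⟩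

instance subsingletonStdAut : Subsingleton (StdAut k 0) :=
  ⟨fun _ _ => LinearEquiv.ext fun _ => Subsingleton.elim _ _⟩

lemma eq_oneLabel {a : IrrLabel k} (h : a.1 = 0) : a = oneLabel k := by
  obtain ⟨n, χ, hχ⟩ := a
  obtain rfl : n = 0 := h
  refine Sigma.ext rfl (heq_of_eq (Subtype.ext ?_))
  change χ = (oneLabel k).2.1
  rw [hχ.eq_one_of_subsingleton]
  exact ((oneLabel k).2.2.eq_one_of_subsingleton (G := StdAut k 0)).symm

lemma oneLabel_apply (g : StdAut k 0) : (oneLabel k).2.1 g = 1 :=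
  congrFun ((oneLabel k).2.2.eq_one_of_subsingleton (G := StdAut k 0)) g

lemma coef_oneLabel (f : EndFn k) : coef f (oneLabel k) = f (Fin 0 → k) 1 := by
  have : Unique (StdAut k 0) := Unique.mk' _
  refine (avg_unique (X := StdAut k 0) _).trans ?_
  rw [oneLabel_apply, star_one, mul_one]
  exact congrArg (f (Fin 0 → k)) (LinearMap.ext fun v => Subsingleton.elim (α := Fin 0 → k) _ _)

omit [Finite k] in
lemma EndFn.Invariant.coprod_subsingleton_left [Subsingleton V₁] {f : EndFn k} (hf : f.Invariant)
    (x₁ : Module.End k V₁) (x₂ : Module.End k V₂) : f.coprod x₁ x₂ = f V₂ x₂ := by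
  have : Subsingleton (V₂ →ₗ[k] V₁) := ⟨fun _ _ => LinearMap.ext fun _ => Subsingleton.elim _ _⟩
  have : Unique (V₂ →ₗ[k] V₁) := Unique.mk' _
  have : Unique V₁ := ⟨⟨0⟩, fun v => Subsingleton.elim _ _⟩
  refine (avg_unique _).trans ?_
  exact hf _ _ LinearEquiv.uniqueProd _ _ fun v => by simp

omit [Finite k] in
lemma EndFn.Invariant.coprod_subsingleton_right [Subsingleton V₂] {f : EndFn k} (hf : f.Invariant)
    (x₁ : Module.End k V₁) (x₂ : Module.End k V₂) : f.coprod x₁ x₂ = f V₁ x₁ := by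
  have : Subsingleton (V₂ →ₗ[k] V₁) := ⟨fun u v => LinearMap.ext fun w => by
    rw [Subsingleton.elim w 0, map_zero, map_zero]⟩
  have : Unique (V₂ →ₗ[k] V₁) := Unique.mk' _
  have : Unique V₂ := ⟨⟨0⟩, fun v => Subsingleton.elim _ _⟩
  refine (avg_unique _).trans ?_
  refine hf _ _ LinearEquiv.prodUnique _ _ fun v => ?_
  have : v.2 = 0 := Subsingleton.elim _ _
  simp [this]

open Classical in
lemma cof_oneLabel_left (a e : IrrLabel k) : cof e.fn (oneLabel k) a = if a = e then 1 else 0 := by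
  rw [cof, coef_oneLabel]
  simp only [eq_comm (a := a)]
  rw [← coef_fn]
  exact coef_congr fun g => e.fn_invariant.coprod_subsingleton_left _ _

open Classical in
lemma cof_oneLabel_right (a e : IrrLabel k) : cof e.fn a (oneLabel k) = if a = e then 1 else 0 := by
  simp only [cof, coef_oneLabel, eq_comm (a := a)]
  rw [← coef_fn]
  exact coef_congr fun g => e.fn_invariant.coprod_subsingleton_right _ _

/-- The product of two irreducible characters in terms of irreducible characters. -/
lemma prod_expand [Finite V] (a b : IrrLabel k) {N : ℕ} (h : Module.finrank k V ≤ N)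
    {x : Module.End k V} (hx : Function.Injective x) :
    a.fn.prod b.fn V x = ∑ e ∈ labelBall k N, cof e.fn a b * e.fn V x := by
  rw [expand (a.fn_invariant.prod b.fn_invariant) h hx]
  simp only [coef_prod]

lemma coprod_prod_expand [Finite V₁] [Finite V₂] (a b : IrrLabel k) {N : ℕ}
    (h₁ : Module.finrank k V₁ ≤ N) (h₂ : Module.finrank k V₂ ≤ N) {x₁ : Module.End k V₁}
    {x₂ : Module.End k V₂} (hx₁ : Function.Injective x₁) (hx₂ : Function.Injective x₂) :
    (a.fn.prod b.fn).coprod x₁ x₂ =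
      ∑ i ∈ (labelBall k N ×ˢ labelBall k N) ×ˢ (labelBall k N ×ˢ labelBall k N),
        cof a.fn i.1.1 i.1.2 * cof b.fn i.2.1 i.2.2 *
          (i.1.1.fn.prod i.2.1.fn V₁ x₁ * i.1.2.fn.prod i.2.2.fn V₂ x₂) := by
  have h3 : ∀ (W : Type) [AddCommGroup W] [Module k W] [Finite W] (x : Module.End k W)
      (hx : Function.Injective x) (U : Submodule k W) (hs : ∀ w ∈ U, x w ∈ U),
      Function.Injective (x.restrict hs) ∧ Function.Injective (U.mapQ U x hs) := by
    intro W _ _ _ x hx U hs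
    refine ⟨fun v w h => Subtype.ext (hx (congrArg Subtype.val h)), ?_⟩
    refine Finite.injective_iff_surjective.2 fun w => ?_
    obtain ⟨w, rfl⟩ := Submodule.Quotient.mk_surjective _ w
    obtain ⟨v, rfl⟩ := Finite.surjective_of_injective hx w
    exact ⟨Submodule.Quotient.mk v, rfl⟩
  rw [coprod_prod a.fn_invariant b.fn_invariant]
  have h4 : ∀ i : (IrrLabel k × IrrLabel k) × (IrrLabel k × IrrLabel k),
      i.1.1.fn.prod i.2.1.fn V₁ x₁ * i.1.2.fn.prod i.2.2.fn V₂ x₂ =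
        ∑ W₁ : Submodule k V₁, ∑ W₂ : Submodule k V₂,
          prodTerm i.1.1.fn.mark i.2.1.fn 0 x₁ W₁ * prodTerm i.1.2.fn.mark i.2.2.fn 0 x₂ W₂ := by
    intro i
    rw [← Finset.sum_mul_sum, ← finsum_eq_sum_of_fintype, ← finsum_eq_sum_of_fintype]
    rfl
  simp only [h4, Finset.mul_sum]
  symm
  refine (Finset.sum_comm.trans (Finset.sum_congr rfl fun W₁ _ => Finset.sum_comm)).trans ?_
  refine Finset.sum_congr rfl fun W₁ _ => Finset.sum_congr rfl fun W₂ _ => ?_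
  split_ifs with hs
  · have hW₁ := W₁.finrank_quotient_add_finrank
    have hW₂ := W₂.finrank_quotient_add_finrank
    rw [coprod_expand (N := N) a.fn_invariant (by lia) (by lia) (h3 _ _ hx₁ _ hs.1).1
      (h3 _ _ hx₂ _ hs.2).1, coprod_expand (N := N) b.fn_invariant (by lia) (by lia)
      (h3 _ _ hx₁ _ hs.1).2 (h3 _ _ hx₂ _ hs.2).2, ← Finset.sum_product', ← Finset.sum_product',
      Finset.sum_mul_sum, ← Finset.sum_product']
    refine Finset.sum_congr rfl fun i _ => ?_
    rw [prodTerm, prodTerm, dif_pos hs.1, dif_pos hs.2]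
    simp only [EndFn.mark]
    ring
  · refine Finset.sum_eq_zero fun i _ => ?_
    rw [not_and_or] at hs
    obtain hs | hs := hs
    · rw [prodTerm, dif_neg hs, zero_mul, mul_zero]
    · rw [mul_comm (prodTerm _ _ _ x₁ _), prodTerm, dif_neg hs, zero_mul, mul_zero]

lemma cof_hopf {a b x y : IrrLabel k} {N : ℕ} (hab : a.1 + b.1 ≤ N) :
    ∑ e ∈ labelBall k N, cof e.fn a b * cof e.fn x y =
      ∑ p ∈ labelBall k N, ∑ q ∈ labelBall k N, ∑ r ∈ labelBall k N, ∑ s ∈ labelBall k N,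
        cof a.fn p q * cof b.fn r s * (cof x.fn p r * cof y.fn q s) := by
  by_cases h : a.1 + b.1 = x.1 + y.1
  · have h1 := cof_expand (a.fn_invariant.prod b.fn_invariant) (h ▸ hab : x.1 + y.1 ≤ N)
    simp only [coef_prod] at h1
    rw [← h1]
    have h2 : cof (a.fn.prod b.fn) x y =
      ∑ i ∈ (labelBall k N ×ˢ labelBall k N) ×ˢ (labelBall k N ×ˢ labelBall k N),
        cof a.fn i.1.1 i.1.2 * cof b.fn i.2.1 i.2.2 * coef (i.1.2.fn.prod i.2.2.fn) y *
          coef (i.1.1.fn.prod i.2.1.fn) x := by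
      rw [cof, ← coef_sum]
      refine coef_congr fun g₁ => ?_
      refine Eq.trans (coef_congr fun g₂ => ?_) (Eq.trans (coef_sum _ (fun i =>
        cof a.fn i.1.1 i.1.2 * cof b.fn i.2.1 i.2.2 *
          i.1.1.fn.prod i.2.1.fn (Fin x.1 → k) g₁.toLinearMap)
        (fun i => i.1.2.fn.prod i.2.2.fn) y) (Finset.sum_congr rfl fun i _ => by ring))
      rw [coprod_prod_expand (N := N) a b (by rw [Module.finrank_fin_fun]; lia)
        (by rw [Module.finrank_fin_fun]; lia) g₁.injective g₂.injective]
      exact Finset.sum_congr rfl fun i _ => by ring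
    rw [h2]
    simp only [Finset.sum_product, coef_prod]
    refine Finset.sum_congr rfl fun p _ => Finset.sum_congr rfl fun q _ =>
      Finset.sum_congr rfl fun r _ => Finset.sum_congr rfl fun s _ => by ring
  · have h1 : ∀ e : IrrLabel k, cof e.fn a b * cof e.fn x y = 0 := by
      intro e
      by_cases h2 : a.1 + b.1 = e.1
      · rw [cof_eq_zero (x := e) (a := x) (h2 ▸ Ne.symm h), mul_zero]
      · rw [cof_eq_zero h2, zero_mul]
    have h3 : ∀ p q r s : IrrLabel k,
        cof a.fn p q * cof b.fn r s * (cof x.fn p r * cof y.fn q s) = 0 := by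
      intro p q r s
      by_cases h4 : p.1 + q.1 = a.1
      swap
      · rw [cof_eq_zero h4, zero_mul, zero_mul]
      by_cases h5 : r.1 + s.1 = b.1
      swap
      · rw [cof_eq_zero h5, mul_zero, zero_mul]
      by_cases h6 : p.1 + r.1 = x.1
      swap
      · rw [cof_eq_zero h6, zero_mul, mul_zero]
      rw [cof_eq_zero (x := y) (a := q) (by lia), mul_zero, mul_zero]
    simp only [h1, h3, Finset.sum_const_zero]

end HopfAxiom

section GenericFunctional

variable {k : Type} [Field k] [Finite k] (ψ : AddChar k ℂ)

lemma IrrLabel.iterate_descent_eq_zero (a : IrrLabel k) (n : ℕ) : ∀ (V : Type) [AddCommGroup V]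
    [Module k V] [Finite V] (l : V →ₗ[k] k) (x : Module.End k V), Module.finrank k V + n ≠ a.1 →
    (descent ψ)^[n] a.fn.mark V l x = 0 := by
  induction n with
  | zero => exact fun V _ _ _ l x h => a.fn_eq_zero h
  | succ n ih =>
    intro V _ _ _ l x h
    rw [Function.iterate_succ_apply']
    refine (congrArg avg (funext fun u => ?_)).trans avg_zero
    rw [ih _ _ _ (by rw [Module.finrank_prod, Module.finrank_self]; lia), mul_zero]

lemma iterate_descent_expand {ι : Type*} {f : EndFn k} {s : Finset ι} {z : ι → ℂ}
    {F : ι → EndFn k} {N : ℕ} (h : ∀ (V : Type) [AddCommGroup V] [Module k V] [Finite V]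
      (x : Module.End k V), Module.finrank k V ≤ N → Function.Injective x →
      f V x = ∑ i ∈ s, z i * F i V x) (n : ℕ) : ∀ (V : Type) [AddCommGroup V]
    [Module k V] [Finite V] (l : V →ₗ[k] k) (x : Module.End k V), Module.finrank k V + n ≤ N →
    Function.Injective x →
    (descent ψ)^[n] f.mark V l x = ∑ i ∈ s, z i * (descent ψ)^[n] (F i).mark V l x := by
  induction n with
  | zero => exact fun V _ _ _ l x hN hx => h V x hN hx
  | succ n ih =>
    intro V _ _ _ l x hN hx
    simp only [Function.iterate_succ_apply']
    simp only [descent, ← avg_mul_left]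
    rw [← avg_sum]
    refine congrArg avg (funext fun u => ?_)
    rw [ih _ _ _ (by rw [Module.finrank_prod, Module.finrank_self]; lia)
      (blk_injective hx Function.injective_id u), Finset.mul_sum]
    exact Finset.sum_congr rfl fun i _ => by ring

/-- The value of the generic functional at an irreducible character. -/
noncomputable def genericValue (a : IrrLabel k) : ℂ := ((descent ψ)^[a.1] a.fn.mark).atZero

lemma atZero_iterate_descent_fn (a : IrrLabel k) (n : ℕ) :
    ((descent ψ)^[n] a.fn.mark).atZero = if a.1 = n then genericValue ψ a else 0 := by
  split_ifs with h
  · rw [← h, genericValue]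
  · refine a.iterate_descent_eq_zero ψ n PUnit 0 0 ?_
    rw [Module.finrank_zero_of_subsingleton]
    lia

lemma atZero_iterate_descent_expand {f : EndFn k} {z : IrrLabel k → ℂ} {n N : ℕ}
    (h : ∀ (V : Type) [AddCommGroup V] [Module k V] [Finite V] (x : Module.End k V),
      Module.finrank k V ≤ N → Function.Injective x →
      f V x = ∑ e ∈ labelBall k N, z e * e.fn V x) (hn : n ≤ N) :
    ((descent ψ)^[n] f.mark).atZero =
      ∑ e ∈ labelBall k N with e.1 = n, z e * genericValue ψ e := by
  rw [MarkedFn.atZero, iterate_descent_expand ψ h n PUnit 0 0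
    (by rw [Module.finrank_zero_of_subsingleton]; lia) (Function.injective_of_subsingleton _),
    Finset.sum_filter]
  refine Finset.sum_congr rfl fun e _ => ?_
  have h1 := atZero_iterate_descent_fn ψ e n
  rw [MarkedFn.atZero] at h1
  rw [h1]
  split_ifs <;> simp

variable {ψ}

lemma genericValue_mul (hψ : ψ ≠ 1) {a b : IrrLabel k} {N : ℕ} (h : a.1 + b.1 ≤ N) :
    ∑ e ∈ labelBall k N, cof e.fn a b * genericValue ψ e =
      genericValue ψ a * genericValue ψ b := by
  have h1 := atZero_iterate_descent_prod hψ a.fn_invariant b.fn_invariant (a.1 + b.1)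
  rw [atZero_iterate_descent_expand ψ (fun V _ _ _ x hV hx => prod_expand a b hV hx) h,
    Finset.sum_eq_single a.1] at h1
  · rw [atZero_iterate_descent_fn, if_pos rfl, Nat.add_sub_cancel_left,
      atZero_iterate_descent_fn, if_pos rfl] at h1
    rw [← h1, Finset.sum_filter]
    refine Finset.sum_congr rfl fun e _ => ?_
    split_ifs with he
    · rfl
    · rw [cof_eq_zero (Ne.symm he), zero_mul]
  · intro i _ hi
    rw [atZero_iterate_descent_fn, if_neg (Ne.symm hi), zero_mul]
  · intro hi
    exact (hi (Finset.mem_range.2 (by lia))).elim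

lemma genericValue_oneLabel : genericValue ψ (oneLabel k) = 1 := by
  have h1 := oneLabel_apply (1 : StdAut k 0)
  refine Eq.trans ?_ (((oneLabel k).fn_std (1 : StdAut k 0)).trans h1)
  have : Unique (Fin (oneLabel k).1 → k) := inferInstanceAs (Unique (Fin 0 → k))
  exact (oneLabel k).fn_invariant _ _ (default : PUnit ≃ₗ[k] (Fin (oneLabel k).1 → k)) _ _
    fun v => Subsingleton.elim _ _

lemma iterate_descent_fn_eq (x : IrrLabel k) {V : Type} [AddCommGroup V] [Module k V] [Finite V]
    {N n : ℕ} (hV : Module.finrank k V ≤ N) (hn : n ≤ N) {y : Module.End k V}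
    (hy : Function.Injective y) :
    (descent ψ)^[n] x.fn.mark V 0 y = ∑ b ∈ labelBall k N,
      (∑ s ∈ labelBall k N with s.1 = n, genericValue ψ s * cof x.fn b s) * b.fn V y := by
  rw [iterate_descent_mark_eq ψ x.fn_invariant, atZero_iterate_descent_expand ψ (n := n) (N := N)
    (z := fun s => ∑ b ∈ labelBall k N, cof x.fn b s * b.fn V y) ?_ hn]
  · simp only [Finset.sum_mul]
    rw [Finset.sum_comm]
    exact Finset.sum_congr rfl fun b _ => Finset.sum_congr rfl fun s _ => by ring
  · intro W _ _ _ z hW hz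
    rw [coprod_expand x.fn_invariant hV hW hy hz, Finset.sum_comm]
    refine Finset.sum_congr rfl fun s _ => ?_
    rw [Finset.sum_mul]
    exact Finset.sum_congr rfl fun b _ => by ring

lemma exists_genericValue_ne_zero (hψ : ψ ≠ 1) {x : IrrLabel k} (hx : 0 < x.1) :
    ∃ s b : IrrLabel k, genericValue ψ s ≠ 0 ∧ 0 < s.1 ∧ cof x.fn b s ≠ 0 := by
  by_contra! h
  refine x.2.2.apply_one_ne_zero ?_
  rw [← x.fn_std]
  refine eq_zero_of_iterate_descent_eq_zero hψ x.fn_invariant hx ?_ _ (Module.finrank_fin_fun k)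
  intro V _ _ _ j hj hV
  rw [iterate_descent_fn_eq (N := x.1) x (by lia) (by lia) Function.injective_id]
  refine Finset.sum_eq_zero fun b _ => ?_
  rw [Finset.sum_eq_zero, zero_mul]
  intro s hs
  by_cases hs' : genericValue ψ s = 0
  · rw [hs', zero_mul]
  · rw [h s b hs' (by rw [(Finset.mem_filter.1 hs).2]; exact hj), mul_zero]

end GenericFunctional

section MultiplicityFree

variable {G : Type} [Group G] [Fintype G] {M : Type} [AddCommGroup M] [Module ℂ M]
  [FiniteDimensional ℂ M]

lemma Representation.IsIrreducible.sum_conj (ρ : Representation ℂ G M) [ρ.IsIrreducible]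
    (X : Module.End ℂ M) : (Module.finrank ℂ M : ℂ) • ∑ g, ρ g * X * ρ g⁻¹ =
      ((Nat.card G : ℂ) * LinearMap.trace ℂ M X) • 1 := by
  have h1 : ∀ h, ρ h * (∑ g, ρ g * X * ρ g⁻¹) = (∑ g, ρ g * X * ρ g⁻¹) * ρ h := by
    intro h
    rw [Finset.mul_sum, Finset.sum_mul]
    refine Fintype.sum_equiv (Equiv.mulLeft h) _ _ fun g => ?_
    rw [Equiv.coe_mulLeft, mul_inv_rev, mul_assoc _ _ (ρ h), ← map_mul, inv_mul_cancel_right,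
      map_mul, mul_assoc, mul_assoc, mul_assoc]
  obtain ⟨c, hc⟩ := exists_eq_smul_id ρ (∑ g, ρ g * X * ρ g⁻¹) fun g v =>
    (LinearMap.congr_fun (h1 g) v).symm
  have h2 : (Nat.card G : ℂ) * LinearMap.trace ℂ M X = c * Module.finrank ℂ M := by
    have h3 := congrArg (LinearMap.trace ℂ M) hc
    rw [map_smul, LinearMap.trace_id, smul_eq_mul, map_sum] at h3
    rw [← h3, Finset.sum_congr rfl fun g _ => (by
      rw [LinearMap.trace_mul_comm, ← mul_assoc, ← map_mul, inv_mul_cancel, map_one, one_mul] :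
      LinearMap.trace ℂ M (ρ g * X * ρ g⁻¹) = LinearMap.trace ℂ M X)]
    simp [Nat.card_eq_fintype_card]
  rw [hc, h2, smul_smul, mul_comm]
  rfl

lemma Representation.IsIrreducible.sum_character_smul (ρ : Representation ℂ G M) [ρ.IsIrreducible]
    (x : G) : (Module.finrank ℂ M : ℂ) • ∑ g, ρ.character (x * g) • ρ g⁻¹ =
      (Nat.card G : ℂ) • ρ x := by
  have h1 : ∀ h, ρ h * (∑ g, ρ.character g • ρ g⁻¹) = (∑ g, ρ.character g • ρ g⁻¹) * ρ h := by
    intro h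
    rw [Finset.mul_sum, Finset.sum_mul]
    refine Fintype.sum_equiv (MulAut.conj h).toEquiv _ _ fun g => ?_
    change ρ h * ρ.character g • ρ g⁻¹ =
      ρ.character (h * g * h⁻¹) • ρ (h * g * h⁻¹)⁻¹ * ρ h
    rw [(isCharacter_of_representation ρ).conj_mul, mul_smul_comm, smul_mul_assoc, ← map_mul,
      ← map_mul]
    congr 2
    group
  obtain ⟨c, hc⟩ := exists_eq_smul_id ρ (∑ g, ρ.character g • ρ g⁻¹) fun g v =>
    (LinearMap.congr_fun (h1 g) v).symm
  have h2 : (Nat.card G : ℂ) = c * Module.finrank ℂ M := by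
    have h3 := congrArg (LinearMap.trace ℂ M) hc
    rw [map_smul, LinearMap.trace_id, smul_eq_mul, map_sum] at h3
    rw [← h3]
    have h4 := (isIrrCharacter ρ).pairing (isIrrCharacter ρ)
    rw [if_pos rfl, _root_.pairing, inv_mul_eq_iff_eq_mul₀ (Nat.cast_ne_zero.2 Nat.card_pos.ne'),
      mul_one] at h4
    rw [← h4]
    refine Finset.sum_congr rfl fun g _ => ?_
    rw [(isCharacter_of_representation ρ).star_apply, map_smul, smul_eq_mul]
    rfl
  have h5 : ∑ g, ρ.character (x * g) • ρ g⁻¹ = (∑ g, ρ.character g • ρ g⁻¹) * ρ x := by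
    rw [Finset.sum_mul]
    refine Fintype.sum_equiv (Equiv.mulLeft x) _ _ fun g => ?_
    rw [Equiv.coe_mulLeft, smul_mul_assoc, ← map_mul, mul_inv_rev, inv_mul_cancel_right]
  rw [h5, hc, h2, smul_mul_assoc, smul_smul, mul_comm]
  rfl

variable (U : Subgroup G) (θ : U →* ℂ)

open Classical in
/-- The projection onto the eigenspace of a linear character of a subgroup. -/
noncomputable def eigenProj (ρ : Representation ℂ G M) : Module.End ℂ M :=
  (Nat.card U : ℂ)⁻¹ • ∑ u : U, θ u • ρ u

variable {U θ}

omit [Fintype G] in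
lemma MonoidHom.mul_inv_apply (u : U) : θ u * θ u⁻¹ = 1 := by
  rw [← map_mul, mul_inv_cancel, map_one]

omit [FiniteDimensional ℂ M] in
lemma eigenProj_mul (ρ : Representation ℂ G M) (u : U) :
    eigenProj U θ ρ * ρ u = θ u⁻¹ • eigenProj U θ ρ := by
  classical
  rw [eigenProj, smul_mul_assoc, smul_comm]
  congr 1
  rw [Finset.sum_mul, Finset.smul_sum]
  refine Fintype.sum_equiv (Equiv.mulRight u) _ _ fun v => ?_
  rw [smul_mul_assoc, smul_smul, Equiv.coe_mulRight, map_mul, Subgroup.coe_mul, map_mul,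
    mul_left_comm, mul_comm (θ u⁻¹), MonoidHom.mul_inv_apply, mul_one]

omit [FiniteDimensional ℂ M] in
lemma mul_eigenProj (ρ : Representation ℂ G M) (u : U) :
    ρ u * eigenProj U θ ρ = θ u⁻¹ • eigenProj U θ ρ := by
  classical
  rw [eigenProj, mul_smul_comm, smul_comm]
  congr 1
  rw [Finset.mul_sum, Finset.smul_sum]
  refine Fintype.sum_equiv (Equiv.mulLeft u) _ _ fun v => ?_
  rw [mul_smul_comm, smul_smul, Equiv.coe_mulLeft, map_mul, Subgroup.coe_mul, map_mul,
    ← mul_assoc, mul_comm (θ u⁻¹), MonoidHom.mul_inv_apply, one_mul]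

omit [FiniteDimensional ℂ M] in
lemma eigenProj_mul_self (ρ : Representation ℂ G M) :
    eigenProj U θ ρ * eigenProj U θ ρ = eigenProj U θ ρ := by
  classical
  nth_rw 2 [eigenProj]
  rw [mul_smul_comm, Finset.mul_sum, Finset.sum_congr rfl fun u _ => (by
    rw [mul_smul_comm, eigenProj_mul, smul_smul, MonoidHom.mul_inv_apply, one_smul] :
    eigenProj U θ ρ * θ u • ρ u = eigenProj U θ ρ), Finset.sum_const, Finset.card_univ,
    ← Nat.card_eq_fintype_card, ← Nat.cast_smul_eq_nsmul ℂ, smul_smul, inv_mul_cancel₀, one_smul]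
  exact Nat.cast_ne_zero.2 Nat.card_pos.ne'

omit [FiniteDimensional ℂ M] in
lemma trace_eigenProj_mul (ρ : Representation ℂ G M) (g : G) :
    LinearMap.trace ℂ M (eigenProj U θ ρ * ρ g) =
      avg fun u : U => θ u * ρ.character (u * g) := by
  classical
  rw [eigenProj, avg_eq_sum, smul_mul_assoc, map_smul, smul_eq_mul, Finset.sum_mul, map_sum]
  congr 1
  refine Finset.sum_congr rfl fun u _ => ?_
  rw [smul_mul_assoc, map_smul, ← map_mul]
  rfl

/-- A linear character of a subgroup induces a multiplicity-free representation if there is an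
anti-involution fixing the double cosets supporting intertwining operators. -/
lemma IsIrrCharacter.avg_eq_zero_or_one {χ : G → ℂ} (hχ : IsIrrCharacter χ) (τ : G → G)
    (hτ : ∀ g h, τ (g * h) = τ h * τ g) (hττ : ∀ g, τ (τ g) = g)
    (hτU : ∀ u : U, ∃ h : τ u ∈ U, θ ⟨τ u, h⟩ = θ u)
    (hG : ∀ g, ∃ (u u' : U) (m : G), g = u * m * u' ∧
      (τ m = m ∨ ∃ v v' : U, v' * m = m * v ∧ θ v ≠ θ v')) :
    (avg fun u : U => θ u * χ u) = 0 ∨ (avg fun u : U => θ u * χ u) = 1 := by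
  classical
  obtain ⟨M, _, _, _, ρ, hρ, rfl⟩ := hχ.exists_representation
  let e := eigenProj U θ ρ
  let B : G → Module.End ℂ M := fun g => e * ρ g * e
  have hB : ∀ (u : U) g (u' : U), B (u * g * u') = (θ u⁻¹ * θ u'⁻¹) • B g := by
    intro u g u'
    simp only [B, map_mul, e]
    rw [← mul_assoc, ← mul_assoc, eigenProj_mul, mul_assoc _ (ρ u'), mul_eigenProj]
    simp only [smul_mul_assoc, mul_smul_comm, smul_smul, mul_comm]
  have hθ : ∀ u u' : U, θ u⁻¹ = θ u'⁻¹ → θ u = θ u' := by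
    intro u u' h
    have h1 := MonoidHom.mul_inv_apply (θ := θ) u
    have h2 := MonoidHom.mul_inv_apply (θ := θ) u'
    rw [h] at h1
    exact mul_right_cancel₀ (right_ne_zero_of_mul_eq_one h1) (h1.trans h2.symm)
  have hBτ : ∀ g, B (τ g) = B g := by
    intro g
    obtain ⟨u, u', m, rfl, hm⟩ := hG g
    obtain ⟨h1, h2⟩ := hτU u⁻¹
    obtain ⟨h3, h4⟩ := hτU u'⁻¹
    have hτ1 : τ 1 = 1 := by simpa using hτ 1 1
    have hinv : ∀ x, τ x⁻¹ = (τ x)⁻¹ := fun x =>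
      eq_inv_of_mul_eq_one_left (by rw [← hτ, mul_inv_cancel, hτ1])
    have h5 : τ (u * m * u') = (⟨τ (u'⁻¹ : U), h3⟩⁻¹ : U) * τ m * (⟨τ (u⁻¹ : U), h1⟩⁻¹ : U) := by
      rw [hτ, hτ, mul_assoc]
      simp [hinv]
    rw [h5, hB, hB, inv_inv, inv_inv, h2, h4, mul_comm]
    obtain hm | ⟨v, v', hv, hne⟩ := hm
    · rw [hm]
    · have h6 : ∀ (a : G) (x y : U), (x : G) * a = a * y → θ x ≠ θ y → B a = 0 := by
        intro a x y hxy hne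
        have h7 := hB x a 1
        have h8 := hB 1 a y
        rw [Subgroup.coe_one, mul_one, inv_one, map_one, mul_one, hxy] at h7
        rw [Subgroup.coe_one, one_mul, inv_one, map_one, one_mul, h7] at h8
        by_contra h9
        exact hne (hθ _ _ (smul_left_injective ℂ h9 h8))
      obtain ⟨h7, h8⟩ := hτU v
      obtain ⟨h9, h10⟩ := hτU v'
      rw [h6 m v' v hv hne.symm, h6 (τ m) ⟨τ v, h7⟩ ⟨τ v', h9⟩ (by
        change τ v * τ m = τ m * τ v'
        rw [← hτ, ← hτ, hv]) (by rwa [h8, h10])]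
  have hcomm : ∀ g h, B g * B h = B h * B g := by
    have h1 : ∀ g h, B g * B h = (Nat.card U : ℂ)⁻¹ • ∑ u : U, θ u • B (g * u * h) := by
      intro g h
      have h2 : B g * B h = e * ρ g * e * (ρ h * e) := by
        simp only [B]
        rw [← mul_assoc, ← mul_assoc, mul_assoc _ e e, eigenProj_mul_self]
        rw [mul_assoc (e * ρ g * e)]
      rw [h2]
      nth_rw 2 [show e = (Nat.card U : ℂ)⁻¹ • ∑ u : U, θ u • ρ u from rfl]
      rw [mul_smul_comm, smul_mul_assoc, Finset.mul_sum, Finset.sum_mul]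
      congr 1
      refine Finset.sum_congr rfl fun u _ => ?_
      rw [mul_smul_comm, smul_mul_assoc]
      simp only [B, map_mul, mul_assoc]
    intro g h
    rw [h1, ← hBτ g, ← hBτ h, h1]
    congr 1
    let T : U ≃ U := ⟨fun u => ⟨τ u, (hτU u).1⟩, fun u => ⟨τ u, (hτU u).1⟩,
      fun u => Subtype.ext (hττ u), fun u => Subtype.ext (hττ u)⟩
    refine Fintype.sum_equiv T _ _ fun u => ?_
    obtain ⟨h2, h3⟩ := hτU u
    rw [← hBτ (g * u * h), hτ, hτ, ← mul_assoc]
    simp only [T, Equiv.coe_fn_mk]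
    rw [h3]
  set r := avg fun u : U => θ u * ρ.character u with hr
  have he : e * e = e := eigenProj_mul_self ρ
  have hre : LinearMap.trace ℂ M e = r := by
    have := trace_eigenProj_mul (U := U) (θ := θ) ρ 1
    simpa using this
  have hd : (Module.finrank ℂ M : ℂ) ≠ 0 := by
    have := hχ.apply_one_ne_zero
    rwa [Representation.char_one] at this
  have hc : (Nat.card G : ℂ) ≠ 0 := Nat.cast_ne_zero.2 Nat.card_pos.ne'
  have hsum : ∀ X : Module.End ℂ M, ∑ g, ρ g * X * ρ g⁻¹ =
      ((Module.finrank ℂ M : ℂ)⁻¹ * ((Nat.card G : ℂ) * LinearMap.trace ℂ M X)) • 1 := by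
    intro X
    rw [mul_smul, ← hρ.sum_conj, inv_smul_smul₀ hd]
  have key : ∀ h, LinearMap.trace ℂ M (e * ρ h) • e = r • B h := by
    intro h
    have h1 : ∑ g, B g * B h * B g⁻¹ = e * (∑ g, ρ g * B h * ρ g⁻¹) * e := by
      rw [Finset.mul_sum, Finset.sum_mul]
      refine Finset.sum_congr rfl fun g _ => ?_
      simp only [B, mul_assoc]
      simp only [← mul_assoc e e, he]
    have h2 : ∑ g, B g * B h * B g⁻¹ = B h * (∑ g, ρ g * e * ρ g⁻¹) * e := by
      rw [Finset.mul_sum, Finset.sum_mul]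
      refine Finset.sum_congr rfl fun g _ => ?_
      rw [hcomm g h]
      simp only [B, mul_assoc]
      simp only [← mul_assoc e e, he]
    have h3 := h1.symm.trans h2
    rw [hsum, hsum, mul_smul_comm, mul_smul_comm, smul_mul_assoc, smul_mul_assoc, mul_one,
      mul_one, he, mul_smul, mul_smul, mul_smul, mul_smul, hre] at h3
    have h4 := smul_right_injective _ hc (smul_right_injective _ (inv_ne_zero hd) h3)
    simp only [B] at h4 ⊢
    rwa [mul_assoc _ e e, he, mul_assoc e, LinearMap.trace_mul_comm, mul_assoc, he,
      LinearMap.trace_mul_comm, ← mul_assoc] at h4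
  have key2 : e = (r ^ 2) • e := by
    have h1 : ∑ h, LinearMap.trace ℂ M (e * ρ h) • e * ρ h⁻¹ =
        r • (e * ∑ h, ρ h * e * ρ h⁻¹) := by
      rw [Finset.mul_sum, Finset.smul_sum]
      refine Finset.sum_congr rfl fun h _ => ?_
      rw [key, smul_mul_assoc]
      simp only [B, mul_assoc]
    have h2 : (Module.finrank ℂ M : ℂ) • ∑ h, LinearMap.trace ℂ M (e * ρ h) • ρ h⁻¹ =
        (Nat.card G : ℂ) • e := by
      simp only [e, trace_eigenProj_mul, avg_eq_sum]
      simp only [mul_smul, ← Finset.smul_sum, Finset.sum_smul]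
      rw [Finset.sum_comm]
      simp only [← Finset.smul_sum]
      rw [smul_comm, Finset.smul_sum, eigenProj, smul_comm (Nat.card G : ℂ), Finset.smul_sum (r := (Nat.card G : ℂ))]
      congr 1
      refine Finset.sum_congr rfl fun u _ => ?_
      rw [smul_comm, hρ.sum_character_smul, smul_comm]
    have h3 : (Nat.card G : ℂ) • e = (Module.finrank ℂ M : ℂ) •
        ∑ h, LinearMap.trace ℂ M (e * ρ h) • e * ρ h⁻¹ := by
      simp only [smul_mul_assoc, ← mul_smul_comm]
      rw [← Finset.mul_sum, ← mul_smul_comm, h2, mul_smul_comm, he]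
    rw [h1, hsum, mul_smul_comm, mul_one, hre, smul_comm r, mul_smul, smul_inv_smul₀ hd,
      mul_smul] at h3
    rw [smul_comm r] at h3
    rw [pow_two, mul_smul]
    exact smul_right_injective _ hc h3
  have h1 : r = r ^ 3 := by
    have h2 := congrArg (LinearMap.trace ℂ M) key2
    rw [map_smul, hre, smul_eq_mul] at h2
    exact h2.trans (by ring)
  obtain ⟨n, hn⟩ : ∃ n : ℕ, r = n := by
    have h2 := LinearMap.isProj_range_iff_isIdempotentElem e |>.2 he
    exact ⟨_, hre.symm.trans h2.trace⟩
  rw [hn] at h1 ⊢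
  norm_cast at h1 ⊢
  rcases n with _ | _ | n
  · simp
  · simp
  · exfalso
    nlinarith [sq_nonneg n]

end MultiplicityFree

section Unitriangular

/-- A permutation of `ℕ` which only descends by one step is an involution. -/
lemma Equiv.Perm.involutive_of_descents {α : Type} (r : Equiv.Perm ℕ) (t : ℕ → α)
    (h : ∀ j, r (j + 1) < r j → r j = r (j + 1) + 1 ∧ t j = t (j + 1)) (x : ℕ) :
    r (r x) = x ∧ t (r x) = t x := by
  have step : ∀ s, (∀ x, x < s ↔ r x < s) →
      ∀ i, s + i ≤ r s → r (s + i) + i = r s ∧ t (s + i) = t s := by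
    intro s hs i
    induction i using Nat.strong_induction_on with
    | _ i ih =>
      intro hi
      obtain _ | i := i
      · simp
      have h1 := ih i i.lt_succ_self (by omega)
      rcases lt_or_ge (r (s + i + 1)) (r (s + i)) with h2 | h2
      · have h3 := h _ h2
        rw [← add_assoc s i 1]
        exact ⟨by omega, by rw [← h3.2, h1.2]⟩
      exfalso
      have hval : ∀ y, s + i < y → r y + i ≥ r s → r s < r y := by
        intro y hy hy'
        by_contra! h3
        have h4 := ih (r s - r y) (by omega) (by omega)
        have h5 : y = s + (r s - r y) := r.injective (by omega)
        omega
      have hcross : ∀ d, r (s + i + 1 + d) > r s := by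
        intro d
        induction d with
        | zero => exact hval _ (by omega) (by rw [add_zero]; omega)
        | succ d ihd =>
          refine hval _ (by omega) ?_
          by_contra! h3
          have h4 := (h (s + i + 1 + d) (by rw [add_assoc _ d 1]; omega)).1
          rw [add_assoc _ d 1] at h4
          omega
      obtain ⟨p, hp⟩ := r.surjective (r s - (i + 1))
      rcases lt_or_ge p (s + i + 1) with h3 | h3
      · rcases lt_or_ge p s with h4 | h4
        · have := (hs p).1 h4
          omega
        · have h5 := ih (p - s) (by omega) (by omega)
          rw [Nat.add_sub_cancel' h4] at h5
          omega
      · have h4 := hcross (p - (s + i + 1))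
        rw [Nat.add_sub_cancel' h3] at h4
        omega
  have main : ∀ m, ∃ s, m ≤ s ∧ (∀ x, x < s ↔ r x < s) ∧
      ∀ x < s, r (r x) = x ∧ t (r x) = t x := by
    intro m
    induction m with
    | zero => exact ⟨0, le_rfl, by simp, by simp⟩
    | succ m ih =>
      obtain ⟨s, hms, hs, hC⟩ := ih
      have hsr : s ≤ r s := by
        by_contra! h1
        exact lt_irrefl _ ((hs s).2 h1)
      have hb : ∀ x, s ≤ x → x ≤ r s → r x + x = r s + s ∧ t x = t s := by
        intro x h1 h2
        have h3 := step s hs (x - s) (by omega)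
        rw [Nat.add_sub_cancel' h1] at h3
        exact ⟨by omega, h3.2⟩
      refine ⟨r s + 1, by omega, fun x => ⟨fun h1 => ?_, fun h1 => ?_⟩, fun x h1 => ?_⟩
      · rcases lt_or_ge x s with h2 | h2
        · have := (hs x).1 h2
          omega
        · have := hb x h2 (by omega)
          omega
      · rcases lt_or_ge x s with h2 | h2
        · omega
        · have h3 : ¬ r x < s := fun h4 => absurd ((hs x).2 h4) (by omega)
          have h5 := hb (s + r s - r x) (by omega) (by omega)
          have h6 : x = s + r s - r x := r.injective (by omega)
          omega
      · rcases lt_or_ge x s with h2 | h2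
        · exact hC x h2
        · have h3 := hb x h2 (by omega)
          have h4 := hb (r x) (by omega) (by omega)
          exact ⟨by omega, h4.2.trans h3.2.symm⟩
  obtain ⟨s, hxs, -, hC⟩ := main (x + 1)
  exact hC x (by omega)

end Unitriangular

section Bruhat

variable {k : Type} [Field k] {n : ℕ}

/-- Unitriangularity of a square matrix. -/
def Matrix.IsUnitriangular (M : Matrix (Fin n) (Fin n) k) : Prop :=
  (∀ i, M i i = 1) ∧ ∀ i j, j < i → M i j = 0

namespace Matrix.IsUnitriangular

variable {M N : Matrix (Fin n) (Fin n) k}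

lemma one : (1 : Matrix (Fin n) (Fin n) k).IsUnitriangular :=
  ⟨fun _ => one_apply_eq _, fun _ _ h => one_apply_ne h.ne'⟩

lemma mul (hM : M.IsUnitriangular) (hN : N.IsUnitriangular) : (M * N).IsUnitriangular := by
  refine ⟨fun i => ?_, fun i j hij => ?_⟩
  · rw [mul_apply, Finset.sum_eq_single i, hM.1, hN.1, one_mul]
    · intro l _ hl
      rcases lt_or_gt_of_ne hl with h | h
      · rw [hM.2 _ _ h, zero_mul]
      · rw [hN.2 _ _ h, mul_zero]
    · simp
  · rw [mul_apply]
    refine Finset.sum_eq_zero fun l _ => ?_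
    rcases lt_or_ge l i with h | h
    · rw [hM.2 _ _ h, zero_mul]
    · rw [hN.2 _ _ (hij.trans_le h), mul_zero]

lemma det (hM : M.IsUnitriangular) : M.det = 1 := by
  rw [det_of_isUpperTriangular fun i j h => hM.2 i j h]
  exact Finset.prod_eq_one fun i _ => hM.1 i

lemma one_sub_col {i : Fin n} {c : Fin n → k} (hc : ∀ a, i ≤ a → c a = 0) :
    (1 - vecMulVec c (Pi.single i 1)).IsUnitriangular := by
  refine ⟨fun a => ?_, fun a b hab => ?_⟩
  · by_cases h : a = i
    · simp [vecMulVec_apply, hc a h.ge]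
    · simp [vecMulVec_apply, Pi.single_eq_of_ne h]
  · rw [sub_apply, one_apply_ne hab.ne', vecMulVec_apply, zero_sub, neg_eq_zero]
    by_cases h : b = i
    · rw [hc a (h ▸ hab.le), zero_mul]
    · rw [Pi.single_eq_of_ne h, mul_zero]

lemma one_sub_row {i : Fin n} {d : Fin n → k} (hd : ∀ b, b ≤ i → d b = 0) :
    (1 - vecMulVec (Pi.single i 1) d).IsUnitriangular := by
  refine ⟨fun a => ?_, fun a b hab => ?_⟩
  · by_cases h : a = i
    · simp [vecMulVec_apply, hd a h.le]
    · simp [vecMulVec_apply, Pi.single_eq_of_ne h]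
  · rw [sub_apply, one_apply_ne hab.ne', vecMulVec_apply, zero_sub, neg_eq_zero]
    by_cases h : a = i
    · rw [hd b (h ▸ hab.le), mul_zero]
    · rw [Pi.single_eq_of_ne h, zero_mul]

/-- A unitriangular matrix as an invertible matrix. -/
noncomputable def toGL (hM : M.IsUnitriangular) : GL (Fin n) k :=
  Matrix.GeneralLinearGroup.mkOfDetNeZero M (by rw [hM.det]; exact one_ne_zero)

lemma val_toGL (hM : M.IsUnitriangular) : hM.toGL.val = M := rfl

end Matrix.IsUnitriangular

variable (k n) in
/-- The subgroup of unitriangular matrices. -/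
def unitriangularGroup [Finite k] : Subgroup (GL (Fin n) k) where
  carrier := {g | g.val.IsUnitriangular}
  one_mem' := Matrix.IsUnitriangular.one
  mul_mem' ha hb := Matrix.IsUnitriangular.mul ha hb
  inv_mem' {g} hg := by
    have h : ∀ m : ℕ, (g ^ m).val.IsUnitriangular := by
      intro m
      induction m with
      | zero => exact Matrix.IsUnitriangular.one
      | succ m ih => exact pow_succ g m ▸ ih.mul hg
    obtain ⟨m, hm⟩ := (isOfFinOrder_of_finite g).mem_powers_iff_mem_zpowers.2
      ((Subgroup.zpowers g).inv_mem (Subgroup.mem_zpowers g))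
    exact hm ▸ h m

variable [Finite k]

/-- The first `j` columns of a matrix are monomial. -/
def Matrix.IsMonomialUpTo (m : Matrix (Fin n) (Fin n) k) (j : ℕ) : Prop :=
  ∀ b : Fin n, (b : ℕ) < j → ∃ a, m a b ≠ 0 ∧ (∀ a', a' ≠ a → m a' b = 0) ∧
    ∀ b', b' ≠ b → m a b' = 0

lemma exists_isMonomialUpTo_succ {j : ℕ} (hj : j < n) (g : GL (Fin n) k)
    (hg : g.val.IsMonomialUpTo j) : ∃ u u' : unitriangularGroup k n,
      (u * g * u' : GL (Fin n) k).val.IsMonomialUpTo (j + 1) := by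
  classical
  let J : Fin n := ⟨j, hj⟩
  obtain ⟨a₀, ha₀⟩ : ∃ a, g.val a J ≠ 0 := by
    by_contra! h
    exact g.det_ne_zero (Matrix.det_eq_zero_of_column_eq_zero J h)
  obtain ⟨i, hi, himax⟩ := (Finset.univ.filter fun a => g.val a J ≠ 0).exists_max_image id
    ⟨a₀, by simpa using ha₀⟩
  have hi : g.val i J ≠ 0 := by simpa using hi
  have himax : ∀ a, i < a → g.val a J = 0 := by
    intro a ha
    by_contra h
    exact absurd (himax a (by simpa using h)) (not_le.2 ha)
  let c : Fin n → k := fun a => if a < i then g.val a J / g.val i J else 0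
  let d : Fin n → k := fun b => if J < b then g.val i b / g.val i J else 0
  have hL := Matrix.IsUnitriangular.one_sub_col (i := i) (c := c) fun a ha => if_neg (not_lt.2 ha)
  have hR := Matrix.IsUnitriangular.one_sub_row (i := J) (d := d) fun b hb => if_neg (not_lt.2 hb)
  refine ⟨⟨hL.toGL, hL⟩, ⟨hR.toGL, hR⟩, ?_⟩
  have hi0 : ∀ b : Fin n, (b : ℕ) < j → g.val i b = 0 := by
    intro b hb
    obtain ⟨a, -, h2, h3⟩ := hg b hb
    refine h2 i fun h => hi ?_
    rw [h]
    exact h3 J (Fin.ne_of_gt hb)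
  set m := (1 - Matrix.vecMulVec c (Pi.single i 1)) * g.val *
    (1 - Matrix.vecMulVec (Pi.single J 1) d) with hm
  change m.IsMonomialUpTo (j + 1)
  have h1 : ∀ a b, ((1 - Matrix.vecMulVec c (Pi.single i 1)) * g.val) a b =
      g.val a b - c a * g.val i b := by
    intro a b
    rw [sub_mul, one_mul, Matrix.sub_apply, Matrix.vecMulVec_mul, Matrix.vecMulVec_apply,
      Matrix.single_one_vecMul]
    rfl
  have h2 : ∀ a b, m a b = g.val a b - c a * g.val i b - (g.val a J - c a * g.val i J) * d b := by
    intro a b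
    rw [hm, mul_sub, mul_one, Matrix.sub_apply, h1, Matrix.mul_vecMulVec, Matrix.vecMulVec_apply,
      Matrix.mulVec_single_one, Matrix.col_apply, h1]
  have hci : c i = 0 := if_neg (lt_irrefl i)
  have hdJ : d J = 0 := if_neg (lt_irrefl J)
  have h3 : ∀ a, a ≠ i → g.val a J - c a * g.val i J = 0 := by
    intro a ha
    rcases lt_or_gt_of_ne ha with h | h
    · simp only [c, if_pos h, div_mul_cancel₀ _ hi, sub_self]
    · simp only [c, if_neg h.not_gt, himax a h, zero_mul, sub_self]
  have h4 : ∀ a, a ≠ i → ∀ b, m a b = g.val a b - c a * g.val i b := by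
    intro a ha b
    rw [h2, h3 a ha, zero_mul, sub_zero]
  have h5 : ∀ b, m i b = g.val i b - g.val i J * d b := by
    intro b
    rw [h2, hci]
    ring
  have h6 : ∀ b, b ≠ J → m i b = 0 := by
    intro b hb
    rw [h5]
    rcases lt_or_gt_of_ne hb with h | h
    · simp only [d, if_neg h.not_gt, hi0 b h, mul_zero, sub_self]
    · simp only [d, if_pos h, mul_div_cancel₀ _ hi, sub_self]
  intro b hb
  rcases Nat.lt_succ_iff_lt_or_eq.1 hb with hb | hb
  · obtain ⟨a, ha, ha', hb'⟩ := hg b hb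
    have hbJ : b ≠ J := Fin.ne_of_lt hb
    have hai : a ≠ i := fun h => ha (h ▸ hi0 b hb)
    refine ⟨a, ?_, fun a' h => ?_, fun b' h => ?_⟩
    · rwa [h4 a hai, hi0 b hb, mul_zero, sub_zero]
    · by_cases h7 : a' = i
      · rw [h7, h6 b hbJ]
      · rw [h4 a' h7, hi0 b hb, ha' a' h, mul_zero, sub_zero]
    · have h7 : c a = 0 := by simp [c, hb' J hbJ.symm]
      rw [h4 a hai, h7, zero_mul, hb' b' h, sub_zero]
  · obtain rfl : b = J := Fin.ext hb
    refine ⟨i, ?_, fun a' h => ?_, fun b' h => h6 b' h⟩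
    · rwa [h5, hdJ, mul_zero, sub_zero]
    · rw [h4 a' h, h3 a' h]

/-- The Bruhat decomposition. -/
lemma exists_monomial (g : GL (Fin n) k) : ∃ (u u' : unitriangularGroup k n) (m : GL (Fin n) k)
    (w : Equiv.Perm (Fin n)) (t : Fin n → k), g = u * m * u' ∧ (∀ b, t b ≠ 0) ∧
      ∀ a b, m.val a b = if a = w b then t b else 0 := by
  classical
  have key : ∀ j ≤ n, ∃ u u' : unitriangularGroup k n,
      (u * g * u' : GL (Fin n) k).val.IsMonomialUpTo j := by
    intro j
    induction j with
    | zero => exact fun _ => ⟨1, 1, fun b hb => absurd hb (Nat.not_lt_zero _)⟩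
    | succ j ih =>
      intro hj
      obtain ⟨u, u', h⟩ := ih (by omega)
      obtain ⟨v, v', h'⟩ := exists_isMonomialUpTo_succ hj _ h
      refine ⟨v * u, u' * v', ?_⟩
      simpa only [Subgroup.coe_mul, mul_assoc] using h'
  obtain ⟨u, u', h⟩ := key n le_rfl
  choose w hw using fun b : Fin n => h b b.2
  have hinj : Function.Injective w := by
    intro b b' hbb
    by_contra hne
    exact (hw b).1 (by rw [hbb]; exact (hw b').2.2 b hne)
  refine ⟨u⁻¹, u'⁻¹, u * g * u', Equiv.ofBijective w (Finite.injective_iff_bijective.1 hinj),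
    fun b => (u * g * u' : GL (Fin n) k).val (w b) b, ?_, fun b => (hw b).1, fun a b => ?_⟩
  · simp [mul_assoc]
  · rw [Equiv.ofBijective_apply]
    split_ifs with hab
    · rw [hab]
    · exact (hw b).2.1 a hab

end Bruhat

section GelfandGraev

open Matrix

variable {k : Type} [Field k] {n : ℕ}

/-- The sum of the entries above the diagonal. -/
noncomputable def superdiagSum (M : Matrix (Fin n) (Fin n) k) : k :=
  ∑ i : Fin n, ∑ j : Fin n, if (i : ℕ) + 1 = j then M i j else 0

lemma superdiagSum_one : superdiagSum (1 : Matrix (Fin n) (Fin n) k) = 0 := by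
  refine Finset.sum_eq_zero fun i _ => Finset.sum_eq_zero fun j _ => ?_
  split_ifs with h
  · exact one_apply_ne fun h' => by rw [h'] at h; omega
  · rfl

lemma superdiagSum_mul {M N : Matrix (Fin n) (Fin n) k} (hM : M.IsUnitriangular)
    (hN : N.IsUnitriangular) : superdiagSum (M * N) = superdiagSum M + superdiagSum N := by
  rw [superdiagSum, superdiagSum, superdiagSum, ← Finset.sum_add_distrib]
  refine Finset.sum_congr rfl fun i _ => ?_
  rw [← Finset.sum_add_distrib]
  refine Finset.sum_congr rfl fun j _ => ?_
  split_ifs with h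
  · have hij : i ≠ j := fun h' => by rw [h'] at h; omega
    rw [mul_apply, ← Finset.sum_subset (Finset.subset_univ {i, j}), Finset.sum_pair hij, hM.1,
      hN.1, one_mul, mul_one, add_comm]
    intro l _ hl
    rw [Finset.mem_insert, Finset.mem_singleton, not_or] at hl
    rcases lt_or_gt_of_ne hl.1 with h1 | h1
    · rw [hM.2 _ _ h1, zero_mul]
    · rw [hN.2 _ _ (show j < l from lt_of_le_of_ne (Fin.le_def.2 (by rw [← h]; exact h1))
        (Ne.symm hl.2)), mul_zero]
  · rw [add_zero]

lemma superdiagSum_rev (M : Matrix (Fin n) (Fin n) k) :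
    superdiagSum (Mᵀ.submatrix Fin.rev Fin.rev) = superdiagSum M := by
  rw [superdiagSum, superdiagSum, Finset.sum_comm]
  refine Fintype.sum_equiv Fin.revPerm _ _ fun j => Fintype.sum_equiv Fin.revPerm _ _ fun i => ?_
  have h : (i : ℕ) + 1 = j ↔ ((Fin.revPerm j : Fin n) : ℕ) + 1 = Fin.revPerm i := by
    simp only [Fin.revPerm_apply, Fin.val_rev]
    omega
  simp only [h]
  rfl

lemma superdiagSum_one_sub (a : k) {i j : Fin n} (hij : i < j) :
    superdiagSum (1 - vecMulVec (Pi.single i a) (Pi.single j 1)) =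
      if (i : ℕ) + 1 = j then -a else 0 := by
  rw [superdiagSum, Finset.sum_eq_single i, Finset.sum_eq_single j]
  · simp [vecMulVec_apply, hij.ne]
  · intro j' _ hj'
    split_ifs with h
    · have : i ≠ j' := fun h' => by rw [h'] at h; omega
      simp [vecMulVec_apply, Pi.single_eq_of_ne hj', this]
    · rfl
  · simp
  · intro i' _ hi'
    refine Finset.sum_eq_zero fun j' _ => ?_
    split_ifs with h
    · have : i' ≠ j' := fun h' => by rw [h'] at h; omega
      simp [vecMulVec_apply, Pi.single_eq_of_ne hi', this]
    · rfl
  · simp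

variable [Finite k] (ψ : AddChar k ℂ)

/-- The generic character of the unitriangular group. -/
noncomputable def genericChar (n : ℕ) : unitriangularGroup k n →* ℂ where
  toFun u := ψ (superdiagSum u.1.val)
  map_one' := by
    rw [Subgroup.coe_one, Units.val_one, superdiagSum_one, AddChar.map_zero_eq_one]
  map_mul' u v := by
    rw [Subgroup.coe_mul, Units.val_mul, superdiagSum_mul u.2 v.2, AddChar.map_add_eq_mul]

/-- The anti-involution of the general linear group reflecting in the antidiagonal. -/
def antitranspose (g : GL (Fin n) k) : GL (Fin n) k where
  val := g.valᵀ.submatrix Fin.revPerm Fin.revPerm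
  inv := (transpose g.inv).submatrix Fin.revPerm Fin.revPerm
  val_inv := by
    rw [submatrix_mul_equiv, ← transpose_mul, g.inv_val, transpose_one, submatrix_one_equiv]
  inv_val := by
    rw [submatrix_mul_equiv, ← transpose_mul, g.val_inv, transpose_one, submatrix_one_equiv]

omit [Finite k] in
lemma antitranspose_apply (g : GL (Fin n) k) (i j : Fin n) :
    (antitranspose g).val i j = g.val j.rev i.rev := rfl

omit [Finite k] in
lemma antitranspose_mul (g h : GL (Fin n) k) :
    antitranspose (g * h) = antitranspose h * antitranspose g := by
  refine Units.ext ?_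
  change ((g.val * h.val)ᵀ).submatrix _ _ = _
  rw [transpose_mul, ← submatrix_mul_equiv _ _ _ Fin.revPerm]
  rfl

omit [Finite k] in
lemma antitranspose_antitranspose (g : GL (Fin n) k) : antitranspose (antitranspose g) = g := by
  refine Units.ext (Matrix.ext fun i j => ?_)
  rw [antitranspose_apply, antitranspose_apply, Fin.rev_rev, Fin.rev_rev]

variable {ψ}

omit [Finite k] in
/-- A monomial matrix admitting no obstruction is fixed by the anti-involution. -/
lemma antitranspose_eq_self {m : GL (Fin n) k} (w : Equiv.Perm (Fin n)) (t : Fin n → k)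
    (hm : ∀ a b, m.val a b = if a = w b then t b else 0)
    (h : ∀ i j : Fin n, (i : ℕ) + 1 = j → w i < w j → (w i : ℕ) + 1 = w j ∧ t i = t j) :
    antitranspose m = m := by
  classical
  let r : Equiv.Perm ℕ := Equiv.Perm.extendDomain (w.trans Fin.revPerm) Fin.equivSubtype
  let t' : ℕ → k := fun x => if h : x < n then t ⟨x, h⟩ else 0
  have hr : ∀ i : Fin n, r i = (w i).rev := by
    intro i
    exact Equiv.Perm.extendDomain_apply_image (w.trans Fin.revPerm) Fin.equivSubtype i
  have ht : ∀ i : Fin n, t' i = t i := fun i => dif_pos i.2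
  have hr' : ∀ x, n ≤ x → r x = x := fun x hx =>
    Equiv.Perm.extendDomain_apply_not_subtype _ _ (not_lt.2 hx)
  have key := r.involutive_of_descents t' fun x hx => by
    rcases lt_or_ge (x + 1) n with h1 | h1
    · have h2 := hr ⟨x, by omega⟩
      have h3 := hr ⟨x + 1, h1⟩
      have h4 := ht ⟨x, by omega⟩
      have h5 := ht ⟨x + 1, h1⟩
      simp only [Fin.val_rev] at h2 h3 h4 h5
      have h6 := h ⟨x, by omega⟩ ⟨x + 1, h1⟩ rfl (Fin.lt_def.2 (by omega))
      exact ⟨by omega, by rw [h4, h5, h6.2]⟩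
    · exfalso
      rw [hr' _ h1] at hx
      rcases lt_or_ge x n with h2 | h2
      · have h3 := hr ⟨x, h2⟩
        simp only at h3
        omega
      · rw [hr' _ h2] at hx
        omega
  have hinv : ∀ i, (w (w i).rev).rev = i := by
    intro i
    have h1 := (key i).1
    rw [hr, hr] at h1
    exact Fin.ext h1
  have htr : ∀ i, t (w i).rev = t i := by
    intro i
    have h1 := (key i).2
    rwa [hr, ht, ht] at h1
  refine Units.ext (Matrix.ext fun i j => ?_)
  rw [antitranspose_apply, hm, hm]
  by_cases hij : i = w j
  · subst hij
    rw [if_pos rfl, htr, if_pos]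
    rw [← Fin.rev_inj, Fin.rev_rev, hinv]
  · rw [if_neg hij, if_neg]
    intro h1
    apply hij
    rw [← Fin.rev_inj, ← hinv i.rev, ← h1, Fin.rev_rev]

/-- The Gelfand–Graev representation is multiplicity free. -/
lemma IsIrrCharacter.avg_genericChar (hψ : ψ ≠ 1) {χ : GL (Fin n) k → ℂ} (hχ : IsIrrCharacter χ) :
    (avg fun u : unitriangularGroup k n => genericChar ψ n u * χ u) = 0 ∨
      (avg fun u : unitriangularGroup k n => genericChar ψ n u * χ u) = 1 := by
  classical
  have := Fintype.ofFinite (GL (Fin n) k)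
  refine hχ.avg_eq_zero_or_one antitranspose antitranspose_mul antitranspose_antitranspose
    (fun u => ⟨⟨fun i => ?_, fun i j hij => ?_⟩, ?_⟩) fun g => ?_
  · rw [antitranspose_apply]
    exact u.2.1 _
  · rw [antitranspose_apply]
    exact u.2.2 _ _ (Fin.rev_lt_rev.2 hij)
  · exact congrArg ψ (superdiagSum_rev _)
  obtain ⟨u, u', m, w, t, hg, ht, hm⟩ := exists_monomial g
  refine ⟨u, u', m, hg, ?_⟩
  by_cases h : ∀ i j : Fin n, (i : ℕ) + 1 = j → w i < w j → (w i : ℕ) + 1 = w j ∧ t i = t j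
  · exact Or.inl (antitranspose_eq_self w t hm h)
  right
  push Not at h
  obtain ⟨i, j, hij, hw, hne⟩ := h
  have hij' : i < j := Fin.lt_def.2 (by omega)
  obtain ⟨a, ha⟩ : ∃ a : k, ψ (-a * t j) ≠ ψ (if (w i : ℕ) + 1 = w j then -a * t i else 0) := by
    split_ifs with h1
    · by_contra! h2
      apply hψ
      ext x
      have h3 := sub_ne_zero.2 (hne h1)
      have h4 := h2 (x / (t i - t j))
      have h5 : x = -(x / (t i - t j)) * t j - -(x / (t i - t j)) * t i := by
        field_simp
        ring
      rw [h5, AddChar.map_sub_eq_div, h4, AddChar.one_apply, div_self ((ψ.val_isUnit _).ne_zero)]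
    · by_contra! h2
      apply hψ
      ext x
      rw [AddChar.one_apply, ← AddChar.map_zero_eq_one ψ, ← h2 (-x / t j), neg_div, neg_neg,
        div_mul_cancel₀ _ (ht j)]
  have hunit : ∀ (i j : Fin n) (b : k), i < j →
      (1 - vecMulVec (Pi.single i b) (Pi.single j 1)).IsUnitriangular := fun i j b hij =>
    Matrix.IsUnitriangular.one_sub_col fun c hc => by
      rw [Pi.single_eq_of_ne (hij.trans_le hc).ne']
  refine ⟨⟨(hunit i j (a * t j) hij').toGL, hunit _ _ _ hij'⟩,
    ⟨(hunit (w i) (w j) (a * t i) hw).toGL, hunit _ _ _ hw⟩, Units.ext ?_, ?_⟩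
  · change (1 - vecMulVec _ _) * m.val = m.val * (1 - vecMulVec _ _)
    rw [sub_mul, mul_sub, one_mul, mul_one, vecMulVec_mul, mul_vecMulVec, single_one_vecMul]
    congr 1
    ext x y
    rw [vecMulVec_apply, vecMulVec_apply, mulVec_single, row_apply, hm]
    simp only [Pi.smul_apply, col_apply, hm, MulOpposite.smul_eq_mul_unop, MulOpposite.unop_op]
    by_cases hx : x = w i
    · subst hx
      by_cases hy : y = j
      · subst hy
        simp
        ring
      · simp [hy, Ne.symm hy]
    · simp [hx]
  · change ψ (superdiagSum _) ≠ ψ (superdiagSum _)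
    rw [Matrix.IsUnitriangular.val_toGL, Matrix.IsUnitriangular.val_toGL,
      superdiagSum_one_sub _ hij', superdiagSum_one_sub _ hw, if_pos hij]
    simpa only [neg_mul] using ha

end GelfandGraev

section Transport

open CategoryTheory

lemma IsIrrCharacter.comp_mulEquiv {G H : Type} [Group G] [Group H] [Finite G] {χ : G → ℂ}
    (hχ : IsIrrCharacter χ) (φ : H ≃* G) : IsIrrCharacter fun h => χ (φ h) := by
  have := Fintype.ofFinite G
  have : Fintype H := Fintype.ofEquiv G φ.symm.toEquiv
  obtain ⟨V, hV, rfl⟩ := hχ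
  obtain ⟨W, hW⟩ := IsCharacter.comp ⟨V, rfl⟩ φ.toMonoidHom
  refine ⟨W, ?_, hW⟩
  rw [FDRep.simple_iff_char_is_norm_one] at hV ⊢
  rw [hW, Nat.card_congr φ.toEquiv, ← hV]
  refine Fintype.sum_equiv φ.toEquiv _ _ fun h => ?_
  change V.character (φ h) * V.character (φ h⁻¹) = V.character (φ h) * V.character (φ h)⁻¹
  rw [map_inv]

end Transport

section GenericValue

open Matrix

variable {k : Type} [Field k]

/-- The last coordinate, or zero if there is none. -/
def lastCoord : ∀ n : ℕ, (Fin n → k) →ₗ[k] k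
  | 0 => 0
  | n + 1 => LinearMap.proj (Fin.last n)

/-- Appending a coordinate. -/
def snocLinearEquiv (n : ℕ) : ((Fin n → k) × k) ≃ₗ[k] (Fin (n + 1) → k) where
  toFun p := Fin.snoc (α := fun _ => k) p.1 p.2
  invFun v := (Fin.init v, v (Fin.last n))
  left_inv p := by simp
  right_inv v := by simp
  map_add' p q := by
    ext i
    refine Fin.lastCases ?_ (fun i => ?_) i <;> simp
  map_smul' c p := by
    ext i
    refine Fin.lastCases ?_ (fun i => ?_) i <;> simp

/-- Bordering a matrix by a column, a zero row and a one. -/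
def border {n : ℕ} (M : Matrix (Fin n) (Fin n) k) (w : Fin n → k) :
    Matrix (Fin (n + 1)) (Fin (n + 1)) k :=
  Matrix.of (Fin.snoc (α := fun _ => Fin (n + 1) → k)
    (fun a => Fin.snoc (α := fun _ => k) (M a) (w a)) (Fin.snoc (α := fun _ => k) 0 1))

section Border

variable {n : ℕ} (M : Matrix (Fin n) (Fin n) k) (w : Fin n → k)

lemma border_castSucc_castSucc (a b : Fin n) :
    border M w a.castSucc b.castSucc = M a b := by simp [border]

lemma border_castSucc_last (a : Fin n) : border M w a.castSucc (Fin.last n) = w a := by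
  simp [border]

lemma border_last_castSucc (b : Fin n) : border M w (Fin.last n) b.castSucc = 0 := by
  simp [border]

lemma border_last_last : border M w (Fin.last n) (Fin.last n) = 1 := by simp [border]

lemma border_mulVec (v : Fin n → k) (c : k) :
    border M w *ᵥ (snocLinearEquiv n (v, c)) = snocLinearEquiv n (M *ᵥ v + c • w, c) := by
  ext a
  refine Fin.lastCases ?_ (fun a => ?_) a
  · simp [mulVec, dotProduct, Fin.sum_univ_castSucc, snocLinearEquiv, border_last_castSucc,
      border_last_last]
  · simp [mulVec, dotProduct, Fin.sum_univ_castSucc, snocLinearEquiv, border_castSucc_castSucc,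
      border_castSucc_last, mul_comm]

lemma superdiagSum_border : superdiagSum (border M w) = superdiagSum M + lastCoord n w := by
  simp only [superdiagSum, Fin.sum_univ_castSucc, border_castSucc_castSucc, border_castSucc_last,
    border_last_castSucc, Fin.val_castSucc, Fin.val_last, Finset.sum_add_distrib, ite_self,
    Finset.sum_const_zero]
  rw [add_zero, if_neg (by omega), add_zero]
  congr 1
  obtain _ | n := n
  · exact Fin.sum_univ_zero _
  · rw [Fin.sum_univ_castSucc, Finset.sum_eq_zero, zero_add]
    · simp [lastCoord]
    · intro a _
      rw [if_neg]
      simp only [Fin.val_castSucc]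
      omega

variable {M} in
lemma Matrix.IsUnitriangular.border (hM : M.IsUnitriangular) :
    (border M w).IsUnitriangular := by
  refine ⟨fun a => ?_, fun a b hab => ?_⟩
  · refine Fin.lastCases (border_last_last M w) (fun a => ?_) a
    rw [border_castSucc_castSucc, hM.1]
  · induction b using Fin.lastCases with
    | last => exact absurd hab (Fin.le_last _).not_gt
    | cast b =>
      induction a using Fin.lastCases with
      | last => exact border_last_castSucc M w b
      | cast a => rw [border_castSucc_castSucc, hM.2 a b hab]

end Border

variable (k) in
/-- Unitriangular matrices of consecutive sizes. -/
def borderEquiv (n : ℕ) :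
    ({M : Matrix (Fin n) (Fin n) k // M.IsUnitriangular} × (k →ₗ[k] (Fin n → k))) ≃
      {M : Matrix (Fin (n + 1)) (Fin (n + 1)) k // M.IsUnitriangular} where
  toFun p := ⟨border p.1.1 (p.2 1), p.1.2.border _⟩
  invFun M := (⟨M.1.submatrix Fin.castSucc Fin.castSucc, fun a => M.2.1 _,
    fun a b hab => M.2.2 _ _ hab⟩, LinearMap.toSpanSingleton k _ fun a => M.1 a.castSucc (Fin.last n))
  left_inv p := by
    refine Prod.ext (Subtype.ext (Matrix.ext fun a b => border_castSucc_castSucc _ _ a b))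
      (LinearMap.ext_ring ?_)
    ext a
    simp [border_castSucc_last]
  right_inv M := by
    refine Subtype.ext (Matrix.ext fun a b => ?_)
    refine Fin.lastCases ?_ (fun a => ?_) a <;> refine Fin.lastCases ?_ (fun b => ?_) b
    · exact (border_last_last _ _).trans (M.2.1 _).symm
    · exact (border_last_castSucc _ _ b).trans (M.2.2 _ _ (Fin.castSucc_lt_last b)).symm
    · simp [border_castSucc_last]
    · simp [border_castSucc_castSucc]

variable [Finite k] (ψ : AddChar k ℂ)

/-- Iterated descent is an average over the unitriangular group. -/
lemma iterate_descent_eq_avg {h : MarkedFn k} (hh : h.Invariant) (n m : ℕ) :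
    ((descent ψ)^[m + n] h).atZero =
      avg fun M : {M : Matrix (Fin n) (Fin n) k // M.IsUnitriangular} =>
        ψ (superdiagSum M.1) *
          (descent ψ)^[m] h (Fin n → k) (lastCoord n) (Matrix.toLin' M.1) := by
  induction n generalizing m with
  | zero =>
    have : Unique {M : Matrix (Fin 0) (Fin 0) k // M.IsUnitriangular} :=
      ⟨⟨⟨1, .one⟩⟩, fun _ => Subsingleton.elim _ _⟩
    rw [avg_unique, MarkedFn.atZero, add_zero]
    have h1 : superdiagSum (default : {M : Matrix (Fin 0) (Fin 0) k // M.IsUnitriangular}).1 = 0 :=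
      rfl
    rw [h1, AddChar.map_zero_eq_one, one_mul]
    exact hh.iterate_descent ψ m _ _ (default : PUnit ≃ₗ[k] (Fin 0 → k)) _ _ _ _
      (fun _ => rfl) fun _ => Subsingleton.elim _ _
  | succ n ih =>
    rw [← add_assoc, add_right_comm, ih, ← avg_equiv (borderEquiv k n),
      avg_prod (X := {M : Matrix (Fin n) (Fin n) k // M.IsUnitriangular}) (fun M u =>
        ψ (superdiagSum (borderEquiv k n (M, u)).1) * (descent ψ)^[m] h (Fin (n + 1) → k)
          (lastCoord (n + 1)) (Matrix.toLin' (borderEquiv k n (M, u)).1))]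
    refine congrArg avg (funext fun M => ?_)
    rw [Function.iterate_succ_apply', descent, ← avg_mul_left]
    refine congrArg avg (funext fun u => ?_)
    have h1 : superdiagSum (borderEquiv k n (M, u)).1 = superdiagSum M.1 + lastCoord n (u 1) :=
      superdiagSum_border _ _
    rw [h1, AddChar.map_add_eq_mul, mul_assoc]
    congr 2
    refine hh.iterate_descent ψ m _ _ (snocLinearEquiv n) _ _ _ _ (fun p => ?_) fun p => ?_
    · simp [lastCoord, snocLinearEquiv]
    · rw [Matrix.toLin'_apply]
      refine (border_mulVec M.1 (u 1) p.1 p.2).trans ?_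
      congr 1
      simp [blk, ← map_smul]

/-- The general linear group as a group of linear automorphisms. -/
noncomputable def stdAutEquiv (n : ℕ) : GL (Fin n) k ≃* StdAut k n :=
  Matrix.GeneralLinearGroup.toLin.trans (LinearMap.GeneralLinearGroup.generalLinearEquiv k _)

omit [Finite k] in
lemma stdAutEquiv_toLinearMap {n : ℕ} (g : GL (Fin n) k) :
    (stdAutEquiv n g).toLinearMap = Matrix.toLin' g.val := rfl

variable {ψ}

lemma genericValue_eq_zero_or_one (hψ : ψ ≠ 1) (a : IrrLabel k) :
    genericValue ψ a = 0 ∨ genericValue ψ a = 1 := by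
  let E : unitriangularGroup k a.1 ≃ {M : Matrix (Fin a.1) (Fin a.1) k // M.IsUnitriangular} :=
    { toFun := fun u => ⟨u.1.val, u.2⟩
      invFun := fun M => ⟨M.2.toGL, M.2⟩
      left_inv := fun u => Subtype.ext (Units.ext rfl)
      right_inv := fun M => rfl }
  have h1 : genericValue ψ a = avg fun u : unitriangularGroup k a.1 =>
      genericChar ψ a.1 u * a.2.1 (stdAutEquiv a.1 u) := by
    have h2 := iterate_descent_eq_avg ψ a.fn_invariant.mark a.1 0
    rw [zero_add] at h2
    rw [genericValue, h2, ← avg_equiv E]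
    refine congrArg avg (funext fun u => ?_)
    rw [← a.fn_std, stdAutEquiv_toLinearMap]
    rfl
  rw [h1]
  exact (a.2.2.comp_mulEquiv (stdAutEquiv a.1)).avg_genericChar hψ

end GenericValue

section HopfData

variable {k : Type} [Field k] [Finite k] {ψ : AddChar k ℂ}

open Classical in
/-- The irreducible characters of all general linear groups as a basis of a positive self-adjoint
Hopf algebra. -/
noncomputable def hopfData (hψ : ψ ≠ 1) : PSHData (IrrLabel k) :=
  have hc := fun a b e : IrrLabel k => (exists_cof_eq e a b).choose_spec
  have hg : ∀ a : IrrLabel k,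
      ((if genericValue ψ a = 1 then 1 else 0 : ℕ) : ℂ) = genericValue ψ a := fun a => by
    rcases genericValue_eq_zero_or_one hψ a with h | h <;> simp [h]
  have hinj {m n : ℕ} (h : (m : ℂ) = n) : m = n := Nat.cast_injective h
  { deg a := a.1
    ball := labelBall k
    mem_ball := mem_labelBall
    c a b e := (exists_cof_eq e a b).choose
    deg_eq := fun {a b e} h => by
      by_contra h'
      refine h (hinj ?_)
      rw [← hc, cof_eq_zero (Ne.symm h'), Nat.cast_zero]
    one := oneLabel k
    deg_one := rfl
    eq_one := eq_oneLabel
    c_one_left_self a := hinj (by rw [← hc, cof_oneLabel_left, if_pos rfl, Nat.cast_one])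
    c_one_right_self a := hinj (by rw [← hc, cof_oneLabel_right, if_pos rfl, Nat.cast_one])
    c_one_left_ne h := hinj (by rw [← hc, cof_oneLabel_left, if_neg h, Nat.cast_zero])
    c_one_right_ne h := hinj (by rw [← hc, cof_oneLabel_right, if_neg h, Nat.cast_zero])
    assoc h x := hinj (by
      push_cast
      simp only [← hc]
      exact cof_assoc x.fn_invariant h)
    hopf h x y := hinj (by
      push_cast
      simp only [← hc]
      exact cof_hopf h)
    gen a := if genericValue ψ a = 1 then 1 else 0
    gen_le_one a := by split_ifs <;> simp
    gen_one := if_pos genericValue_oneLabel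
    gen_mul h := hinj (by
      rw [Nat.cast_sum]
      simp only [Nat.cast_mul, hg, ← hc]
      exact genericValue_mul hψ h)
    exists_gen := fun {x} h => by
      obtain ⟨s, b, hs, h0, hsb⟩ := exists_genericValue_ne_zero hψ h
      refine ⟨s, b, if_pos ((genericValue_eq_zero_or_one hψ s).resolve_left hs), h0, fun h' => ?_⟩
      exact hsb (by rw [hc, h', Nat.cast_zero]) }

lemma cof_eq_hopfData (hψ : ψ ≠ 1) (a b e : IrrLabel k) :
    cof e.fn a b = (hopfData hψ).c a b e :=
  (exists_cof_eq e a b).choose_spec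

lemma genericValue_eq_hopfData (hψ : ψ ≠ 1) (a : IrrLabel k) :
    genericValue ψ a = (hopfData hψ).gen a := by
  rcases genericValue_eq_zero_or_one hψ a with h | h <;> simp [hopfData, h]

end HopfData

section Functionals

variable {k : Type} [Field k] [Finite k] {ψ : AddChar k ℂ} {S : Subring ℂ}

omit [Finite k] in
lemma inv_card_hom_mem (hS : (Nat.card k : ℂ)⁻¹ ∈ S) (V : Type) [AddCommGroup V] [Module k V]
    [Finite V] : (Nat.card (k →ₗ[k] V) : ℂ)⁻¹ ∈ S := by
  rw [Nat.card_congr (LinearMap.ringLmapEquivSelf k k V).toEquiv,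
    Module.natCard_eq_pow_finrank (K := k), Nat.cast_pow, ← inv_pow]
  exact pow_mem hS _

/-- Iterated descents are given by functionals with coefficients in any ring containing
the inverse of the order of the field and the values of the additive character. -/
lemma exists_functional_iterate_descent (hS : (Nat.card k : ℂ)⁻¹ ∈ S) (hψS : ∀ t, ψ t ∈ S) {n : ℕ}
    (j : ℕ) : ∀ (V : Type) [AddCommGroup V] [Module k V] [Finite V] (l : V →ₗ[k] k)
    (x : Module.End k V), Module.finrank k V + j = n → Function.Injective x →
    ∃ b : StdAut k n → ℂ, (∀ g, b g ∈ S) ∧ ∀ f : EndFn k, f.Invariant →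
      (descent ψ)^[j] f.mark V l x = ∑ g, b g * f (Fin n → k) g.toLinearMap := by
  classical
  induction j with
  | zero =>
    intro V _ _ _ l x hn hx
    obtain rfl : Module.finrank k V = n := hn
    let i : (Fin (Module.finrank k V) → k) ≃ₗ[k] V := (Module.finBasis k V).equivFun.symm
    let g : StdAut k _ := i.trans ((LinearEquiv.ofInjectiveEndo x hx).trans i.symm)
    refine ⟨Pi.single g 1, fun h => ?_, fun f hf => ?_⟩
    · rw [Pi.single_apply]
      split_ifs
      exacts [S.one_mem, S.zero_mem]
    · simp only [Pi.single_apply, ite_mul, one_mul, zero_mul, Finset.sum_ite_eq',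
        Finset.mem_univ, if_true]
      exact (hf _ _ i _ _ fun v => by simp [g]).symm
  | succ j ih =>
    intro V _ _ _ l x hn hx
    have := Fintype.ofFinite (k →ₗ[k] V)
    choose b hb hf using fun u : k →ₗ[k] V => ih (V × k) (LinearMap.snd k V k) (blk x u 1)
      (by rw [Module.finrank_prod, Module.finrank_self]; lia)
      (blk_injective hx Function.injective_id u)
    refine ⟨fun g => avg fun u => ψ (l (u 1)) * b u g, fun g => ?_, fun f h => ?_⟩
    · beta_reduce
      rw [avg_eq_sum]
      exact S.mul_mem (inv_card_hom_mem hS V)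
        (S.sum_mem fun u _ => S.mul_mem (hψS _) (hb u g))
    · rw [Function.iterate_succ_apply']
      simp only [descent, ← avg_mul_right]
      rw [← avg_sum]
      refine congrArg avg (funext fun u => ?_)
      rw [hf u f h, Finset.mul_sum]
      exact Finset.sum_congr rfl fun g _ => by ring

/-- Every irreducible character takes the value `1` under some functional which is integral on
characters. -/
lemma exists_functional (hψ : ψ ≠ 1) (hS : (Nat.card k : ℂ)⁻¹ ∈ S) (hψS : ∀ t, ψ t ∈ S) {n : ℕ} :
    ∀ x : IrrLabel k, x.1 = n → ∃ a : StdAut k n → ℂ, (∀ g, a g ∈ S) ∧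
      (∀ χ, IsIrrCharacter χ → ∃ z : ℤ, ∑ g, a g * χ g = z) ∧
      ∑ g, a g * x.fn (Fin n → k) g.toLinearMap = 1 := by
  classical
  induction n using Nat.strong_induction_on with
  | _ n ih =>
  intro x hx
  rcases Nat.eq_zero_or_pos n with rfl | hn
  · have : Unique (StdAut k 0) := Unique.mk' _
    refine ⟨1, fun _ => S.one_mem, fun χ hχ => ⟨1, ?_⟩, ?_⟩
    · simp [hχ.eq_one_of_subsingleton]
    · obtain rfl := eq_oneLabel hx
      rw [Fintype.sum_unique, Pi.one_apply, one_mul]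
      exact ((oneLabel k).fn_std _).trans (oneLabel_apply _)
  obtain ⟨j, e, hj, hej, he⟩ := (hopfData hψ).exists_derivative (x := x)
    (show 0 < x.1 by lia)
  change e.1 + j = x.1 at hej
  obtain ⟨a, haS, haZ, ha1⟩ := ih e.1 (by lia) e rfl
  have hD : ∀ (x' : IrrLabel k) (y : StdAut k e.1),
      (descent ψ)^[j] x'.fn.mark (Fin e.1 → k) 0 y.toLinearMap = ∑ b ∈ labelBall k n,
        (∑ s ∈ labelBall k n with s.1 = j, (hopfData hψ).gen s * (hopfData hψ).c b s x' : ℕ) *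
          b.fn (Fin e.1 → k) y.toLinearMap := by
    intro x' y
    rw [iterate_descent_fn_eq x' (N := n) (by rw [Module.finrank_fin_fun]; lia) (by lia)
      y.injective]
    push_cast
    simp only [genericValue_eq_hopfData hψ, cof_eq_hopfData hψ]
  choose b hbS hb using fun y : StdAut k e.1 => exists_functional_iterate_descent hS hψS (n := n) j
    (Fin e.1 → k) 0 y.toLinearMap (by rw [Module.finrank_fin_fun]; lia) y.injective
  have hsum : ∀ x' : IrrLabel k,
      ∑ g, (∑ y, a y * b y g) * x'.fn (Fin n → k) g.toLinearMap = ∑ i ∈ labelBall k n,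
        (∑ s ∈ labelBall k n with s.1 = j, (hopfData hψ).gen s * (hopfData hψ).c i s x' : ℕ) *
          ∑ y, a y * i.fn (Fin e.1 → k) y.toLinearMap := by
    intro x'
    simp only [Finset.sum_mul, mul_assoc]
    rw [Finset.sum_comm]
    simp only [← Finset.mul_sum, ← hb _ _ x'.fn_invariant, hD]
    simp only [Finset.mul_sum]
    rw [Finset.sum_comm]
    exact Finset.sum_congr rfl fun i _ => Finset.sum_congr rfl fun y _ => by ring
  refine ⟨fun g => ∑ y, a y * b y g, fun g => S.sum_mem fun y _ => S.mul_mem (haS y) (hbS y g),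
    fun χ hχ => ?_, ?_⟩
  · have h1 := hsum ⟨n, χ, hχ⟩
    rw [show ∑ g, (∑ y, a y * b y g) * χ g = _ from Finset.sum_congr rfl fun g _ =>
      congrArg _ (IrrLabel.fn_std ⟨n, χ, hχ⟩ g).symm, h1]
    have h2 : ∀ i : IrrLabel k, ∃ z : ℤ, ∑ y, a y * i.fn (Fin e.1 → k) y.toLinearMap = z := by
      intro i
      by_cases hi : i.1 = e.1
      · obtain ⟨m, χ', hχ'⟩ := i
        obtain rfl : m = e.1 := hi
        obtain ⟨z, hz⟩ := haZ χ' hχ'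
        refine ⟨z, hz ▸ Finset.sum_congr rfl fun y _ => ?_⟩
        exact congrArg _ (IrrLabel.fn_std ⟨e.1, χ', hχ'⟩ y)
      · refine ⟨0, ?_⟩
        rw [Int.cast_zero]
        refine Finset.sum_eq_zero fun y _ => ?_
        rw [i.fn_eq_zero (by rw [Module.finrank_fin_fun]; exact Ne.symm hi), mul_zero]
    choose z hz using h2
    simp only [hz]
    exact ⟨∑ i ∈ labelBall k n, (∑ s ∈ labelBall k n with s.1 = j,
      (hopfData hψ).gen s * (hopfData hψ).c i s ⟨n, χ, hχ⟩ : ℕ) * z i, by push_cast; rfl⟩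
  · rw [hsum]
    have h3 : ∀ i, ∑ s ∈ labelBall k n with s.1 = j,
        (hopfData hψ).gen s * (hopfData hψ).c i s x = if i = e then 1 else 0 := by
      intro i
      rw [← he i, ← hx]
      rfl
    simp only [h3, Nat.cast_ite, Nat.cast_one, Nat.cast_zero, ite_mul, one_mul, zero_mul]
    rw [Finset.sum_ite_eq', if_pos (mem_labelBall.2 (by lia)), ha1]

end Functionals

section Denominators

/-- The complex numbers which become algebraic integers after multiplication by a power of `q`. -/
def integralAway (q : ℕ) : Subring ℂ where
  carrier := {z | ∃ m : ℕ, IsIntegral ℤ ((q : ℂ) ^ m * z)}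
  one_mem' := ⟨0, by simpa using isIntegral_one⟩
  zero_mem' := ⟨0, by simpa using isIntegral_zero⟩
  mul_mem' := by
    rintro a b ⟨m, hm⟩ ⟨n, hn⟩
    refine ⟨m + n, ?_⟩
    rw [pow_add, mul_mul_mul_comm]
    exact hm.mul hn
  add_mem' := by
    rintro a b ⟨m, hm⟩ ⟨n, hn⟩
    have hq (i : ℕ) : IsIntegral ℤ ((q : ℂ) ^ i) := (isIntegral_algebraMap (x := (q : ℤ))).pow i
    refine ⟨m + n, ?_⟩
    rw [show (q : ℂ) ^ (m + n) * (a + b) = q ^ n * (q ^ m * a) + q ^ m * (q ^ n * b) by ring]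
    exact ((hq n).mul hm).add ((hq m).mul hn)
  neg_mem' := by
    rintro a ⟨m, hm⟩
    exact ⟨m, by simpa using hm.neg⟩

lemma inv_mem_integralAway {q : ℕ} (hq : q ≠ 0) : (q : ℂ)⁻¹ ∈ integralAway q := by
  refine ⟨1, ?_⟩
  rw [pow_one, mul_inv_cancel₀ (Nat.cast_ne_zero.2 hq)]
  exact isIntegral_one

lemma addChar_mem_integralAway {A : Type*} [AddGroup A] [Finite A] (ψ : AddChar A ℂ) (t : A)
    (q : ℕ) : ψ t ∈ integralAway q := by
  refine ⟨0, ?_⟩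
  rw [pow_zero, one_mul]
  refine IsIntegral.of_pow (n := Nat.card A) Nat.card_pos ?_
  rw [← AddChar.map_nsmul_eq_pow, card_nsmul_eq_zero', AddChar.map_zero_eq_one]
  exact isIntegral_one

lemma exists_int_of_mem_integralAway {q : ℕ} {h : ℚ} (hh : (h : ℂ) ∈ integralAway q) :
    ∃ m : ℕ, ∃ z : ℤ, (q : ℚ) ^ m * h = z := by
  obtain ⟨m, hm⟩ := hh
  have h1 : IsIntegral ℤ (algebraMap ℚ ℂ ((q : ℚ) ^ m * h)) := by
    simpa using hm
  obtain ⟨z, hz⟩ := IsIntegrallyClosed.isIntegral_iff.1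
    ((isIntegral_algebraMap_iff (algebraMap ℚ ℂ).injective).1 h1)
  exact ⟨m, z, hz.symm⟩

end Denominators

/-- For a finite field `k` with `q` elements and `n ≥ 1`, `h(GL_n(k)) ∈ ℤ[q⁻¹]`:
some power of `q` clears the denominator of `h(GL_n(k))`. -/
theorem harada_GL_q_inverse (k : Type) [Field k] [Fintype k] (q : ℕ)
    (hq : Fintype.card k = q) (n : ℕ) (hn : 0 < n) :
    ∃ m : ℕ, ∃ z : ℤ, (q : ℚ) ^ m * groupH (GL (Fin n) k) = (z : ℚ) := by
  obtain ⟨ψ, hψ⟩ := AddChar.exists_apply_ne_zero.2 (one_ne_zero : (1 : k) ≠ 0)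
  have hψ1 : ψ ≠ 1 := fun h => hψ (by rw [h, AddChar.one_apply])
  refine exists_int_of_mem_integralAway ?_
  have : Fintype (GL (Fin n) k) := Fintype.ofFinite _
  refine groupH_mem _ fun χ hχ => ?_
  let φ : GL (Fin n) k ≃* StdAut k n := stdAutEquiv n
  have hirr : ∀ χ ∈ irrChars (GL (Fin n) k), IsIrrCharacter fun g => χ (φ.symm g) :=
    fun χ hχ => (mem_irrChars.1 hχ).comp_mulEquiv φ.symm
  obtain ⟨a, haS, haZ, ha1⟩ := exists_functional (S := integralAway q) hψ1
    (by
      rw [Nat.card_eq_fintype_card, hq]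
      exact inv_mem_integralAway (hq ▸ Fintype.card_ne_zero))
    (fun t => addChar_mem_integralAway ψ t q) ⟨n, _, hirr χ hχ⟩ rfl
  have hsum : ∀ χ : GL (Fin n) k → ℂ, ∑ g, a (φ g) * χ g = ∑ g, a g * χ (φ.symm g) := fun χ =>
    Fintype.sum_equiv φ.toEquiv _ _ fun g => by
      simp
  refine ⟨fun g => a (φ g), fun g => haS _, fun χ' hχ' => ?_, ?_⟩
  · obtain ⟨z, hz⟩ := haZ _ (hirr χ' hχ')
    exact ⟨z, (hsum χ').trans hz⟩
  · rw [hsum, ← ha1]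
    exact Finset.sum_congr rfl fun g _ => congrArg _ (IrrLabel.fn_std ⟨n, _, hirr χ hχ⟩ g).symm
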